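/- arXiv:2512.11152 — 3 statements merged into one kernel-verified Lean document; each statement's English description precedes it below -/
import Mathlib

section
/- Let d = 2. There exist η₀ ∈ (0, 1/2) and C ≥ 1 such that: if v is a solution of the hodograph PDE on H₁ = {y : y₂ ≥ 0, |y| ≥ 1} which is bounded from above or from below and satisfies |∇v(y)| ≤ η₀ on H₁, then there exists k ∈ ℝ such that for all y ∈ H₁, |v(y) − k·log|y|| ≤ C·M and |k| ≤ C·M, where M := max_K |v| is the maximum of |v| over K = {y : 1 ≤ |y| ≤ 2, y₂ ≥ 0}. -/
open Real Set Filter MeasureTheory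

noncomputable section

/-- The last index of `Fin d`. -/
def lastIdx (d : ℕ) (hd : 0 < d) : Fin d := ⟨d - 1, by omega⟩

/-- The `i`-th partial derivative of `v` at `y`. -/
def gradC (d : ℕ) (v : EuclideanSpace ℝ (Fin d) → ℝ)
    (y : EuclideanSpace ℝ (Fin d)) (i : Fin d) : ℝ :=
  fderiv ℝ v y (EuclideanSpace.single i 1)

/-- The `(i,j)` entry of the Hessian of `v` at `y`. -/
def hessC (d : ℕ) (v : EuclideanSpace ℝ (Fin d) → ℝ)
    (y : EuclideanSpace ℝ (Fin d)) (i j : Fin d) : ℝ :=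
  fderiv ℝ (fun z => fderiv ℝ v z (EuclideanSpace.single i 1)) y (EuclideanSpace.single j 1)

/-- The squared euclidean norm of the tangential part `p'` of `p`. -/
def tangSq (d : ℕ) (hd : 0 < d) (p : Fin d → ℝ) : ℝ :=
  ∑ m : Fin d, if m = lastIdx d hd then 0 else (p m) ^ 2

/-- The coefficient matrix `A(p)` of the hodograph PDE. -/
def hodA (d : ℕ) (hd : 0 < d) (p : Fin d → ℝ) (i j : Fin d) : ℝ :=
  if i = lastIdx d hd then
    (if j = lastIdx d hd then (1 + tangSq d hd p) / (1 + p (lastIdx d hd)) ^ 2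
     else p j / (1 + p (lastIdx d hd)))
  else
    (if j = lastIdx d hd then p i / (1 + p (lastIdx d hd))
     else if i = j then 1 else 0)

/-- The boundary nonlinearity `N(p') = √(1 + |p'|²) - 1`. -/
def hodN (d : ℕ) (hd : 0 < d) (p : Fin d → ℝ) : ℝ :=
  Real.sqrt (1 + tangSq d hd p) - 1

/-- The quantity `tr(A(∇v(y)) D²v(y))`. -/
def hodOp (d : ℕ) (hd : 0 < d) (v : EuclideanSpace ℝ (Fin d) → ℝ)
    (y : EuclideanSpace ℝ (Fin d)) : ℝ :=
  ∑ i : Fin d, ∑ j : Fin d, hodA d hd (fun m => gradC d v y m) i j * hessC d v y i j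

/-- `v` is `C^∞` on an open neighborhood of `U`. -/
def SmoothNear (d : ℕ) (v : EuclideanSpace ℝ (Fin d) → ℝ)
    (U : Set (EuclideanSpace ℝ (Fin d))) : Prop :=
  ∃ W : Set (EuclideanSpace ℝ (Fin d)), IsOpen W ∧ U ⊆ W ∧ ContDiffOn ℝ (⊤ : ℕ∞) v W

/-- `v` is a (classical) solution of the hodograph PDE on `U`. -/
def IsHodSol (d : ℕ) (hd : 0 < d) (v : EuclideanSpace ℝ (Fin d) → ℝ)
    (U : Set (EuclideanSpace ℝ (Fin d))) : Prop :=
  SmoothNear d v U ∧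
  (∀ y ∈ U, 0 < y (lastIdx d hd) → hodOp d hd v y = 0) ∧
  (∀ y ∈ U, y (lastIdx d hd) = 0 →
    gradC d v y (lastIdx d hd) = hodN d hd (fun m => gradC d v y m))

/-- `v` is a subsolution of the hodograph PDE on `U`. -/
def IsHodSubsol (d : ℕ) (hd : 0 < d) (v : EuclideanSpace ℝ (Fin d) → ℝ)
    (U : Set (EuclideanSpace ℝ (Fin d))) : Prop :=
  SmoothNear d v U ∧
  (∀ y ∈ U, 0 < y (lastIdx d hd) → 0 ≤ hodOp d hd v y) ∧
  (∀ y ∈ U, y (lastIdx d hd) = 0 →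
    hodN d hd (fun m => gradC d v y m) ≤ gradC d v y (lastIdx d hd))

/-- `v` is a supersolution of the hodograph PDE on `U`. -/
def IsHodSupersol (d : ℕ) (hd : 0 < d) (v : EuclideanSpace ℝ (Fin d) → ℝ)
    (U : Set (EuclideanSpace ℝ (Fin d))) : Prop :=
  SmoothNear d v U ∧
  (∀ y ∈ U, 0 < y (lastIdx d hd) → hodOp d hd v y ≤ 0) ∧
  (∀ y ∈ U, y (lastIdx d hd) = 0 →
    gradC d v y (lastIdx d hd) ≤ hodN d hd (fun m => gradC d v y m))

/-- The exterior half-space domain `H₁ = {y : y_d ≥ 0, |y| ≥ 1}`. -/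
def extDom (d : ℕ) (hd : 0 < d) : Set (EuclideanSpace ℝ (Fin d)) :=
  {y | 0 ≤ y (lastIdx d hd) ∧ 1 ≤ ‖y‖}

/-- The half annulus `A_r = {y : 1 ≤ |y| ≤ r, y_d ≥ 0}`. -/
def halfAnn (d : ℕ) (hd : 0 < d) (r : ℝ) : Set (EuclideanSpace ℝ (Fin d)) :=
  {y | 0 ≤ y (lastIdx d hd) ∧ 1 ≤ ‖y‖ ∧ ‖y‖ ≤ r}

/-- The upper half sphere `∂B_ρ⁺ = {y : y_d ≥ 0, |y| = ρ}`. -/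
def upSphere (d : ℕ) (hd : 0 < d) (ρ : ℝ) : Set (EuclideanSpace ℝ (Fin d)) :=
  {y | 0 ≤ y (lastIdx d hd) ∧ ‖y‖ = ρ}

/-- The filter of `|y| → ∞` within `H₁`. -/
def farFilter (d : ℕ) (hd : 0 < d) : Filter (EuclideanSpace ℝ (Fin d)) :=
  (Filter.comap (fun y : EuclideanSpace ℝ (Fin d) => ‖y‖) Filter.atTop) ⊓
    Filter.principal (extDom d hd)

/-- `g` has first partial derivatives `a`, `b` at `z`. -/
def HasGradAt (g : ℝ × ℝ → ℝ) (a b : ℝ) (z : ℝ × ℝ) : Prop :=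
  HasFDerivAt g (a • ContinuousLinearMap.fst ℝ ℝ ℝ + b • ContinuousLinearMap.snd ℝ ℝ ℝ) z

theorem HasGradAt.congr_val {g : ℝ × ℝ → ℝ} {a b a' b' : ℝ} {z : ℝ × ℝ}
    (h : HasGradAt g a b z) (ha : a = a') (hb : b = b') : HasGradAt g a' b' z := by
  subst ha hb; exact h

theorem HasFDerivAt.hasGradAt {g : ℝ × ℝ → ℝ} {L : ℝ × ℝ →L[ℝ] ℝ} {a b : ℝ} {z : ℝ × ℝ}
    (h : HasFDerivAt g L z) (ha : L (1, 0) = a) (hb : L (0, 1) = b) : HasGradAt g a b z :=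
  h.congr_fderiv (by ext <;> simp [ha, hb])

theorem hasGradAt_const (c : ℝ) (z : ℝ × ℝ) : HasGradAt (fun _ => c) 0 0 z :=
  (hasFDerivAt_const (𝕜 := ℝ) c z).hasGradAt (by simp) (by simp)

theorem hasGradAt_fst (z : ℝ × ℝ) : HasGradAt (fun w => w.1) 1 0 z :=
  (hasFDerivAt_fst (𝕜 := ℝ) (p := z)).hasGradAt (by simp) (by simp)

theorem hasGradAt_snd (z : ℝ × ℝ) : HasGradAt (fun w => w.2) 0 1 z :=
  (hasFDerivAt_snd (𝕜 := ℝ) (p := z)).hasGradAt (by simp) (by simp)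

theorem HasGradAt.add {g h : ℝ × ℝ → ℝ} {a b c d : ℝ} {z : ℝ × ℝ}
    (hg : HasGradAt g a b z) (hh : HasGradAt h c d z) :
    HasGradAt (fun w => g w + h w) (a + c) (b + d) z :=
  (HasFDerivAt.add hg hh).hasGradAt (by simp) (by simp)

theorem HasGradAt.mul {g h : ℝ × ℝ → ℝ} {a b c d : ℝ} {z : ℝ × ℝ}
    (hg : HasGradAt g a b z) (hh : HasGradAt h c d z) :
    HasGradAt (fun w => g w * h w) (a * h z + g z * c) (b * h z + g z * d) z :=
  (HasFDerivAt.mul hg hh).hasGradAt (by simp; ring) (by simp; ring)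

theorem HasGradAt.const_mul {g : ℝ × ℝ → ℝ} {a b : ℝ} {z : ℝ × ℝ}
    (k : ℝ) (hg : HasGradAt g a b z) :
    HasGradAt (fun w => k * g w) (k * a) (k * b) z := by
  refine ((hasGradAt_const k z).mul hg).congr_val ?_ ?_ <;> ring

theorem HasGradAt.neg {g : ℝ × ℝ → ℝ} {a b : ℝ} {z : ℝ × ℝ}
    (hg : HasGradAt g a b z) : HasGradAt (fun w => -g w) (-a) (-b) z :=
  (HasFDerivAt.neg hg).hasGradAt (by simp) (by simp)

theorem HasGradAt.sub {g h : ℝ × ℝ → ℝ} {a b c d : ℝ} {z : ℝ × ℝ}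
    (hg : HasGradAt g a b z) (hh : HasGradAt h c d z) :
    HasGradAt (fun w => g w - h w) (a - c) (b - d) z :=
  (HasFDerivAt.sub hg hh).hasGradAt (by simp) (by simp)

/-- Post-composition with a real function. -/
theorem HasGradAt.comp {g : ℝ × ℝ → ℝ} {a b : ℝ} {z : ℝ × ℝ} {f : ℝ → ℝ} {f' : ℝ}
    (hg : HasGradAt g a b z) (hf : HasDerivAt f f' (g z)) :
    HasGradAt (fun w => f (g w)) (f' * a) (f' * b) z :=
  HasFDerivAt.hasGradAt (hf.comp_hasFDerivAt z hg) (by simp) (by simp)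

/-- Restriction to a differentiable curve. -/
theorem HasGradAt.comp_curve {g : ℝ × ℝ → ℝ} {a b : ℝ} {α β : ℝ → ℝ} {α' β' t : ℝ}
    (hg : HasGradAt g a b (α t, β t)) (hα : HasDerivAt α α' t) (hβ : HasDerivAt β β' t) :
    HasDerivAt (fun s => g (α s, β s)) (a * α' + b * β') t := by
  have := HasFDerivAt.comp_hasDerivAt (f := fun s => (α s, β s)) t hg (hα.prodMk hβ)
  exact this.congr_deriv (by simp)

theorem HasGradAt.continuousAt {g : ℝ × ℝ → ℝ} {a b : ℝ} {z : ℝ × ℝ}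
    (hg : HasGradAt g a b z) : ContinuousAt g z := HasFDerivAt.continuousAt hg

theorem HasGradAt.unique {g : ℝ × ℝ → ℝ} {a b c d : ℝ} {z : ℝ × ℝ}
    (hg : HasGradAt g a b z) (hh : HasGradAt g c d z) : a = c ∧ b = d := by
  have h := HasFDerivAt.unique hg hh
  have h1 := congrArg (fun L : ℝ × ℝ →L[ℝ] ℝ => L (1, 0)) h
  have h2 := congrArg (fun L : ℝ × ℝ →L[ℝ] ℝ => L (0, 1)) h
  simpa using And.intro h1 h2

/-- `g` is twice differentiable on `U`, with the displayed partial derivatives. -/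
structure Jet2On (U : Set (ℝ × ℝ)) (g gx gy gxx gxy gyy : ℝ × ℝ → ℝ) : Prop where
  grad : ∀ z ∈ U, HasGradAt g (gx z) (gy z) z
  gradx : ∀ z ∈ U, HasGradAt gx (gxx z) (gxy z) z
  grady : ∀ z ∈ U, HasGradAt gy (gxy z) (gyy z) z

namespace Jet2On
variable {U : Set (ℝ × ℝ)} {g gx gy gxx gxy gyy h hx hy hxx hxy hyy : ℝ × ℝ → ℝ}

theorem add (hg : Jet2On U g gx gy gxx gxy gyy) (hh : Jet2On U h hx hy hxx hxy hyy) :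
    Jet2On U (fun z => g z + h z) (fun z => gx z + hx z) (fun z => gy z + hy z)
      (fun z => gxx z + hxx z) (fun z => gxy z + hxy z) (fun z => gyy z + hyy z) :=
  ⟨fun z hz => (hg.grad z hz).add (hh.grad z hz), fun z hz => (hg.gradx z hz).add (hh.gradx z hz),
    fun z hz => (hg.grady z hz).add (hh.grady z hz)⟩

theorem const_mul (k : ℝ) (hg : Jet2On U g gx gy gxx gxy gyy) :
    Jet2On U (fun z => k * g z) (fun z => k * gx z) (fun z => k * gy z)
      (fun z => k * gxx z) (fun z => k * gxy z) (fun z => k * gyy z) :=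
  ⟨fun z hz => (hg.grad z hz).const_mul k, fun z hz => (hg.gradx z hz).const_mul k,
    fun z hz => (hg.grady z hz).const_mul k⟩

theorem neg (hg : Jet2On U g gx gy gxx gxy gyy) :
    Jet2On U (fun z => -g z) (fun z => -gx z) (fun z => -gy z)
      (fun z => -gxx z) (fun z => -gxy z) (fun z => -gyy z) :=
  ⟨fun z hz => (hg.grad z hz).neg, fun z hz => (hg.gradx z hz).neg,
    fun z hz => (hg.grady z hz).neg⟩

theorem mono {U' : Set (ℝ × ℝ)} (hU : U' ⊆ U) (hg : Jet2On U g gx gy gxx gxy gyy) :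
    Jet2On U' g gx gy gxx gxy gyy :=
  ⟨fun z hz => hg.grad z (hU hz), fun z hz => hg.gradx z (hU hz), fun z hz => hg.grady z (hU hz)⟩

end Jet2On

theorem jet2On_exp_snd (U : Set (ℝ × ℝ)) (l : ℝ) :
    Jet2On U (fun z => exp (l * z.2)) (fun _ => 0) (fun z => l * exp (l * z.2))
      (fun _ => 0) (fun _ => 0) (fun z => l * (l * exp (l * z.2))) := by
  have h : ∀ z : ℝ × ℝ, HasGradAt (fun z => exp (l * z.2)) 0 (l * exp (l * z.2)) z := fun z =>
    (((hasGradAt_snd z).const_mul l).comp (Real.hasDerivAt_exp _)).congr_val (by ring) (by ring)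
  exact ⟨fun z _ => h z, fun z _ => hasGradAt_const 0 z,
    fun z _ => ((h z).const_mul l).congr_val (by ring) rfl⟩

theorem deriv_two_nonpos_of_isLocalMax {f f' : ℝ → ℝ} {f'' x : ℝ} (hmax : IsLocalMax f x)
    (h1 : ∀ᶠ y in nhds x, HasDerivAt f (f' y) y) (h2 : HasDerivAt f' f'' x) : f'' ≤ 0 := by
  by_contra! hpos
  have e1 : deriv f =ᶠ[nhds x] f' := h1.mono fun y hy => hy.deriv
  have hd : deriv (deriv f) x = f'' := by rw [e1.deriv_eq, h2.deriv]
  have hmin : IsLocalMin f x :=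
    isLocalMin_of_deriv_deriv_pos (hd ▸ hpos) hmax.deriv_eq_zero h1.self_of_nhds.continuousAt
  have hc : f =ᶠ[nhds x] fun _ => f x := by
    filter_upwards [hmax, hmin] with y h1 h2 using le_antisymm h1 h2
  have h0 : deriv f =ᶠ[nhds x] fun _ => 0 := hc.deriv.trans (by simp)
  rw [h0.deriv_eq] at hd
  simp at hd
  linarith

/-- The closed half annulus, in terms of squared radii. -/
def sqAnn (ρ₁ ρ₂ : ℝ) : Set (ℝ × ℝ) :=
  {z | 0 ≤ z.2 ∧ ρ₁ ≤ z.1 ^ 2 + z.2 ^ 2 ∧ z.1 ^ 2 + z.2 ^ 2 ≤ ρ₂}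

theorem isCompact_sqAnn (ρ₁ ρ₂ : ℝ) : IsCompact (sqAnn ρ₁ ρ₂) := by
  refine (isCompact_Icc (a := ((-√ρ₂, -√ρ₂) : ℝ × ℝ)) (b := (√ρ₂, √ρ₂))).of_isClosed_subset ?_ ?_
  · have hc : Continuous fun z : ℝ × ℝ => z.1 ^ 2 + z.2 ^ 2 := by fun_prop
    exact (isClosed_le continuous_const continuous_snd).inter
      ((isClosed_le continuous_const hc).inter (isClosed_le hc continuous_const))
  · rintro ⟨x, y⟩ ⟨-, -, h⟩
    simp only at h
    have h1 := abs_le.1 (Real.abs_le_sqrt (show x ^ 2 ≤ ρ₂ by nlinarith [sq_nonneg y]))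
    have h2 := abs_le.1 (Real.abs_le_sqrt (show y ^ 2 ≤ ρ₂ by nlinarith [sq_nonneg x]))
    exact ⟨⟨h1.1, h2.1⟩, ⟨h1.2, h2.2⟩⟩

section
variable {U : Set (ℝ × ℝ)} {g gx gy gxx gxy gyy : ℝ × ℝ → ℝ}

theorem Jet2On.second_le_zero (hU : IsOpen U) (hg : Jet2On U g gx gy gxx gxy gyy)
    {z : ℝ × ℝ} (hz : z ∈ U) (hmax : IsLocalMax g z) (m n : ℝ) :
    gxx z * m ^ 2 + 2 * gxy z * m * n + gyy z * n ^ 2 ≤ 0 := by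
  have hc : ∀ s, HasDerivAt (fun s : ℝ => z.1 + s * m) m s := fun s => by
    simpa using ((hasDerivAt_id s).mul_const m).const_add z.1
  have hc' : ∀ s, HasDerivAt (fun s : ℝ => z.2 + s * n) n s := fun s => by
    simpa using ((hasDerivAt_id s).mul_const n).const_add z.2
  have hz0 : (z.1 + 0 * m, z.2 + 0 * n) = z := by simp
  have hcont : ContinuousAt (fun s : ℝ => (z.1 + s * m, z.2 + s * n)) 0 := by fun_prop
  have hev : ∀ᶠ s : ℝ in nhds 0, (z.1 + s * m, z.2 + s * n) ∈ U :=
    hcont.eventually (by simpa using hU.mem_nhds hz)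
  have hloc : IsLocalMax (fun s : ℝ => g (z.1 + s * m, z.2 + s * n)) 0 := by
    have : ∀ᶠ w in nhds (z.1 + 0 * m, z.2 + 0 * n), g w ≤ g z := by rw [hz0]; exact hmax
    filter_upwards [hcont.eventually this] with s hs
    simpa using hs
  have hx := (hg.gradx z hz)
  have hy := (hg.grady z hz)
  have h := deriv_two_nonpos_of_isLocalMax hloc
    (f' := fun s => gx (z.1 + s * m, z.2 + s * n) * m + gy (z.1 + s * m, z.2 + s * n) * n)
    (hev.mono fun s hs => (hg.grad _ hs).comp_curve (hc s) (hc' s))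
    (((HasGradAt.comp_curve (by rw [hz0]; exact hx) (hc 0) (hc' 0)).mul_const m).add
      ((HasGradAt.comp_curve (by rw [hz0]; exact hy) (hc 0) (hc' 0)).mul_const n))
  nlinarith [h]

/-- Maximum principle on half annuli with an oblique condition on the flat part. -/
theorem max_principle (hU : IsOpen U) (hg : Jet2On U g gx gy gxx gxy gyy)
    {ρ₁ ρ₂ B D : ℝ} (hS : sqAnn ρ₁ ρ₂ ⊆ U) {a b d₁ d₂ β : ℝ × ℝ → ℝ}
    (hell : ∀ z ∈ sqAnn ρ₁ ρ₂, a z ^ 2 ≤ b z) (hb : ∀ z ∈ sqAnn ρ₁ ρ₂, 1 / 4 ≤ b z)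
    (hd : ∀ z ∈ sqAnn ρ₁ ρ₂, |d₂ z| ≤ D)
    (hsub : ∀ z ∈ sqAnn ρ₁ ρ₂, 0 < z.2 →
      0 ≤ gxx z + 2 * a z * gxy z + b z * gyy z + d₁ z * gx z + d₂ z * gy z)
    (hbd : ∀ z ∈ sqAnn ρ₁ ρ₂, z.2 = 0 → g z ≤ B ∨ 0 ≤ gy z + β z * gx z)
    (harc₁ : ∀ z ∈ sqAnn ρ₁ ρ₂, z.1 ^ 2 + z.2 ^ 2 = ρ₁ → g z ≤ B)
    (harc₂ : ∀ z ∈ sqAnn ρ₁ ρ₂, z.1 ^ 2 + z.2 ^ 2 = ρ₂ → g z ≤ B) :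
    ∀ z ∈ sqAnn ρ₁ ρ₂, g z ≤ B := by
  intro z₁ hz₁
  have hD : 0 ≤ D := (abs_nonneg _).trans (hd z₁ hz₁)
  set l := 4 * D + 1 with hl
  have key : ∀ e > 0, g z₁ ≤ B + e * exp (l * √ρ₂) := by
    intro e he
    have hG := hg.add ((jet2On_exp_snd U l).const_mul e)
    have hcont : ContinuousOn (fun z => g z + e * exp (l * z.2)) (sqAnn ρ₁ ρ₂) := fun z hz =>
      (hG.grad z (hS hz)).continuousAt.continuousWithinAt
    obtain ⟨z, hz, hmax⟩ := (isCompact_sqAnn ρ₁ ρ₂).exists_isMaxOn ⟨z₁, hz₁⟩ hcont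
    have hm : ∀ w ∈ sqAnn ρ₁ ρ₂, g w + e * exp (l * w.2) ≤ g z + e * exp (l * z.2) :=
      fun w hw => hmax hw
    have hfin : g z ≤ B → g z₁ ≤ B + e * exp (l * √ρ₂) := by
      intro hB
      have h1 := hm z₁ hz₁
      have h2 : z.2 ≤ √ρ₂ := by
        apply Real.le_sqrt_of_sq_le
        nlinarith [hz.2.2, sq_nonneg z.1]
      have h3 : exp (l * z.2) ≤ exp (l * √ρ₂) := by
        apply Real.exp_le_exp.2; gcongr
      have h4 := exp_pos (l * z₁.2)
      nlinarith [mul_pos he h4]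
    rcases eq_or_ne (z.1 ^ 2 + z.2 ^ 2) ρ₁ with h1 | h1
    · exact hfin (harc₁ z hz h1)
    rcases eq_or_ne (z.1 ^ 2 + z.2 ^ 2) ρ₂ with h2 | h2
    · exact hfin (harc₂ z hz h2)
    have h1' : ρ₁ < z.1 ^ 2 + z.2 ^ 2 := lt_of_le_of_ne hz.2.1 (Ne.symm h1)
    have h2' : z.1 ^ 2 + z.2 ^ 2 < ρ₂ := lt_of_le_of_ne hz.2.2 h2
    have hnear : ∀ᶠ w : ℝ × ℝ in nhds z, ρ₁ < w.1 ^ 2 + w.2 ^ 2 ∧ w.1 ^ 2 + w.2 ^ 2 < ρ₂ :=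
      (((by fun_prop : Continuous fun w : ℝ × ℝ => w.1 ^ 2 + w.2 ^ 2).tendsto z).eventually
        (lt_mem_nhds h1')).and
      (((by fun_prop : Continuous fun w : ℝ × ℝ => w.1 ^ 2 + w.2 ^ 2).tendsto z).eventually
        (gt_mem_nhds h2'))
    have hgrad := hG.grad z (hS hz)
    have hE := exp_pos (l * z.2)
    rcases hz.1.lt_or_eq with hy | hy
    · exfalso
      have hloc : IsLocalMax (fun z => g z + e * exp (l * z.2)) z := by
        filter_upwards [hnear, (continuous_snd.tendsto z).eventually (lt_mem_nhds hy)] with w hw hw2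
        exact hm w ⟨hw2.le, hw.1.le, hw.2.le⟩
      have q1 := hG.second_le_zero hU (hS hz) hloc 1 (a z)
      have q2 := hG.second_le_zero hU (hS hz) hloc 0 1
      have hfd := hloc.hasFDerivAt_eq_zero hgrad
      have f1 := congrArg (fun L : ℝ × ℝ →L[ℝ] ℝ => L (1, 0)) hfd
      have f2 := congrArg (fun L : ℝ × ℝ →L[ℝ] ℝ => L (0, 1)) hfd
      simp at f1 f2
      have hs := hsub z hz hy
      have hell' := hell z hz
      have hb' := hb z hz
      have hd' := (abs_le.1 (hd z hz)).1
      have q3 : 0 ≤ (b z - a z ^ 2) * -(gyy z + e * (l * (l * exp (l * z.2)))) := by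
        apply mul_nonneg <;> nlinarith
      have hgy : gy z = -(e * (l * exp (l * z.2))) := by linarith
      rw [f1, hgy] at hs
      have hlp : 0 < l := by linarith
      have : 0 < e * l * exp (l * z.2) := by positivity
      have q4 : 0 < (e * l * exp (l * z.2)) * (b z * l + d₂ z) := by
        apply mul_pos this; nlinarith
      nlinarith
    · rcases hbd z hz hy.symm with hB | hob
      · exact hfin hB
      exfalso
      have hX : HasDerivAt (fun s : ℝ => g (z.1 + s, z.2) + e * exp (l * z.2)) (gx z) 0 := by
        have := HasGradAt.comp_curve (t := 0) (α := fun s : ℝ => z.1 + s) (β := fun _ => z.2)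
          (by simpa using hgrad) ((hasDerivAt_id (0 : ℝ)).const_add _) (hasDerivAt_const _ _)
        simpa using this
      have hlx : IsLocalMax (fun s : ℝ => g (z.1 + s, z.2) + e * exp (l * z.2)) 0 := by
        have hc : ContinuousAt (fun s : ℝ => (z.1 + s, z.2)) 0 := by fun_prop
        have := hc.eventually (p := fun w => ρ₁ < w.1 ^ 2 + w.2 ^ 2 ∧ w.1 ^ 2 + w.2 ^ 2 < ρ₂)
          (by simpa only [add_zero] using hnear)
        filter_upwards [this] with s hs
        simpa using hm (z.1 + s, z.2) ⟨hz.1, hs.1.le, hs.2.le⟩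
      have gx0 : gx z = 0 := hlx.hasDerivAt_eq_zero hX
      have hY : HasDerivAt (fun s : ℝ => g (z.1, z.2 + s) + e * exp (l * (z.2 + s)))
          (gy z + e * (l * exp (l * z.2))) 0 := by
        have := HasGradAt.comp_curve (t := 0) (α := fun _ : ℝ => z.1) (β := fun s => z.2 + s)
          (by simpa using hgrad) (hasDerivAt_const _ _) ((hasDerivAt_id (0 : ℝ)).const_add _)
        simpa using this
      have hly : ∀ᶠ s : ℝ in nhdsWithin 0 (Ioi (0 : ℝ)),
          slope (fun s : ℝ => g (z.1, z.2 + s) + e * exp (l * (z.2 + s))) 0 s ≤ 0 := by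
        have hc : ContinuousAt (fun s : ℝ => (z.1, z.2 + s)) 0 := by fun_prop
        have := hc.eventually (p := fun w => ρ₁ < w.1 ^ 2 + w.2 ^ 2 ∧ w.1 ^ 2 + w.2 ^ 2 < ρ₂)
          (by simpa only [add_zero] using hnear)
        filter_upwards [nhdsWithin_le_nhds this, self_mem_nhdsWithin] with s hs hs0
        have hs0' : 0 < s := hs0
        have := hm (z.1, z.2 + s) ⟨by simp only; linarith [hz.1], hs.1.le, hs.2.le⟩
        rw [slope_def_field]
        apply div_nonpos_of_nonpos_of_nonneg
        · simp only [add_zero] at this ⊢; linarith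
        · linarith
      have ht := (hasDerivAt_iff_tendsto_slope.1 hY).mono_left
        (nhdsWithin_mono 0 (fun s (hs : s ∈ Ioi (0 : ℝ)) => (ne_of_gt hs : s ≠ 0)))
      have hle := le_of_tendsto ht hly
      rw [gx0] at hob
      have : 0 < e * (l * exp (l * z.2)) := by
        have hlp : 0 < l := by linarith
        positivity
      linarith
  have hlim : Tendsto (fun e : ℝ => B + e * exp (l * √ρ₂)) (nhdsWithin 0 (Ioi 0)) (nhds B) := by
    have : ContinuousAt (fun e : ℝ => B + e * exp (l * √ρ₂)) 0 := by fun_prop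
    have h := this.tendsto.mono_left (nhdsWithin_le_nhds (s := Ioi 0))
    simpa using h
  exact ge_of_tendsto hlim (by filter_upwards [self_mem_nhdsWithin] with e he using key e he)

/-- The reciprocal of the Euclidean norm. -/
def invRad (z : ℝ × ℝ) : ℝ := (√(z.1 ^ 2 + z.2 ^ 2))⁻¹

/-- The punctured plane. -/
def punctured : Set (ℝ × ℝ) := {z | 0 < z.1 ^ 2 + z.2 ^ 2}

theorem isOpen_punctured : IsOpen punctured :=
  isOpen_lt continuous_const (by fun_prop)

theorem invRad_sq {z : ℝ × ℝ} : invRad z ^ 2 = (z.1 ^ 2 + z.2 ^ 2)⁻¹ := by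
  unfold invRad
  rw [inv_pow, Real.sq_sqrt (by positivity)]

theorem invRad_pos {z : ℝ × ℝ} (hz : z ∈ punctured) : 0 < invRad z :=
  inv_pos.2 (Real.sqrt_pos.2 hz)

theorem sq_add_sq_mul_invRad {z : ℝ × ℝ} (hz : z ∈ punctured) :
    (z.1 * invRad z) ^ 2 + (z.2 * invRad z) ^ 2 = 1 := by
  have h : (z.1 ^ 2 + z.2 ^ 2) ≠ 0 := ne_of_gt hz
  rw [mul_pow, mul_pow, invRad_sq, ← add_mul, mul_inv_cancel₀ h]

theorem hasGradAt_sqrt_normSq {z : ℝ × ℝ} (hz : z ∈ punctured) :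
    HasGradAt (fun w => √(w.1 ^ 2 + w.2 ^ 2)) (z.1 * invRad z) (z.2 * invRad z) z := by
  have h1 : HasGradAt (fun w : ℝ × ℝ => w.1 * w.1 + w.2 * w.2) (2 * z.1) (2 * z.2) z :=
    (((hasGradAt_fst z).mul (hasGradAt_fst z)).add
      ((hasGradAt_snd z).mul (hasGradAt_snd z))).congr_val (by ring) (by ring)
  have h2 : HasGradAt (fun w : ℝ × ℝ => w.1 ^ 2 + w.2 ^ 2) (2 * z.1) (2 * z.2) z := by
    simpa only [sq] using h1
  have hne : z.1 ^ 2 + z.2 ^ 2 ≠ 0 := ne_of_gt hz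
  refine (h2.comp (Real.hasDerivAt_sqrt hne)).congr_val ?_ ?_ <;>
  · unfold invRad
    have := (Real.sqrt_pos.2 hz).ne'
    field_simp

theorem hasGradAt_invRad {z : ℝ × ℝ} (hz : z ∈ punctured) :
    HasGradAt invRad (-(z.1 * invRad z ^ 3)) (-(z.2 * invRad z ^ 3)) z := by
  have hne := (Real.sqrt_pos.2 hz).ne'
  refine ((hasGradAt_sqrt_normSq hz).comp (hasDerivAt_inv hne)).congr_val ?_ ?_ <;>
  · unfold invRad
    field_simp

theorem jet2On_log_rad : Jet2On punctured (fun z => log √(z.1 ^ 2 + z.2 ^ 2))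
    (fun z => z.1 * (invRad z * invRad z)) (fun z => z.2 * (invRad z * invRad z))
    (fun z => invRad z ^ 2 - 2 * z.1 ^ 2 * invRad z ^ 4)
    (fun z => -(2 * z.1 * z.2 * invRad z ^ 4))
    (fun z => invRad z ^ 2 - 2 * z.2 ^ 2 * invRad z ^ 4) := by
  refine ⟨fun z hz => ?_, fun z hz => ?_, fun z hz => ?_⟩
  · have hne := (Real.sqrt_pos.2 hz).ne'
    refine ((hasGradAt_sqrt_normSq hz).comp (Real.hasDerivAt_log hne)).congr_val ?_ ?_ <;>
    · unfold invRad
      ring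
  · exact ((hasGradAt_fst z).mul ((hasGradAt_invRad hz).mul (hasGradAt_invRad hz))).congr_val
      (by ring) (by ring)
  · exact ((hasGradAt_snd z).mul ((hasGradAt_invRad hz).mul (hasGradAt_invRad hz))).congr_val
      (by ring) (by ring)

theorem jet2On_invRad : Jet2On punctured invRad
    (fun z => -(z.1 * (invRad z * (invRad z * invRad z))))
    (fun z => -(z.2 * (invRad z * (invRad z * invRad z))))
    (fun z => -invRad z ^ 3 + 3 * z.1 ^ 2 * invRad z ^ 5)
    (fun z => 3 * z.1 * z.2 * invRad z ^ 5)
    (fun z => -invRad z ^ 3 + 3 * z.2 ^ 2 * invRad z ^ 5) := by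
  refine ⟨fun z hz => (hasGradAt_invRad hz).congr_val (by ring) (by ring),
    fun z hz => ?_, fun z hz => ?_⟩
  · have h := hasGradAt_invRad hz
    exact ((hasGradAt_fst z).mul (h.mul (h.mul h))).neg.congr_val (by ring) (by ring)
  · have h := hasGradAt_invRad hz
    exact ((hasGradAt_snd z).mul (h.mul (h.mul h))).neg.congr_val (by ring) (by ring)

theorem jet2On_snd_mul_invRad_sq : Jet2On punctured (fun z => z.2 * (invRad z * invRad z))
    (fun z => -2 * (z.1 * (z.2 * ((invRad z * invRad z) * (invRad z * invRad z)))))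
    (fun z => invRad z * invRad z
      + -2 * (z.2 * (z.2 * ((invRad z * invRad z) * (invRad z * invRad z)))))
    (fun z => -2 * z.2 * invRad z ^ 4 + 8 * z.1 ^ 2 * z.2 * invRad z ^ 6)
    (fun z => -2 * z.1 * invRad z ^ 4 + 8 * z.1 * z.2 ^ 2 * invRad z ^ 6)
    (fun z => -6 * z.2 * invRad z ^ 4 + 8 * z.2 ^ 3 * invRad z ^ 6) := by
  refine ⟨fun z hz => ?_, fun z hz => ?_, fun z hz => ?_⟩ <;> have h := hasGradAt_invRad hz
  · exact ((hasGradAt_snd z).mul (h.mul h)).congr_val (by ring) (by ring)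
  · exact (((hasGradAt_fst z).mul ((hasGradAt_snd z).mul ((h.mul h).mul (h.mul h)))).const_mul
      (-2)).congr_val (by ring) (by ring)
  · exact ((h.mul h).add (((hasGradAt_snd z).mul
      ((hasGradAt_snd z).mul ((h.mul h).mul (h.mul h)))).const_mul (-2))).congr_val
      (by ring) (by ring)

/-- A logarithm with a lower order correction, which is a supersolution of every linear oblique
problem that is asymptotically the Neumann problem for the Laplacian. -/
def logBarrier (k m : ℝ) (z : ℝ × ℝ) : ℝ :=
  k * log √(z.1 ^ 2 + z.2 ^ 2) - m * (invRad z + z.2 * (invRad z * invRad z))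

theorem logBarrier_interior_le {k m ε u X Y a b : ℝ} (hkm : |k| ≤ 10 * m) (hε0 : 0 ≤ ε)
    (hε : ε ≤ 1 / 200) (hu : 0 < u) (hu1 : u ≤ 1) (hXY : X ^ 2 + Y ^ 2 = 1)
    (ha : |a| ≤ 2 * ε * u) (hb : |b - 1| ≤ 3 * ε * u) :
    (k * u ^ 2 * (1 - 2 * X ^ 2) + m * u ^ 3 * -(-1 + 3 * X ^ 2 - 2 * Y + 8 * X ^ 2 * Y)) +
      2 * a * (k * u ^ 2 * -(2 * (X * Y)) +
        m * u ^ 3 * -(3 * (X * Y) - 2 * X + 8 * (X * Y) * Y)) +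
      b * (k * u ^ 2 * (1 - 2 * Y ^ 2) + m * u ^ 3 * -(-1 + 3 * Y ^ 2 - 6 * Y + 8 * Y ^ 3))
      ≤ 0 := by
  have hm : 0 ≤ m := by linarith [abs_nonneg k]
  have hY1 : |Y| ≤ 1 := abs_le_one_iff_mul_self_le_one.2 (by nlinarith [sq_nonneg X])
  have hX1 : |X| ≤ 1 := abs_le_one_iff_mul_self_le_one.2 (by nlinarith [sq_nonneg Y])
  obtain ⟨hX2, hX3⟩ := abs_le.1 hX1
  obtain ⟨hY2, hY3⟩ := abs_le.1 hY1
  have hu2 : 0 < u ^ 2 := by positivity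
  have hu3p : 0 < u ^ 3 := by positivity
  have hu3 : u ^ 3 ≤ u ^ 2 := pow_le_pow_of_le_one hu.le hu1 (by norm_num)
  have hmu : m * u ^ 3 ≤ m * u ^ 2 := mul_le_mul_of_nonneg_left hu3 hm
  have hku : |k| * u ^ 2 ≤ 10 * m * u ^ 2 := mul_le_mul_of_nonneg_right hkm hu2.le
  have c1 : X * Y ≤ 1 / 2 := by nlinarith [sq_nonneg (X - Y)]
  have c2 : -(1 / 2) ≤ X * Y := by nlinarith [sq_nonneg (X + Y)]
  have hXYY : |X * Y * Y| ≤ 1 / 2 := by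
    rw [abs_mul]
    have : |X * Y| ≤ 1 / 2 := abs_le.2 ⟨c2, c1⟩
    nlinarith [abs_nonneg (X * Y), abs_nonneg Y]
  obtain ⟨c3, c4⟩ := abs_le.1 hXYY
  have hYY : Y ^ 2 ≤ 1 := by nlinarith [sq_nonneg X]
  have c5 : 8 * Y ^ 3 - 6 * Y ≤ 2 := by nlinarith [mul_nonneg (sub_nonneg.2 hY3) (sq_nonneg (2 * Y + 1))]
  have c6 : -2 ≤ 8 * Y ^ 3 - 6 * Y := by
    nlinarith [mul_nonneg (by linarith : 0 ≤ 1 + Y) (sq_nonneg (2 * Y - 1))]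
  have bound : ∀ s t : ℝ, |s| ≤ 1 → |t| ≤ 8 →
      |k * u ^ 2 * s + m * u ^ 3 * t| ≤ 18 * (m * u ^ 2) := by
    intro s t hs ht
    refine (abs_add_le _ _).trans ?_
    rw [abs_mul, abs_mul, abs_mul, abs_mul m, abs_of_nonneg hm, abs_of_nonneg hu2.le,
      abs_of_nonneg hu3p.le]
    have h1 : |k| * u ^ 2 * |s| ≤ 10 * m * u ^ 2 * 1 :=
      mul_le_mul hku hs (abs_nonneg _) (by positivity)
    have h2 : m * u ^ 3 * |t| ≤ m * u ^ 2 * 8 :=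
      mul_le_mul hmu ht (abs_nonneg _) (by positivity)
    linarith
  have bP := bound (-(2 * (X * Y))) (-(3 * (X * Y) - 2 * X + 8 * (X * Y) * Y))
    (abs_le.2 ⟨by linarith, by linarith⟩) (abs_le.2 ⟨by linarith, by linarith⟩)
  have bQ := bound (1 - 2 * Y ^ 2) (-(-1 + 3 * Y ^ 2 - 6 * Y + 8 * Y ^ 3))
    (abs_le.2 ⟨by linarith, by linarith [sq_nonneg Y]⟩)
    (abs_le.2 ⟨by linarith, by linarith [sq_nonneg Y]⟩)
  have hsum : (k * u ^ 2 * (1 - 2 * X ^ 2) +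
      m * u ^ 3 * -(-1 + 3 * X ^ 2 - 2 * Y + 8 * X ^ 2 * Y)) +
      (k * u ^ 2 * (1 - 2 * Y ^ 2) + m * u ^ 3 * -(-1 + 3 * Y ^ 2 - 6 * Y + 8 * Y ^ 3))
      = -(m * u ^ 3) := by
    have : X ^ 2 = 1 - Y ^ 2 := by linarith
    rw [this]; ring
  generalize k * u ^ 2 * -(2 * (X * Y)) +
    m * u ^ 3 * -(3 * (X * Y) - 2 * X + 8 * (X * Y) * Y) = P at *
  generalize k * u ^ 2 * (1 - 2 * Y ^ 2) +
    m * u ^ 3 * -(-1 + 3 * Y ^ 2 - 6 * Y + 8 * Y ^ 3) = Q at *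
  generalize k * u ^ 2 * (1 - 2 * X ^ 2) +
    m * u ^ 3 * -(-1 + 3 * X ^ 2 - 2 * Y + 8 * X ^ 2 * Y) = R at *
  have h1 : |a * P| ≤ (2 * ε * u) * (18 * (m * u ^ 2)) := by
    rw [abs_mul]; exact mul_le_mul ha bP (abs_nonneg _) (by positivity)
  have h2 : |(b - 1) * Q| ≤ (3 * ε * u) * (18 * (m * u ^ 2)) := by
    rw [abs_mul]; exact mul_le_mul hb bQ (abs_nonneg _) (by positivity)
  have h3 := (abs_le.1 h1).2
  have h4 := (abs_le.1 h2).2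
  have h5 : 0 ≤ m * u ^ 3 := by positivity
  have h6 : ε * (m * u ^ 3) ≤ 1 / 200 * (m * u ^ 3) := mul_le_mul_of_nonneg_right hε h5
  have e : R + 2 * a * P + b * Q = (R + Q) + 2 * (a * P) + (b - 1) * Q := by ring
  have e1 : (2 * ε * u) * (18 * (m * u ^ 2)) = 36 * (ε * (m * u ^ 3)) := by ring
  have e2 : (3 * ε * u) * (18 * (m * u ^ 2)) = 54 * (ε * (m * u ^ 3)) := by ring
  rw [e, hsum]
  linarith

theorem logBarrier_boundary_le {k m ε u X β : ℝ} (hkm : |k| ≤ 10 * m)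
    (hε : ε ≤ 1 / 200) (hu : 0 < u) (hu1 : u ≤ 1) (hX : |X| ≤ 1)
    (hβ : |β| ≤ ε * u) :
    -(m * u ^ 2) + β * (k * (X * u) + m * (X * u ^ 2)) ≤ 0 := by
  have hm : 0 ≤ m := by linarith [abs_nonneg k]
  have hε0 : 0 ≤ ε * u := (abs_nonneg _).trans hβ
  have hu2 : 0 < u ^ 2 := by positivity
  have hb : |k * (X * u) + m * (X * u ^ 2)| ≤ 11 * (m * u) := by
    refine (abs_add_le _ _).trans ?_
    rw [abs_mul, abs_mul, abs_mul, abs_mul X, abs_of_nonneg hm, abs_of_pos hu, abs_of_pos hu2]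
    have h1 : |X| * u ≤ u := by nlinarith
    have h2 : |X| * u ^ 2 ≤ u := by nlinarith
    have h3 := mul_le_mul hkm h1 (by positivity) (by positivity)
    have h4 := mul_le_mul_of_nonneg_left h2 hm
    linarith
  have h1 : |β * (k * (X * u) + m * (X * u ^ 2))| ≤ (ε * u) * (11 * (m * u)) := by
    rw [abs_mul]; exact mul_le_mul hβ hb (abs_nonneg _) hε0
  have h2 := (abs_le.1 h1).2
  have h3 : ε * (m * u ^ 2) ≤ 1 / 200 * (m * u ^ 2) :=
    mul_le_mul_of_nonneg_right hε (by positivity)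
  have h4 : 0 ≤ m * u ^ 2 := by positivity
  have e1 : (ε * u) * (11 * (m * u)) = 11 * (ε * (m * u ^ 2)) := by ring
  linarith

theorem exists_jet2On_logBarrier {k m : ℝ} (hkm : |k| ≤ 10 * m) :
    ∃ hx hy hxx hxy hyy : ℝ × ℝ → ℝ, Jet2On punctured (logBarrier k m) hx hy hxx hxy hyy ∧
      ∀ z ∈ punctured, invRad z ≤ 1 → ∀ ε a b : ℝ, ε ≤ 1 / 200 →
        |a| ≤ 2 * ε * invRad z → |b - 1| ≤ 3 * ε * invRad z →
        (hxx z + 2 * a * hxy z + b * hyy z ≤ 0) ∧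
        (z.2 = 0 → ∀ β : ℝ, |β| ≤ ε * invRad z → hy z + β * hx z ≤ 0) := by
  have hj := (jet2On_log_rad.const_mul k).add
    ((jet2On_invRad.add jet2On_snd_mul_invRad_sq).const_mul (-m))
  have e : logBarrier k m = fun z => k * log √(z.1 ^ 2 + z.2 ^ 2) +
      -m * (invRad z + z.2 * (invRad z * invRad z)) := by
    funext z; unfold logBarrier; ring
  refine ⟨_, _, _, _, _, e ▸ hj, ?_⟩
  intro z hz hu1 ε a b hε ha hb
  have hu := invRad_pos hz
  have hXY := sq_add_sq_mul_invRad hz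
  have hε0 : 0 ≤ ε := by
    by_contra! h
    have := (abs_nonneg a).trans ha
    nlinarith
  constructor
  · have := logBarrier_interior_le hkm hε0 hε hu hu1 hXY ha hb
    convert this using 1
    ring
  · intro hz2 β hβ
    have hX : |z.1 * invRad z| ≤ 1 :=
      abs_le_one_iff_mul_self_le_one.2 (by nlinarith [sq_nonneg (z.2 * invRad z)])
    have := logBarrier_boundary_le hkm hε hu hu1 hX hβ
    rw [hz2]
    convert this using 1
    ring

/-- The half plane outside the unit disc. -/
def extHalf : Set (ℝ × ℝ) := {z | 0 ≤ z.2 ∧ 1 ≤ z.1 ^ 2 + z.2 ^ 2}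

theorem sqAnn_subset_extHalf {ρ₁ ρ₂ : ℝ} (h : 1 ≤ ρ₁) : sqAnn ρ₁ ρ₂ ⊆ extHalf :=
  fun _ hz => ⟨hz.1, h.trans hz.2.1⟩

theorem extHalf_subset_punctured : extHalf ⊆ punctured :=
  fun _ hz => lt_of_lt_of_le one_pos hz.2

theorem invRad_le_one {z : ℝ × ℝ} (hz : z ∈ extHalf) : invRad z ≤ 1 :=
  inv_le_one_of_one_le₀ (Real.one_le_sqrt.2 hz.2)

theorem snd_mul_invRad_sq_mem {z : ℝ × ℝ} (hz : z ∈ extHalf) :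
    0 ≤ z.2 * (invRad z * invRad z) ∧ z.2 * (invRad z * invRad z) ≤ 1 := by
  have h := sq_add_sq_mul_invRad (extHalf_subset_punctured hz)
  have h1 := invRad_le_one hz
  have h2 := invRad_pos (extHalf_subset_punctured hz)
  have h3 : 0 ≤ z.2 := hz.1
  refine ⟨by positivity, ?_⟩
  have h4 : z.2 * invRad z ≤ 1 := by nlinarith [sq_nonneg (z.1 * invRad z)]
  nlinarith

theorem logBarrier_bounds {k m : ℝ} (hm : 0 ≤ m) {z : ℝ × ℝ} (hz : z ∈ extHalf) :
    k * log √(z.1 ^ 2 + z.2 ^ 2) - 2 * m ≤ logBarrier k m z ∧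
      logBarrier k m z ≤ k * log √(z.1 ^ 2 + z.2 ^ 2) := by
  have h1 := snd_mul_invRad_sq_mem hz
  have h2 := invRad_le_one hz
  have h3 := invRad_pos (extHalf_subset_punctured hz)
  unfold logBarrier
  constructor <;> nlinarith

section
variable {U : Set (ℝ × ℝ)} {g gx gy gxx gxy gyy a b β : ℝ × ℝ → ℝ} {ε : ℝ}

/-- Comparison with logarithms on half annuli. -/
theorem annulus_log_upper (hU : IsOpen U) (hg : Jet2On U g gx gy gxx gxy gyy)
    (hS : extHalf ⊆ U) (hε : ε ≤ 1 / 200)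
    (ha : ∀ z ∈ extHalf, |a z| ≤ 2 * ε * invRad z)
    (hb : ∀ z ∈ extHalf, |b z - 1| ≤ 3 * ε * invRad z)
    (hβ : ∀ z ∈ extHalf, |β z| ≤ ε * invRad z)
    (hpde : ∀ z ∈ extHalf, 0 < z.2 → gxx z + 2 * a z * gxy z + b z * gyy z = 0)
    (hbd : ∀ z ∈ extHalf, z.2 = 0 → gy z + β z * gx z = 0)
    {k m B ρ : ℝ} (hkm : |k| ≤ 10 * m)
    (h₁ : ∀ z ∈ extHalf, z.1 ^ 2 + z.2 ^ 2 = 1 → g z ≤ B)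
    (h₂ : ∀ z ∈ extHalf, z.1 ^ 2 + z.2 ^ 2 = ρ → g z ≤ k * log √ρ + B) :
    ∀ z ∈ sqAnn 1 ρ, g z ≤ k * log √(z.1 ^ 2 + z.2 ^ 2) + B + 2 * m := by
  obtain ⟨hx, hy, hxx, hxy, hyy, hj, hsup⟩ := exists_jet2On_logBarrier hkm
  have hm : 0 ≤ m := by linarith [abs_nonneg k]
  have hdiff := (hg.mono (inter_subset_left (t := punctured))).add
    ((hj.mono (inter_subset_right (s := U))).neg)
  have hE : sqAnn 1 ρ ⊆ extHalf := sqAnn_subset_extHalf le_rfl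
  have main := max_principle (hU.inter isOpen_punctured) hdiff (ρ₁ := 1) (ρ₂ := ρ)
    (B := B + 2 * m) (D := 0) (a := a) (b := b) (d₁ := fun _ => 0) (d₂ := fun _ => 0) (β := β)
    (fun z hz => ⟨hS (hE hz), extHalf_subset_punctured (hE hz)⟩) ?_ ?_ (by simp) ?_ ?_ ?_ ?_
  · intro z hz
    have h := main z hz
    have h' := (logBarrier_bounds (k := k) hm (hE hz)).2
    linarith
  · intro z hz
    have h1 := abs_le.1 (ha z (hE hz))
    have h2 := abs_le.1 (hb z (hE hz))
    have h3 := invRad_le_one (hE hz)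
    have h4 := invRad_pos (extHalf_subset_punctured (hE hz))
    have h5 : ε * invRad z ≤ 1 / 200 := by nlinarith
    nlinarith
  · intro z hz
    have h2 := abs_le.1 (hb z (hE hz))
    have h3 := invRad_le_one (hE hz)
    have h4 := invRad_pos (extHalf_subset_punctured (hE hz))
    have h5 : ε * invRad z ≤ 1 / 200 := by nlinarith
    nlinarith
  · intro z hz hz2
    have h1 := hpde z (hE hz) hz2
    have h2 := (hsup z (extHalf_subset_punctured (hE hz)) (invRad_le_one (hE hz)) ε (a z) (b z) hε
      (ha z (hE hz)) (hb z (hE hz))).1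
    linarith
  · intro z hz hz2
    right
    have h1 := hbd z (hE hz) hz2
    have h2 := (hsup z (extHalf_subset_punctured (hE hz)) (invRad_le_one (hE hz)) ε (a z) (b z) hε
      (ha z (hE hz)) (hb z (hE hz))).2 hz2 (β z) (hβ z (hE hz))
    linarith
  · intro z hz hz1
    have h' := (logBarrier_bounds (k := k) hm (hE hz)).1
    rw [hz1] at h'
    have := h₁ z (hE hz) hz1
    simp at h'
    linarith
  · intro z hz hz1
    have h' := (logBarrier_bounds (k := k) hm (hE hz)).1
    rw [hz1] at h'
    have := h₂ z (hE hz) hz1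
    linarith

/-- Comparison with logarithms in the whole exterior domain. -/
theorem exterior_log_upper (hU : IsOpen U) (hg : Jet2On U g gx gy gxx gxy gyy)
    (hS : extHalf ⊆ U) (hε : ε ≤ 1 / 200)
    (ha : ∀ z ∈ extHalf, |a z| ≤ 2 * ε * invRad z)
    (hb : ∀ z ∈ extHalf, |b z - 1| ≤ 3 * ε * invRad z)
    (hβ : ∀ z ∈ extHalf, |β z| ≤ ε * invRad z)
    (hpde : ∀ z ∈ extHalf, 0 < z.2 → gxx z + 2 * a z * gxy z + b z * gyy z = 0)
    (hbd : ∀ z ∈ extHalf, z.2 = 0 → gy z + β z * gx z = 0)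
    {k B C : ℝ}
    (h₁ : ∀ z ∈ extHalf, z.1 ^ 2 + z.2 ^ 2 = 1 → g z ≤ B)
    (h₂ : ∀ z ∈ extHalf, g z ≤ k * log √(z.1 ^ 2 + z.2 ^ 2) + C) :
    ∀ z ∈ extHalf, g z ≤ k * log √(z.1 ^ 2 + z.2 ^ 2) + B + |k| / 5 := by
  intro z hz
  have key : ∀ e > 0, g z ≤ (k + e) * log √(z.1 ^ 2 + z.2 ^ 2) + B + (|k| + e) / 5 := by
    intro e he
    have hlim : Tendsto (fun ρ : ℝ => e * log √ρ) atTop atTop :=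
      (Real.tendsto_log_atTop.comp Real.tendsto_sqrt_atTop).const_mul_atTop he
    obtain ⟨ρ, hρ1, hρ2⟩ := ((hlim.eventually_ge_atTop (C - B)).and
      (eventually_ge_atTop (z.1 ^ 2 + z.2 ^ 2))).exists
    have hk : |k + e| ≤ 10 * ((|k| + e) / 10) := by
      have := abs_add_le k e
      rw [abs_of_pos he] at this
      linarith
    have := annulus_log_upper hU hg hS hε ha hb hβ hpde hbd hk h₁ (ρ := ρ) (fun w hw hwρ => by
      have := h₂ w hw
      rw [hwρ] at this
      linarith) z ⟨hz.1, hz.2, hρ2⟩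
    linarith
  have hlim : Tendsto (fun e : ℝ => (k + e) * log √(z.1 ^ 2 + z.2 ^ 2) + B + (|k| + e) / 5)
      (nhdsWithin 0 (Ioi 0)) (nhds (k * log √(z.1 ^ 2 + z.2 ^ 2) + B + |k| / 5)) := by
    have : ContinuousAt
        (fun e : ℝ => (k + e) * log √(z.1 ^ 2 + z.2 ^ 2) + B + (|k| + e) / 5) 0 := by fun_prop
    have h := this.tendsto.mono_left (nhdsWithin_le_nhds (s := Ioi 0))
    simpa using h
  exact ge_of_tendsto hlim (by filter_upwards [self_mem_nhdsWithin] with e he using key e he)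

theorem antitoneOn_Ici_of_hasDerivAt_nonpos {f f' : ℝ → ℝ} {a : ℝ}
    (h : ∀ t ≥ a, HasDerivAt f (f' t) t) (hn : ∀ t ≥ a, f' t ≤ 0) : AntitoneOn f (Ici a) := by
  refine antitoneOn_of_deriv_nonpos (convex_Ici a)
    (fun t ht => (h t ht).continuousAt.continuousWithinAt) ?_ ?_
  · intro t ht
    rw [interior_Ici] at ht
    exact (h t (le_of_lt ht)).differentiableAt.differentiableWithinAt
  · intro t ht
    rw [interior_Ici] at ht
    rw [(h t (le_of_lt ht)).deriv]
    exact hn t (le_of_lt ht)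

theorem hasDerivAt_integral_strip {F F' : ℝ → ℝ → ℝ}
    (hF : ContinuousOn (fun z : ℝ × ℝ => F z.1 z.2) (Ici 0 ×ˢ Icc 0 π))
    (hF' : ContinuousOn (fun z : ℝ × ℝ => F' z.1 z.2) (Ici 0 ×ˢ Icc 0 π))
    (hd : ∀ t ≥ 0, ∀ θ ∈ Icc 0 π, HasDerivAt (fun s => F s θ) (F' t θ) t) {t : ℝ} (ht : 0 < t) :
    HasDerivAt (fun s => ∫ θ in 0..π, F s θ) (∫ θ in 0..π, F' t θ) t := by
  have hslice : ∀ {G : ℝ → ℝ → ℝ},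
      ContinuousOn (fun z : ℝ × ℝ => G z.1 z.2) (Ici 0 ×ˢ Icc 0 π) → ∀ s ≥ (0 : ℝ),
      IntervalIntegrable (G s) volume 0 π := fun hG s hs =>
    ContinuousOn.intervalIntegrable_of_Icc pi_pos.le
      (hG.comp (f := fun θ => (s, θ)) (by fun_prop) fun θ hθ => ⟨hs, hθ⟩)
  obtain ⟨C, hC⟩ := (isCompact_Icc.prod isCompact_Icc).exists_bound_of_continuousOn
    (hF'.mono (prod_mono (fun _ hs => hs.1 : Icc (0 : ℝ) (t + 1) ⊆ Ici 0) le_rfl))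
  have hnhds : Icc 0 (t + 1) ∈ nhds t := Icc_mem_nhds ht (by linarith)
  have huI : ∀ θ ∈ uIoc 0 π, θ ∈ Icc 0 π := fun θ hθ => by
    rw [uIoc_of_le pi_pos.le] at hθ
    exact Ioc_subset_Icc_self hθ
  refine (intervalIntegral.hasDerivAt_integral_of_dominated_loc_of_deriv_le (F' := F')
    (bound := fun _ => C) hnhds ?_ (hslice hF t ht.le) ?_ ?_ intervalIntegrable_const ?_).2
  · filter_upwards [hnhds] with s hs
    exact (intervalIntegrable_iff.1 (hslice hF s hs.1)).aestronglyMeasurable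
  · exact (intervalIntegrable_iff.1 (hslice hF' t ht.le)).aestronglyMeasurable
  · exact Eventually.of_forall fun θ hθ s hs => hC (s, θ) ⟨hs, huI θ hθ⟩
  · exact Eventually.of_forall fun θ hθ s hs => hd s hs.1 θ (huI θ hθ)

theorem sq_integral_le {f : ℝ → ℝ} (hf : ContinuousOn f (Icc 0 π)) :
    (∫ θ in 0..π, f θ) ^ 2 ≤ π * ∫ θ in 0..π, f θ ^ 2 := by
  have hi : IntervalIntegrable f volume 0 π := hf.intervalIntegrable_of_Icc pi_pos.le
  have hi2 : IntervalIntegrable (fun θ => f θ ^ 2) volume 0 π :=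
    (hf.pow 2).intervalIntegrable_of_Icc pi_pos.le
  set c := (∫ θ in 0..π, f θ) / π with hc
  have hcπ : ∫ θ in 0..π, f θ = c * π := by rw [hc, div_mul_cancel₀ _ pi_ne_zero]
  have h : 0 ≤ ∫ θ in 0..π, ((f θ ^ 2 - 2 * c * f θ) + c ^ 2) :=
    intervalIntegral.integral_nonneg pi_pos.le fun θ _ => by nlinarith [sq_nonneg (f θ - c)]
  rw [intervalIntegral.integral_add (hi2.sub (hi.const_mul _)) intervalIntegrable_const,
    intervalIntegral.integral_sub hi2 (hi.const_mul _), intervalIntegral.integral_const_mul,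
    intervalIntegral.integral_const, hcπ] at h
  rw [hcπ]
  simp only [sub_zero, smul_eq_mul] at h
  nlinarith [pi_pos]

/-- The Wirtinger inequality on `[0, π]` with zero boundary values. -/
theorem integral_sq_le_integral_deriv_sq {R R' : ℝ → ℝ} (hR' : ContinuousOn R' (Icc 0 π))
    (hd : ∀ θ ∈ Icc 0 π, HasDerivAt R (R' θ) θ) (h0 : R 0 = 0) (hπ : R π = 0) :
    ∫ θ in 0..π, R θ ^ 2 ≤ ∫ θ in 0..π, R' θ ^ 2 := by
  have hR : ContinuousOn R (Icc 0 π) := fun θ hθ => (hd θ hθ).continuousAt.continuousWithinAt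
  have key : ∀ l ∈ Ioo (0 : ℝ) 1, l ^ 2 * ∫ θ in 0..π, R θ ^ 2 ≤ ∫ θ in 0..π, R' θ ^ 2 := by
    intro l hl
    set c := (π - l * π) / 2 with hc
    have hsin : ∀ θ ∈ Icc 0 π, 0 < sin (l * θ + c) := fun θ hθ => by
      apply sin_pos_of_pos_of_lt_pi
      · nlinarith [hθ.1, hθ.2, hl.1, hl.2, pi_pos, mul_nonneg hl.1.le hθ.1]
      · nlinarith [hθ.1, hθ.2, hl.1, hl.2, pi_pos, mul_nonneg hl.1.le (sub_nonneg.2 hθ.2)]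
    have hlin : ∀ θ, HasDerivAt (fun θ : ℝ => l * θ + c) l θ := fun θ => by
      simpa using ((hasDerivAt_id θ).const_mul l).add_const c
    set g : ℝ → ℝ := fun θ => l * (cos (l * θ + c) / sin (l * θ + c)) with hg
    have hgd : ∀ θ ∈ Icc 0 π, HasDerivAt g (-(l ^ 2) - g θ ^ 2) θ := fun θ hθ => by
      have hs := (hsin θ hθ).ne'
      have := (((hlin θ).cos).div ((hlin θ).sin) hs).const_mul l
      refine this.congr_deriv ?_
      simp only [hg]
      field_simp
    have hgc : ContinuousOn g (Icc 0 π) := fun θ hθ => (hgd θ hθ).continuousAt.continuousWithinAt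
    have hprod : ∀ θ ∈ Icc 0 π, HasDerivAt (fun θ => g θ * R θ ^ 2)
        ((-(l ^ 2) - g θ ^ 2) * R θ ^ 2 + g θ * (2 * R θ * R' θ)) θ := fun θ hθ => by
      have := (hgd θ hθ).mul ((hd θ hθ).pow 2)
      refine this.congr_deriv ?_
      simp
    have h_int := intervalIntegral.integral_eq_sub_of_hasDerivAt (a := 0) (b := π)
      (f := fun θ => g θ * R θ ^ 2)
      (f' := fun θ => (-(l ^ 2) - g θ ^ 2) * R θ ^ 2 + g θ * (2 * R θ * R' θ))
      (fun θ hθ => hprod θ (by rwa [uIcc_of_le pi_pos.le] at hθ))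
      (ContinuousOn.intervalIntegrable_of_Icc pi_pos.le (by fun_prop))
    simp only [h0, hπ] at h_int
    have hmono : ∫ θ in 0..π, ((-(l ^ 2) - g θ ^ 2) * R θ ^ 2 + g θ * (2 * R θ * R' θ)) ≤
        ∫ θ in 0..π, (R' θ ^ 2 - l ^ 2 * R θ ^ 2) := by
      refine intervalIntegral.integral_mono_on pi_pos.le
        (ContinuousOn.intervalIntegrable_of_Icc pi_pos.le (by fun_prop))
        (ContinuousOn.intervalIntegrable_of_Icc pi_pos.le (by fun_prop)) fun θ _ => ?_
      nlinarith [sq_nonneg (R' θ - g θ * R θ)]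
    rw [h_int, intervalIntegral.integral_sub
      (ContinuousOn.intervalIntegrable_of_Icc pi_pos.le (by fun_prop))
      (ContinuousOn.intervalIntegrable_of_Icc pi_pos.le (by fun_prop)),
      intervalIntegral.integral_const_mul] at hmono
    linarith
  have hlim : Tendsto (fun l : ℝ => l ^ 2 * ∫ θ in 0..π, R θ ^ 2) (nhdsWithin 1 (Iio 1))
      (nhds (∫ θ in 0..π, R θ ^ 2)) := by
    have : ContinuousAt (fun l : ℝ => l ^ 2 * ∫ θ in 0..π, R θ ^ 2) 1 := by fun_prop
    have h := this.tendsto.mono_left (nhdsWithin_le_nhds (s := Iio 1))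
    simpa using h
  refine le_of_tendsto hlim ?_
  filter_upwards [Ioo_mem_nhdsLT (show (0 : ℝ) < 1 by norm_num)] with l hl using key l hl

/-- A decreasing quantity controlled by the square root of its dissipation is nonnegative. -/
theorem nonneg_of_sq_le_mul_dissipation {E J : ℝ → ℝ} {K a : ℝ} (hK : 0 < K)
    (hd : ∀ t ≥ a, HasDerivAt E (-J t) t) (hJ : ∀ t ≥ a, E t ^ 2 ≤ K * J t) :
    ∀ t ≥ a, 0 ≤ E t := by
  intro s hs
  by_contra! hneg
  have hJ0 : ∀ t ≥ a, 0 ≤ J t := fun t ht => by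
    have := hJ t ht
    by_contra! h
    nlinarith [sq_nonneg (E t)]
  have hanti := antitoneOn_Ici_of_hasDerivAt_nonpos hd fun t ht => by linarith [hJ0 t ht]
  have hE : ∀ t ≥ s, E t < 0 := fun t ht => (hanti hs (hs.trans ht) ht).trans_lt hneg
  have h1 : AntitoneOn (fun t => -(E t)⁻¹ + t / K) (Ici s) := by
    refine antitoneOn_Ici_of_hasDerivAt_nonpos (f' := fun t => -(-(-J t) / E t ^ 2) + 1 / K)
      (fun t ht => ?_) fun t ht => ?_
    · exact ((hd t (hs.trans ht)).inv (hE t ht).ne).neg.add ((hasDerivAt_id t).div_const K)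
    · have h2 : 0 < E t ^ 2 := by nlinarith [hE t ht]
      have h3 : 1 / K ≤ J t / E t ^ 2 := by
        rw [div_le_div_iff₀ hK h2]
        linarith [hJ t (hs.trans ht)]
      simp only [neg_neg]
      linarith
  set T := s + K * (-(E s)⁻¹) with hT
  have hEs : 0 < -(E s)⁻¹ := by
    have := inv_lt_zero.2 hneg
    linarith
  have hTs : s ≤ T := by nlinarith
  have h2 := h1 (mem_Ici.2 le_rfl) (mem_Ici.2 hTs) hTs
  have h3 := inv_lt_zero.2 (hE T hTs)
  have h4 : T / K = s / K + -(E s)⁻¹ := by rw [hT]; field_simp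
  simp only [h4] at h2
  linarith

theorem le_of_sq_le_mul_dissipation {E J : ℝ → ℝ} {K a : ℝ} (hK : 0 < K)
    (hd : ∀ t ≥ a, HasDerivAt E (-J t) t) (hJ : ∀ t ≥ a, E t ^ 2 ≤ K * J t) :
    ∀ t ≥ a + 1, E t ≤ K := by
  intro T hT
  by_contra! hlt
  have hJ0 : ∀ t ≥ a, 0 ≤ J t := fun t ht => by
    have := hJ t ht
    by_contra! h
    nlinarith [sq_nonneg (E t)]
  have hanti := antitoneOn_Ici_of_hasDerivAt_nonpos hd fun t ht => by linarith [hJ0 t ht]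
  have hE : ∀ t ∈ Icc a T, K < E t := fun t ht =>
    hlt.trans_le (hanti (mem_Ici.2 ht.1) (mem_Ici.2 (by linarith)) ht.2)
  have hdd : ∀ t ∈ Icc a T, HasDerivAt (fun t => -(E t)⁻¹ + t / K)
      (-(-(-J t) / E t ^ 2) + 1 / K) t := fun t ht =>
    ((hd t ht.1).inv (hK.trans (hE t ht)).ne').neg.add ((hasDerivAt_id t).div_const K)
  have h1 : AntitoneOn (fun t => -(E t)⁻¹ + t / K) (Icc a T) := by
    refine antitoneOn_of_deriv_nonpos (convex_Icc a T)
      (fun t ht => (hdd t ht).continuousAt.continuousWithinAt)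
      (fun t ht => (hdd t (interior_subset ht)).differentiableAt.differentiableWithinAt)
      fun t ht => ?_
    rw [(hdd t (interior_subset ht)).deriv]
    have ht' := interior_subset ht
    have h2 : 0 < E t ^ 2 := pow_pos (hK.trans (hE t ht')) 2
    have h3 : 1 / K ≤ J t / E t ^ 2 := by
      rw [div_le_div_iff₀ hK h2]
      linarith [hJ t ht'.1]
    simp only [neg_neg]
    linarith
  have haT : a ≤ T := by linarith
  have h2 := h1 (left_mem_Icc.2 haT) (right_mem_Icc.2 haT) haT
  have h3 : 0 < (E a)⁻¹ := inv_pos.2 (hK.trans (hE a (left_mem_Icc.2 haT)))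
  have h4 : (E T)⁻¹ < K⁻¹ := inv_strictAnti₀ hK hlt
  have h5 : a / K + K⁻¹ ≤ T / K := by
    rw [← one_div, ← add_div]
    gcongr
  simp only at h2
  linarith

/-- The boundary nonlinearity in two dimensions. -/
def bdN (s : ℝ) : ℝ := √(1 + s ^ 2) - 1

theorem one_le_sqrt_one_add_sq (s : ℝ) : 1 ≤ √(1 + s ^ 2) :=
  Real.one_le_sqrt.2 (by nlinarith [sq_nonneg s])

theorem bdN_zero : bdN 0 = 0 := by simp [bdN]

theorem hasDerivAt_bdN (s : ℝ) : HasDerivAt bdN (s / √(1 + s ^ 2)) s := by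
  have h : HasDerivAt (fun s : ℝ => 1 + s ^ 2) (2 * s) s := by
    simpa using (hasDerivAt_pow 2 s).const_add 1
  refine ((h.sqrt (by positivity)).sub_const 1).congr_deriv ?_
  rw [mul_div_mul_left _ _ two_ne_zero]

theorem HasDerivAt.bdN_comp {f : ℝ → ℝ} {f' x : ℝ} (h : HasDerivAt f f' x) :
    HasDerivAt (fun s => bdN (f s)) (f x / √(1 + f x ^ 2) * f') x :=
  HasDerivAt.comp (h₂ := bdN) x (hasDerivAt_bdN (f x)) h

theorem continuous_bdN : Continuous bdN :=
  continuous_iff_continuousAt.2 fun s => (hasDerivAt_bdN s).continuousAt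

theorem abs_div_sqrt_one_add_sq_le (s : ℝ) : |s / √(1 + s ^ 2)| ≤ |s| := by
  rw [abs_div, abs_of_pos (by linarith [one_le_sqrt_one_add_sq s] : 0 < √(1 + s ^ 2))]
  exact div_le_self (abs_nonneg _) (one_le_sqrt_one_add_sq s)

theorem abs_bdN_sub_le (a b : ℝ) : |bdN a - bdN b| ≤ |a - b| := by
  have hA := Real.sq_sqrt (by positivity : 0 ≤ 1 + a ^ 2)
  have hB := Real.sq_sqrt (by positivity : 0 ≤ 1 + b ^ 2)
  have hA1 := one_le_sqrt_one_add_sq a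
  have hB1 := one_le_sqrt_one_add_sq b
  have e : bdN a - bdN b = √(1 + a ^ 2) - √(1 + b ^ 2) := by unfold bdN; ring
  rw [e]
  generalize √(1 + a ^ 2) = A at *
  generalize √(1 + b ^ 2) = B at *
  refine sq_le_sq.1 ?_
  have h1 : a * b + 1 ≤ A * B := by
    refine (le_abs_self _).trans (abs_le_of_sq_le_sq ?_ (by positivity))
    rw [mul_pow, hA, hB]
    nlinarith [sq_nonneg (a - b)]
  nlinarith

theorem abs_bdN_le (a : ℝ) : |bdN a| ≤ |a| := by
  simpa [bdN_zero] using abs_bdN_sub_le a 0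

/-- The gradient of a solution of the hodograph equation, in logarithmic polar coordinates. -/
structure StripSol (η : ℝ) (P Q Pt Pa Pta Qt Qa : ℝ → ℝ → ℝ) : Prop where
  dPt : ∀ t ≥ 0, ∀ θ ∈ Icc 0 π, HasDerivAt (fun s => P s θ) (Pt t θ) t
  dPa : ∀ t ≥ 0, ∀ θ ∈ Icc 0 π, HasDerivAt (P t) (Pa t θ) θ
  dQt : ∀ t ≥ 0, ∀ θ ∈ Icc 0 π, HasDerivAt (fun s => Q s θ) (Qt t θ) t
  dQa : ∀ t ≥ 0, ∀ θ ∈ Icc 0 π, HasDerivAt (Q t) (Qa t θ) θ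
  dPat : ∀ t ≥ 0, ∀ θ ∈ Icc 0 π, HasDerivAt (fun s => Pa s θ) (Pta t θ) t
  dPta : ∀ t ≥ 0, ∀ θ ∈ Icc 0 π, HasDerivAt (Pt t) (Pta t θ) θ
  cP : ContinuousOn (fun z : ℝ × ℝ => P z.1 z.2) (Ici 0 ×ˢ Icc 0 π)
  cQ : ContinuousOn (fun z : ℝ × ℝ => Q z.1 z.2) (Ici 0 ×ˢ Icc 0 π)
  cPt : ContinuousOn (fun z : ℝ × ℝ => Pt z.1 z.2) (Ici 0 ×ˢ Icc 0 π)
  cPa : ContinuousOn (fun z : ℝ × ℝ => Pa z.1 z.2) (Ici 0 ×ˢ Icc 0 π)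
  cPta : ContinuousOn (fun z : ℝ × ℝ => Pta z.1 z.2) (Ici 0 ×ˢ Icc 0 π)
  cQt : ContinuousOn (fun z : ℝ × ℝ => Qt z.1 z.2) (Ici 0 ×ˢ Icc 0 π)
  cQa : ContinuousOn (fun z : ℝ × ℝ => Qa z.1 z.2) (Ici 0 ×ˢ Icc 0 π)
  ella : ∀ t ≥ 0, ∀ θ ∈ Ioo 0 π, ∀ g ≤ 1 / 100, |P t θ| ≤ g → |Q t θ| ≤ g →
    Pa t θ ^ 2 + Qa t θ ^ 2 ≤ (1 + 20 * g) * (Qt t θ * Pa t θ - Qa t θ * Pt t θ)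
  ellt : ∀ t ≥ 0, ∀ θ ∈ Ioo 0 π, ∀ g ≤ 1 / 100, |P t θ| ≤ g → |Q t θ| ≤ g →
    Pt t θ ^ 2 + Qt t θ ^ 2 ≤ (1 + 20 * g) * (Qt t θ * Pa t θ - Qa t θ * Pt t θ)
  bd0 : ∀ t ≥ 0, Q t 0 = bdN (P t 0)
  bdπ : ∀ t ≥ 0, Q t π = bdN (P t π)
  bP : ∀ t ≥ 0, ∀ θ ∈ Icc 0 π, |P t θ| ≤ η
  bQ : ∀ t ≥ 0, ∀ θ ∈ Icc 0 π, |Q t θ| ≤ η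

theorem continuousOn_slice {G : ℝ → ℝ → ℝ}
    (hG : ContinuousOn (fun z : ℝ × ℝ => G z.1 z.2) (Ici 0 ×ˢ Icc 0 π)) {t : ℝ} (ht : 0 ≤ t) :
    ContinuousOn (G t) (Icc 0 π) :=
  hG.comp (f := fun θ => (t, θ)) (by fun_prop) fun _ hθ => ⟨ht, hθ⟩

/-- Oscillation of a function on `[0, π]` in terms of its Dirichlet energy. -/
theorem sq_sub_le_integral_sq {f f' : ℝ → ℝ} (hf' : ContinuousOn f' (Icc 0 π))
    (hd : ∀ θ ∈ Icc 0 π, HasDerivAt f (f' θ) θ) {x y : ℝ} (hx : x ∈ Icc 0 π) (hy : y ∈ Icc 0 π) :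
    (f x - f y) ^ 2 ≤ π * ∫ θ in 0..π, f' θ ^ 2 := by
  have h_int : ∀ {g : ℝ → ℝ}, ContinuousOn g (Icc 0 π) → IntervalIntegrable g volume 0 π :=
    fun hg => hg.intervalIntegrable_of_Icc pi_pos.le
  have habs := sq_integral_le hf'.abs
  have hsub : |f x - f y| ≤ ∫ θ in 0..π, |f' θ| := by
    have hsubset : uIcc y x ⊆ Icc 0 π := uIcc_subset_Icc hy hx
    rw [← intervalIntegral.integral_eq_sub_of_hasDerivAt (fun θ hθ => hd θ (hsubset hθ))
      (hf'.mono hsubset).intervalIntegrable]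
    refine (intervalIntegral.norm_integral_le_integral_norm_uIoc (f := f')).trans ?_
    rw [intervalIntegral.integral_of_le pi_pos.le]
    refine setIntegral_mono_set (intervalIntegrable_iff_integrableOn_Ioc_of_le pi_pos.le |>.1
      (h_int hf'.abs)) (Eventually.of_forall fun _ => abs_nonneg _) ?_
    refine LE.le.eventuallyLE ?_
    intro z hz
    rcases le_total y x with h | h
    · rw [uIoc_of_le h] at hz
      exact ⟨hy.1.trans_lt hz.1, hz.2.trans hx.2⟩
    · rw [uIoc_of_ge h] at hz
      exact ⟨hx.1.trans_lt hz.1, hz.2.trans hy.2⟩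
  rw [← sq_abs]
  refine (pow_le_pow_left₀ (abs_nonneg _) hsub 2).trans ?_
  simpa [sq_abs] using habs

/-- The energy flux through the arc at logarithmic height `t`. -/
def energyFlux (P Q Pa : ℝ → ℝ → ℝ) (t : ℝ) : ℝ :=
  -∫ θ in 0..π, (Q t θ - bdN (P t θ)) * Pa t θ

/-- The energy density at logarithmic height `t`. -/
def energyDens (Pt Pa Qt Qa : ℝ → ℝ → ℝ) (t : ℝ) : ℝ :=
  ∫ θ in 0..π, (Qt t θ * Pa t θ - Qa t θ * Pt t θ)

namespace StripSol

variable {η : ℝ} {P Q Pt Pa Pta Qt Qa : ℝ → ℝ → ℝ}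

theorem hasDerivAt_energyFlux (h : StripSol η P Q Pt Pa Pta Qt Qa) {t : ℝ} (ht : 0 < t) :
    HasDerivAt (energyFlux P Q Pa) (-energyDens Pt Pa Qt Qa t) t := by
  have cN : ContinuousOn (fun z : ℝ × ℝ => bdN (P z.1 z.2)) (Ici 0 ×ˢ Icc 0 π) :=
    continuous_bdN.comp_continuousOn h.cP
  have cN' : ContinuousOn (fun z : ℝ × ℝ => P z.1 z.2 / √(1 + P z.1 z.2 ^ 2))
      (Ici 0 ×ˢ Icc 0 π) :=
    h.cP.div (Real.continuous_sqrt.comp_continuousOn ((h.cP.pow 2).const_add 1))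
      fun z _ => by linarith [one_le_sqrt_one_add_sq (P z.1 z.2)]
  have h1 := hasDerivAt_integral_strip
    (F := fun t θ => (Q t θ - bdN (P t θ)) * Pa t θ)
    (F' := fun t θ => (Qt t θ - P t θ / √(1 + P t θ ^ 2) * Pt t θ) * Pa t θ +
      (Q t θ - bdN (P t θ)) * Pta t θ)
    ((h.cQ.sub cN).mul h.cPa)
    (((h.cQt.sub (cN'.mul h.cPt)).mul h.cPa).add ((h.cQ.sub cN).mul h.cPta))
    (fun t ht θ hθ => ((h.dQt t ht θ hθ).sub (h.dPt t ht θ hθ).bdN_comp).mul (h.dPat t ht θ hθ)) ht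
  refine h1.neg.congr_deriv (congrArg Neg.neg ?_)
  have sP := continuousOn_slice h.cP ht.le
  have sQ := continuousOn_slice h.cQ ht.le
  have sPt := continuousOn_slice h.cPt ht.le
  have sPa := continuousOn_slice h.cPa ht.le
  have sPta := continuousOn_slice h.cPta ht.le
  have sQt := continuousOn_slice h.cQt ht.le
  have sQa := continuousOn_slice h.cQa ht.le
  have sN : ContinuousOn (fun θ => bdN (P t θ)) (Icc 0 π) := continuous_bdN.comp_continuousOn sP
  have sN' : ContinuousOn (fun θ => P t θ / √(1 + P t θ ^ 2)) (Icc 0 π) :=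
    continuousOn_slice (G := fun t θ => P t θ / √(1 + P t θ ^ 2)) cN' ht.le
  have h2 := intervalIntegral.integral_eq_sub_of_hasDerivAt (a := 0) (b := π)
    (f := fun θ => (Q t θ - bdN (P t θ)) * Pt t θ)
    (f' := fun θ => (Qa t θ - P t θ / √(1 + P t θ ^ 2) * Pa t θ) * Pt t θ +
      (Q t θ - bdN (P t θ)) * Pta t θ)
    (fun θ hθ => by
      rw [uIcc_of_le pi_pos.le] at hθ
      exact ((h.dQa t ht.le θ hθ).sub (h.dPa t ht.le θ hθ).bdN_comp).mul (h.dPta t ht.le θ hθ))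
    (ContinuousOn.intervalIntegrable_of_Icc pi_pos.le (by fun_prop))
  rw [h.bd0 t ht.le, h.bdπ t ht.le, sub_self, sub_self, zero_mul, zero_mul, sub_self] at h2
  have h3 := intervalIntegral.integral_sub (μ := volume) (a := 0) (b := π)
    (f := fun θ => (Qt t θ - P t θ / √(1 + P t θ ^ 2) * Pt t θ) * Pa t θ +
      (Q t θ - bdN (P t θ)) * Pta t θ)
    (g := fun θ => (Qa t θ - P t θ / √(1 + P t θ ^ 2) * Pa t θ) * Pt t θ +
      (Q t θ - bdN (P t θ)) * Pta t θ)
    (ContinuousOn.intervalIntegrable_of_Icc pi_pos.le (by fun_prop))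
    (ContinuousOn.intervalIntegrable_of_Icc pi_pos.le (by fun_prop))
  rw [h2, sub_zero] at h3
  unfold energyDens
  rw [← h3]
  refine intervalIntegral.integral_congr fun θ _ => ?_
  ring

theorem integral_sq_angle_le (h : StripSol η P Q Pt Pa Pta Qt Qa) {t g : ℝ} (ht : 0 ≤ t)
    (hg : g ≤ 1 / 100) (hP : ∀ θ ∈ Icc 0 π, |P t θ| ≤ g) (hQ : ∀ θ ∈ Icc 0 π, |Q t θ| ≤ g) :
    ∫ θ in 0..π, (Pa t θ ^ 2 + Qa t θ ^ 2) ≤ (1 + 20 * g) * energyDens Pt Pa Qt Qa t := by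
  have sPt := continuousOn_slice h.cPt ht
  have sPa := continuousOn_slice h.cPa ht
  have sQt := continuousOn_slice h.cQt ht
  have sQa := continuousOn_slice h.cQa ht
  unfold energyDens
  rw [← intervalIntegral.integral_const_mul]
  exact intervalIntegral.integral_mono_on_of_le_Ioo pi_pos.le
    (ContinuousOn.intervalIntegrable_of_Icc pi_pos.le (by fun_prop))
    (ContinuousOn.intervalIntegrable_of_Icc pi_pos.le (by fun_prop)) fun θ hθ =>
    h.ella t ht θ hθ g hg (hP θ (Ioo_subset_Icc_self hθ)) (hQ θ (Ioo_subset_Icc_self hθ))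

theorem integral_sq_radial_le (h : StripSol η P Q Pt Pa Pta Qt Qa) {t g : ℝ} (ht : 0 ≤ t)
    (hg : g ≤ 1 / 100) (hP : ∀ θ ∈ Icc 0 π, |P t θ| ≤ g) (hQ : ∀ θ ∈ Icc 0 π, |Q t θ| ≤ g) :
    ∫ θ in 0..π, (Pt t θ ^ 2 + Qt t θ ^ 2) ≤ (1 + 20 * g) * energyDens Pt Pa Qt Qa t := by
  have sPt := continuousOn_slice h.cPt ht
  have sPa := continuousOn_slice h.cPa ht
  have sQt := continuousOn_slice h.cQt ht
  have sQa := continuousOn_slice h.cQa ht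
  unfold energyDens
  rw [← intervalIntegral.integral_const_mul]
  exact intervalIntegral.integral_mono_on_of_le_Ioo pi_pos.le
    (ContinuousOn.intervalIntegrable_of_Icc pi_pos.le (by fun_prop))
    (ContinuousOn.intervalIntegrable_of_Icc pi_pos.le (by fun_prop)) fun θ hθ =>
    h.ellt t ht θ hθ g hg (hP θ (Ioo_subset_Icc_self hθ)) (hQ θ (Ioo_subset_Icc_self hθ))

theorem integral_sq_le_of_le_add {f g : ℝ → ℝ} {c : ℝ} (hf : ContinuousOn f (Icc 0 π))
    (hg : ContinuousOn g (Icc 0 π)) (h : ∫ θ in 0..π, (f θ ^ 2 + g θ ^ 2) ≤ c) :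
    ∫ θ in 0..π, f θ ^ 2 ≤ c ∧ ∫ θ in 0..π, g θ ^ 2 ≤ c := by
  rw [intervalIntegral.integral_add
    (ContinuousOn.intervalIntegrable_of_Icc pi_pos.le (by fun_prop))
    (ContinuousOn.intervalIntegrable_of_Icc pi_pos.le (by fun_prop))] at h
  have h1 : 0 ≤ ∫ θ in 0..π, f θ ^ 2 :=
    intervalIntegral.integral_nonneg pi_pos.le fun θ _ => sq_nonneg _
  have h2 : 0 ≤ ∫ θ in 0..π, g θ ^ 2 :=
    intervalIntegral.integral_nonneg pi_pos.le fun θ _ => sq_nonneg _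
  constructor <;> linarith

theorem energyDens_nonneg (h : StripSol η P Q Pt Pa Pta Qt Qa) (hη : η ≤ 1 / 100) {t : ℝ}
    (ht : 0 ≤ t) : 0 ≤ energyDens Pt Pa Qt Qa t := by
  have h1 := h.integral_sq_angle_le ht hη (h.bP t ht) (h.bQ t ht)
  have h2 : 0 ≤ ∫ θ in 0..π, (Pa t θ ^ 2 + Qa t θ ^ 2) :=
    intervalIntegral.integral_nonneg pi_pos.le fun θ _ => by positivity
  have h3 : 0 ≤ η := (abs_nonneg _).trans (h.bP t ht 0 ⟨le_rfl, pi_pos.le⟩)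
  by_contra! hneg
  nlinarith

theorem energyFlux_sq_le (h : StripSol η P Q Pt Pa Pta Qt Qa) (hη : η ≤ 1 / 100) {t : ℝ}
    (ht : 0 ≤ t) :
    energyFlux P Q Pa t ^ 2 ≤ 26 * η ^ 2 * energyDens Pt Pa Qt Qa t := by
  have sP := continuousOn_slice h.cP ht
  have sQ := continuousOn_slice h.cQ ht
  have sPa := continuousOn_slice h.cPa ht
  have sQa := continuousOn_slice h.cQa ht
  have sN : ContinuousOn (fun θ => bdN (P t θ)) (Icc 0 π) := continuous_bdN.comp_continuousOn sP
  have hJ := h.energyDens_nonneg hη ht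
  have h1 := sq_integral_le (f := fun θ => (Q t θ - bdN (P t θ)) * Pa t θ) (by fun_prop)
  have h2 : ∫ θ in 0..π, ((Q t θ - bdN (P t θ)) * Pa t θ) ^ 2 ≤
      ∫ θ in 0..π, 4 * η ^ 2 * Pa t θ ^ 2 := by
    refine intervalIntegral.integral_mono_on pi_pos.le
      (ContinuousOn.intervalIntegrable_of_Icc pi_pos.le (by fun_prop))
      (ContinuousOn.intervalIntegrable_of_Icc pi_pos.le (by fun_prop)) fun θ hθ => ?_
    rw [mul_pow]
    refine mul_le_mul_of_nonneg_right ?_ (sq_nonneg _)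
    have h3 : |Q t θ - bdN (P t θ)| ≤ 2 * η := by
      refine (abs_sub _ _).trans ?_
      linarith [h.bP t ht θ hθ, h.bQ t ht θ hθ, abs_bdN_le (P t θ)]
    rw [← sq_abs]
    nlinarith [abs_nonneg (Q t θ - bdN (P t θ))]
  rw [intervalIntegral.integral_const_mul] at h2
  have h3 := (integral_sq_le_of_le_add sPa sQa
    (h.integral_sq_angle_le ht hη (h.bP t ht) (h.bQ t ht))).1
  have h4 : ∫ θ in 0..π, Pa t θ ^ 2 ≤ 6 / 5 * energyDens Pt Pa Qt Qa t :=
    h3.trans (by nlinarith)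
  unfold energyFlux
  rw [neg_sq]
  refine h1.trans ?_
  have h5 : 4 * η ^ 2 * ∫ θ in 0..π, Pa t θ ^ 2 ≤
      4 * η ^ 2 * (6 / 5 * energyDens Pt Pa Qt Qa t) :=
    mul_le_mul_of_nonneg_left h4 (by positivity)
  have h6 : 0 ≤ η ^ 2 * energyDens Pt Pa Qt Qa t := by positivity
  calc _ ≤ π * (4 * η ^ 2 * (6 / 5 * energyDens Pt Pa Qt Qa t)) :=
        mul_le_mul_of_nonneg_left (h2.trans h5) pi_pos.le
    _ ≤ _ := by nlinarith [pi_lt_d2]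

theorem energyFlux_le (h : StripSol η P Q Pt Pa Pta Qt Qa) {t g : ℝ} (ht : 0 ≤ t)
    (hg : g ≤ 1 / 100) (hP : ∀ θ ∈ Icc 0 π, |P t θ| ≤ g) (hQ : ∀ θ ∈ Icc 0 π, |Q t θ| ≤ g)
    (hJ : 0 ≤ energyDens Pt Pa Qt Qa t) :
    energyFlux P Q Pa t ≤ 1 / 2 * (1 + 80 * g) * energyDens Pt Pa Qt Qa t := by
  have hg0 : 0 ≤ g := (abs_nonneg _).trans (hP 0 ⟨le_rfl, pi_pos.le⟩)
  have sP := continuousOn_slice h.cP ht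
  have sQ := continuousOn_slice h.cQ ht
  have sPa := continuousOn_slice h.cPa ht
  have sQa := continuousOn_slice h.cQa ht
  have sN : ContinuousOn (fun θ => bdN (P t θ)) (Icc 0 π) := continuous_bdN.comp_continuousOn sP
  have sN' : ContinuousOn (fun θ => P t θ / √(1 + P t θ ^ 2)) (Icc 0 π) :=
    sP.div (Real.continuous_sqrt.comp_continuousOn ((sP.pow 2).const_add 1))
      fun θ _ => by linarith [one_le_sqrt_one_add_sq (P t θ)]
  have hW := integral_sq_le_integral_deriv_sq (R := fun θ => Q t θ - bdN (P t θ))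
    (R' := fun θ => Qa t θ - P t θ / √(1 + P t θ ^ 2) * Pa t θ) (by fun_prop)
    (fun θ hθ => (h.dQa t ht θ hθ).sub (h.dPa t ht θ hθ).bdN_comp)
    (by simp [h.bd0 t ht]) (by simp [h.bdπ t ht])
  have i1 : IntervalIntegrable (fun θ => (Q t θ - bdN (P t θ)) ^ 2) volume 0 π :=
    ContinuousOn.intervalIntegrable_of_Icc pi_pos.le (by fun_prop)
  have i2 : IntervalIntegrable (fun θ => Pa t θ ^ 2) volume 0 π :=
    ContinuousOn.intervalIntegrable_of_Icc pi_pos.le (by fun_prop)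
  have i3 : IntervalIntegrable (fun θ => (Qa t θ - P t θ / √(1 + P t θ ^ 2) * Pa t θ) ^ 2)
      volume 0 π := ContinuousOn.intervalIntegrable_of_Icc pi_pos.le (by fun_prop)
  have h1 : energyFlux P Q Pa t ≤
      ∫ θ in 0..π, 1 / 2 * ((Q t θ - bdN (P t θ)) ^ 2 + Pa t θ ^ 2) := by
    unfold energyFlux
    rw [← intervalIntegral.integral_neg]
    refine intervalIntegral.integral_mono_on pi_pos.le
      (ContinuousOn.intervalIntegrable_of_Icc pi_pos.le (by fun_prop))
      ((i1.add i2).const_mul _) fun θ _ => ?_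
    nlinarith [sq_nonneg (Q t θ - bdN (P t θ) + Pa t θ)]
  rw [intervalIntegral.integral_const_mul, intervalIntegral.integral_add i1 i2] at h1
  have h2 : (∫ θ in 0..π, (Qa t θ - P t θ / √(1 + P t θ ^ 2) * Pa t θ) ^ 2) +
      ∫ θ in 0..π, Pa t θ ^ 2 ≤
      ∫ θ in 0..π, (1 + 2 * g) * (Pa t θ ^ 2 + Qa t θ ^ 2) := by
    rw [← intervalIntegral.integral_add i3 i2]
    refine intervalIntegral.integral_mono_on pi_pos.le (i3.add i2)
      (ContinuousOn.intervalIntegrable_of_Icc pi_pos.le (by fun_prop)) fun θ hθ => ?_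
    have hN := (abs_div_sqrt_one_add_sq_le (P t θ)).trans (hP θ hθ)
    generalize P t θ / √(1 + P t θ ^ 2) = n at *
    obtain ⟨n1, n2⟩ := abs_le.1 hN
    have hnn : n ^ 2 ≤ g := by nlinarith
    have hx : 0 ≤ (g - n) * (Qa t θ + Pa t θ) ^ 2 := mul_nonneg (by linarith) (sq_nonneg _)
    have hy : 0 ≤ (g + n) * (Qa t θ - Pa t θ) ^ 2 := mul_nonneg (by linarith) (sq_nonneg _)
    nlinarith [mul_nonneg (sub_nonneg.2 hnn) (sq_nonneg (Pa t θ)), mul_nonneg hg0 (sq_nonneg (Qa t θ))]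
  rw [intervalIntegral.integral_const_mul] at h2
  have h3 := h.integral_sq_angle_le ht hg hP hQ
  have h4 : (1 + 2 * g) * ∫ θ in 0..π, (Pa t θ ^ 2 + Qa t θ ^ 2) ≤
      (1 + 80 * g) * energyDens Pt Pa Qt Qa t := by
    refine (mul_le_mul_of_nonneg_left h3 (by linarith)).trans ?_
    rw [← mul_assoc]
    exact mul_le_mul_of_nonneg_right (by nlinarith) hJ
  linarith

end StripSol

namespace StripSol

variable {η : ℝ} {P Q Pt Pa Pta Qt Qa : ℝ → ℝ → ℝ}

theorem energyFlux_nonneg (h : StripSol η P Q Pt Pa Pta Qt Qa) (hη0 : 0 < η) (hη : η ≤ 1 / 100) :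
    ∀ t ≥ 1, 0 ≤ energyFlux P Q Pa t :=
  nonneg_of_sq_le_mul_dissipation (K := 26 * η ^ 2) (by positivity)
    (fun _ ht => h.hasDerivAt_energyFlux (by linarith))
    fun _ ht => h.energyFlux_sq_le hη (by linarith)

theorem energyFlux_le_const (h : StripSol η P Q Pt Pa Pta Qt Qa) (hη0 : 0 < η)
    (hη : η ≤ 1 / 100) : ∀ t ≥ 2, energyFlux P Q Pa t ≤ 26 * η ^ 2 := fun t ht =>
  le_of_sq_le_mul_dissipation (K := 26 * η ^ 2) (a := 1) (J := energyDens Pt Pa Qt Qa)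
    (by positivity) (fun _ ht => h.hasDerivAt_energyFlux (by linarith))
    (fun _ ht => h.energyFlux_sq_le hη (by linarith)) t (by linarith)

theorem energyFlux_decay_half (h : StripSol η P Q Pt Pa Pta Qt Qa) (hη0 : 0 < η)
    (hη : η ≤ 1 / 100) :
    ∀ t ≥ 2, energyFlux P Q Pa t ≤ (15 * η * exp (-(1 / 2 * t))) ^ 2 := by
  have hanti : AntitoneOn (fun t => energyFlux P Q Pa t * exp t) (Ici 2) := by
    refine antitoneOn_Ici_of_hasDerivAt_nonpos
      (fun t ht => (h.hasDerivAt_energyFlux (by linarith)).mul (Real.hasDerivAt_exp t))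
      fun t ht => ?_
    have hJ := h.energyDens_nonneg hη (by linarith : 0 ≤ t)
    have h1 := h.energyFlux_le (by linarith) hη (h.bP t (by linarith)) (h.bQ t (by linarith)) hJ
    have h2 : energyFlux P Q Pa t ≤ energyDens Pt Pa Qt Qa t := h1.trans (by nlinarith)
    nlinarith [exp_pos t]
  intro t ht
  have h1 := hanti (mem_Ici.2 le_rfl) (mem_Ici.2 ht) ht
  have h2 := h.energyFlux_le_const hη0 hη 2 le_rfl
  have h3 : exp 2 ≤ 225 / 26 := by
    have : exp 2 = exp 1 ^ 2 := by rw [← exp_nat_mul]; norm_num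
    rw [this]
    have := exp_one_lt_d9
    nlinarith [exp_pos 1]
  have h4 : energyFlux P Q Pa t * exp t ≤ 225 * η ^ 2 := by
    refine h1.trans ?_
    calc energyFlux P Q Pa 2 * exp 2 ≤ 26 * η ^ 2 * (225 / 26) :=
          mul_le_mul h2 h3 (exp_pos _).le (by positivity)
      _ = _ := by ring
  have h5 : (15 * η * exp (-(1 / 2 * t))) ^ 2 = 225 * η ^ 2 / exp t := by
    rw [mul_pow, ← exp_nat_mul, div_eq_mul_inv (225 * η ^ 2), ← exp_neg]
    push_cast
    ring_nf
  rw [h5, le_div_iff₀ (exp_pos t)]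
  exact h4

theorem energyFlux_decay_one (h : StripSol η P Q Pt Pa Pta Qt Qa) (hη0 : 0 < η)
    (hη : η ≤ 1 / 1000000)
    (hP : ∀ t ≥ 3, ∀ θ ∈ Icc 0 π, |P t θ| ≤ 270 * η * exp (-(1 / 2 * t)))
    (hQ : ∀ t ≥ 3, ∀ θ ∈ Icc 0 π, |Q t θ| ≤ 270 * η * exp (-(1 / 2 * t))) :
    ∀ t ≥ 3, energyFlux P Q Pa t ≤ (170 * η * exp (-(1 * t))) ^ 2 := by
  set c := 21600 * η with hc
  have hc1 : c ≤ 1 / 4 := by linarith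
  have hc0 : 0 < c := by positivity
  have hη' : η ≤ 1 / 100 := by linarith
  have hx : ∀ t : ℝ, HasDerivAt (fun t => exp (-(1 / 2 * t))) (-(1 / 2) * exp (-(1 / 2 * t))) t :=
    fun t => (((hasDerivAt_id t).const_mul (1 / 2)).neg.exp).congr_deriv (by simp; ring)
  have hw : ∀ t : ℝ, HasDerivAt (fun t => exp (2 * t + 4 * c * exp (-(1 / 2 * t))))
      (exp (2 * t + 4 * c * exp (-(1 / 2 * t))) * (2 - 2 * c * exp (-(1 / 2 * t)))) t := fun t =>
    ((((hasDerivAt_id t).const_mul 2).add ((hx t).const_mul (4 * c))).exp).congr_deriv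
      (by simp; ring)
  have hanti : AntitoneOn
      (fun t => energyFlux P Q Pa t * exp (2 * t + 4 * c * exp (-(1 / 2 * t)))) (Ici 3) := by
    refine antitoneOn_Ici_of_hasDerivAt_nonpos
      (fun t ht => (h.hasDerivAt_energyFlux (by linarith)).mul (hw t)) fun t ht => ?_
    have hJ := h.energyDens_nonneg hη' (by linarith : 0 ≤ t)
    have hx1 : exp (-(1 / 2 * t)) ≤ 1 := exp_le_one_iff.2 (by linarith)
    have hx0 := exp_pos (-(1 / 2 * t))
    have hcx : 270 * η * exp (-(1 / 2 * t)) ≤ 1 / 100 := by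
      have : 270 * η * exp (-(1 / 2 * t)) ≤ 270 * η * 1 :=
        mul_le_mul_of_nonneg_left hx1 (by positivity)
      linarith
    have h1 := h.energyFlux_le (by linarith) hcx (hP t ht) (hQ t ht) hJ
    have e : 80 * (270 * η * exp (-(1 / 2 * t))) = c * exp (-(1 / 2 * t)) := by rw [hc]; ring
    rw [e] at h1
    have hE := h.energyFlux_nonneg hη0 hη' t (by linarith)
    generalize exp (-(1 / 2 * t)) = x at *
    have hw0 := exp_pos (2 * t + 4 * c * x)
    generalize exp (2 * t + 4 * c * x) = w at *
    generalize energyFlux P Q Pa t = E at *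
    generalize energyDens Pt Pa Qt Qa t = J at *
    have hcx1 : c * x ≤ 1 := by nlinarith
    have h2 : E * (2 - 2 * (c * x)) ≤ 1 / 2 * (1 + c * x) * J * (2 - 2 * (c * x)) :=
      mul_le_mul_of_nonneg_right h1 (by linarith)
    have h3 : 1 / 2 * (1 + c * x) * J * (2 - 2 * (c * x)) ≤ J := by
      nlinarith [mul_nonneg (sq_nonneg (c * x)) hJ]
    have h4 : (E * (2 - 2 * (c * x)) - J) * w ≤ 0 :=
      mul_nonpos_of_nonpos_of_nonneg (by linarith) hw0.le
    linarith
  intro t ht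
  have h1 := hanti (mem_Ici.2 le_rfl) (mem_Ici.2 ht) ht
  have h2 := h.energyFlux_le_const hη0 hη' 3 (by norm_num)
  have hE := h.energyFlux_nonneg hη0 hη' t (by linarith)
  have h3 : exp (2 * 3 + 4 * c * exp (-(1 / 2 * 3))) ≤ 28900 / 26 := by
    have h7 : exp 7 = exp 1 ^ 7 := by rw [← exp_nat_mul]; norm_num
    have hx1 : exp (-(1 / 2 * 3) : ℝ) ≤ 1 := exp_le_one_iff.2 (by norm_num)
    calc exp (2 * 3 + 4 * c * exp (-(1 / 2 * 3))) ≤ exp 7 :=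
          exp_le_exp.2 (by nlinarith [exp_pos (-(1 / 2 * 3) : ℝ)])
      _ = exp 1 ^ 7 := h7
      _ ≤ 2.7182818286 ^ 7 := pow_le_pow_left₀ (exp_pos _).le exp_one_lt_d9.le 7
      _ ≤ _ := by norm_num
  have h4 : energyFlux P Q Pa t * exp (2 * t) ≤ 28900 * η ^ 2 := by
    calc energyFlux P Q Pa t * exp (2 * t)
        ≤ energyFlux P Q Pa t * exp (2 * t + 4 * c * exp (-(1 / 2 * t))) :=
          mul_le_mul_of_nonneg_left (exp_le_exp.2 (by
            have := exp_pos (-(1 / 2 * t)); nlinarith [mul_pos hc0 this])) hE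
      _ ≤ energyFlux P Q Pa 3 * exp (2 * 3 + 4 * c * exp (-(1 / 2 * 3))) := h1
      _ ≤ 26 * η ^ 2 * (28900 / 26) := mul_le_mul h2 h3 (exp_pos _).le (by positivity)
      _ = _ := by ring
  have h5 : (170 * η * exp (-(1 * t))) ^ 2 = 28900 * η ^ 2 / exp (2 * t) := by
    rw [mul_pow, ← exp_nat_mul, div_eq_mul_inv (28900 * η ^ 2), ← exp_neg]
    push_cast
    ring_nf
  rw [h5, le_div_iff₀ (exp_pos _)]
  exact h4

/-- Decay of the energy flux yields a limit of the gradient along a sequence of arcs. -/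
theorem exists_good_arcs (h : StripSol η P Q Pt Pa Pta Qt Qa) (hη0 : 0 < η) (hη : η ≤ 1 / 100)
    {κ σ t₀ : ℝ} (hκ : 0 < κ) (hσ : 1 / 2 ≤ σ) (ht₀ : 1 ≤ t₀)
    (hE : ∀ t ≥ t₀, energyFlux P Q Pa t ≤ (κ * exp (-(σ * t))) ^ 2) :
    ∃ p₀ : ℝ, ∀ t ≥ t₀, ∃ s ∈ Icc t (t + 1), ∀ θ ∈ Icc 0 π,
      |P s θ - p₀| ≤ 4 * (κ * exp (-(σ * t))) ∧ |Q s θ - bdN p₀| ≤ 6 * (κ * exp (-(σ * t))) := by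
  set δ : ℝ → ℝ := fun t => κ * exp (-(σ * t)) with hδ
  have hδ0 : ∀ t, 0 < δ t := fun t => mul_pos hκ (exp_pos _)
  have hδd : ∀ t, HasDerivAt δ (-σ * δ t) t := fun t =>
    ((((hasDerivAt_id t).const_mul σ).neg.exp).const_mul κ).congr_deriv (by simp [hδ]; ring)
  have hδanti : ∀ s t, s ≤ t → δ t ≤ δ s := fun s t hst =>
    mul_le_mul_of_nonneg_left (exp_le_exp.2 (by nlinarith)) hκ.le
  set E := energyFlux P Q Pa with hEdef
  set J := energyDens Pt Pa Qt Qa with hJdef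
  have hEd : ∀ t ≥ t₀, HasDerivAt E (-J t) t := fun t ht =>
    h.hasDerivAt_energyFlux (by linarith)
  have hE0 : ∀ t ≥ t₀, 0 ≤ E t := fun t ht => h.energyFlux_nonneg hη0 hη t (by linarith)
  have hJ0 : ∀ t ≥ t₀, 0 ≤ J t := fun t ht => h.energyDens_nonneg hη (by linarith)
  set m : ℝ → ℝ := fun t => ∫ θ in 0..π, P t θ with hm
  set m' : ℝ → ℝ := fun t => ∫ θ in 0..π, Pt t θ with hm'
  have hmd : ∀ t ≥ t₀, HasDerivAt m (m' t) t := fun t ht =>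
    hasDerivAt_integral_strip h.cP h.cPt h.dPt (by linarith)
  have hm2 : ∀ t ≥ t₀, |m' t| ≤ J t / δ t + δ t := by
    intro t ht
    have ht' : 0 ≤ t := by linarith
    have h1 := sq_integral_le (continuousOn_slice h.cPt ht')
    have h2 := (integral_sq_le_of_le_add (continuousOn_slice h.cPt ht')
      (continuousOn_slice h.cQt ht')
      (h.integral_sq_radial_le ht' hη (h.bP t ht') (h.bQ t ht'))).1
    have h3 : m' t ^ 2 ≤ 4 * J t := by
      have h4 : ∫ θ in 0..π, Pt t θ ^ 2 ≤ 6 / 5 * J t := h2.trans (by nlinarith [hJ0 t ht])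
      refine h1.trans ((mul_le_mul_of_nonneg_left h4 pi_pos.le).trans ?_)
      nlinarith [hJ0 t ht, pi_lt_d2]
    have h5 : 0 ≤ J t / δ t := div_nonneg (hJ0 t ht) (hδ0 t).le
    refine abs_le_of_sq_le_sq (h3.trans ?_) (by linarith [hδ0 t])
    have h6 : J t = J t / δ t * δ t := (div_mul_cancel₀ _ (hδ0 t).ne').symm
    nlinarith [sq_nonneg (J t / δ t - δ t)]
  set Y : ℝ → ℝ := fun t => E t / δ t + 3 * δ t with hY
  have hYd : ∀ t ≥ t₀, HasDerivAt Y
      ((-J t * δ t - E t * (-σ * δ t)) / δ t ^ 2 + 3 * (-σ * δ t)) t := fun t ht =>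
    ((hEd t ht).div (hδd t) (hδ0 t).ne').add ((hδd t).const_mul 3)
  have hYle : ∀ t ≥ t₀, (-J t * δ t - E t * (-σ * δ t)) / δ t ^ 2 + 3 * (-σ * δ t) ≤
      -(J t / δ t + δ t) := by
    intro t ht
    have h1 : (-J t * δ t - E t * (-σ * δ t)) / δ t ^ 2 = -(J t / δ t) + σ * (E t / δ t) := by
      have := (hδ0 t).ne'
      field_simp
      ring
    have h2 : E t / δ t ≤ δ t := by
      rw [div_le_iff₀ (hδ0 t), ← sq]
      exact hE t ht
    have h3 : σ * (E t / δ t) ≤ σ * δ t := mul_le_mul_of_nonneg_left h2 (by linarith)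
    have h4 : 1 / 2 * δ t ≤ σ * δ t := mul_le_mul_of_nonneg_right hσ (hδ0 t).le
    rw [h1]
    linarith
  have hup : AntitoneOn (fun t => m t + Y t) (Ici t₀) :=
    antitoneOn_Ici_of_hasDerivAt_nonpos (fun t ht => (hmd t ht).add (hYd t ht)) fun t ht => by
      linarith [hYle t ht, hm2 t ht, le_abs_self (m' t)]
  have hdown : AntitoneOn (fun t => -m t + Y t) (Ici t₀) :=
    antitoneOn_Ici_of_hasDerivAt_nonpos (fun t ht => (hmd t ht).neg.add (hYd t ht)) fun t ht => by
      linarith [hYle t ht, hm2 t ht, neg_abs_le (m' t)]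
  have hY0 : ∀ t ≥ t₀, 0 ≤ Y t := fun t ht =>
    add_nonneg (div_nonneg (hE0 t ht) (hδ0 t).le) (by linarith [hδ0 t])
  have hY4 : ∀ t ≥ t₀, Y t ≤ 4 * δ t := fun t ht => by
    have h2 : E t / δ t ≤ δ t := by
      rw [div_le_iff₀ (hδ0 t), ← sq]
      exact hE t ht
    simp only [hY]
    linarith
  have hcross : ∀ s ≥ t₀, ∀ t ≥ t₀, m s - Y s ≤ m t + Y t := by
    intro s hs t ht
    rcases le_total s t with hst | hst
    · have := hdown (mem_Ici.2 hs) (mem_Ici.2 ht) hst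
      simp only at this
      linarith [hY0 t ht]
    · have := hup (mem_Ici.2 ht) (mem_Ici.2 hs) hst
      simp only at this
      linarith [hY0 s hs]
  set M := sSup ((fun t => m t - Y t) '' Ici t₀) with hM
  have hne : ((fun t => m t - Y t) '' Ici t₀).Nonempty := ⟨_, t₀, mem_Ici.2 le_rfl, rfl⟩
  have hM1 : ∀ t ≥ t₀, m t - Y t ≤ M := fun t ht =>
    le_csSup ⟨m t₀ + Y t₀, by rintro _ ⟨s, hs, rfl⟩; exact hcross s hs t₀ le_rfl⟩ ⟨t, ht, rfl⟩
  have hM2 : ∀ t ≥ t₀, M ≤ m t + Y t := fun t ht =>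
    csSup_le hne (by rintro _ ⟨s, hs, rfl⟩; exact hcross s hs t ht)
  refine ⟨M / π, fun t ht => ?_⟩
  obtain ⟨s, hs, hslope⟩ := exists_hasDerivAt_eq_slope E (fun t => -J t) (by linarith : t < t + 1)
    (fun u hu => (hEd u (ht.trans hu.1)).continuousAt.continuousWithinAt)
    (fun u hu => hEd u (ht.trans hu.1.le))
  have hst : t₀ ≤ s := ht.trans hs.1.le
  have hs0 : 0 ≤ s := by linarith
  have hJs : J s ≤ δ t ^ 2 := by
    have h1 := hE0 (t + 1) (by linarith)
    have h2 := hE t ht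
    rw [add_sub_cancel_left, div_one] at hslope
    linarith
  have hang := integral_sq_le_of_le_add (continuousOn_slice h.cPa hs0)
    (continuousOn_slice h.cQa hs0) (h.integral_sq_angle_le hs0 hη (h.bP s hs0) (h.bQ s hs0))
  have hosc : ∀ {f f' : ℝ → ℝ}, ContinuousOn f' (Icc 0 π) →
      (∀ θ ∈ Icc 0 π, HasDerivAt f (f' θ) θ) →
      ∫ θ in 0..π, f' θ ^ 2 ≤ (1 + 20 * η) * J s →
      ∀ x ∈ Icc 0 π, ∀ y ∈ Icc 0 π, |f x - f y| ≤ 2 * δ t := by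
    intro f f' hf' hd h_int x hx y hy
    refine abs_le_of_sq_le_sq ((sq_sub_le_integral_sq hf' hd hx hy).trans ?_)
      (by linarith [hδ0 t])
    have h4 : ∫ θ in 0..π, f' θ ^ 2 ≤ 6 / 5 * δ t ^ 2 :=
      h_int.trans (by nlinarith [hJ0 s hst])
    refine (mul_le_mul_of_nonneg_left h4 pi_pos.le).trans ?_
    nlinarith [pi_lt_d2, pow_pos (hδ0 t) 2]
  have hPosc := hosc (continuousOn_slice h.cPa hs0) (h.dPa s hs0) hang.1
  have hQosc := hosc (continuousOn_slice h.cQa hs0) (h.dQa s hs0) hang.2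
  have hPp : ∀ θ ∈ Icc 0 π, |P s θ - M / π| ≤ 4 * δ t := by
    intro θ hθ
    have h1 : |∫ x in 0..π, (P s θ - P s x)| ≤ 2 * δ t * |π - 0| := by
      refine intervalIntegral.norm_integral_le_of_norm_le_const
        (f := fun x => P s θ - P s x) fun x hx => ?_
      rw [uIoc_of_le pi_pos.le] at hx
      exact hPosc θ hθ x (Ioc_subset_Icc_self hx)
    rw [intervalIntegral.integral_sub intervalIntegrable_const
      ((continuousOn_slice h.cP hs0).intervalIntegrable_of_Icc pi_pos.le),
      intervalIntegral.integral_const, sub_zero, abs_of_pos pi_pos, smul_eq_mul] at h1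
    have h2 := hM1 s hst
    have h3 := hM2 s hst
    have h4 := (hY4 s hst).trans (mul_le_mul_of_nonneg_left (hδanti t s hs.1.le) (by norm_num))
    have h5 : |π * (P s θ - M / π)| ≤ π * (4 * δ t) := by
      have e : π * (P s θ - M / π) = (π * P s θ - m s) + (m s - M) := by
        have := pi_ne_zero
        field_simp
        ring
      rw [e]
      have h6 : |m s - M| ≤ 4 * δ t := abs_le.2 ⟨by linarith, by linarith⟩
      refine (abs_add_le _ _).trans ((add_le_add h1 h6).trans ?_)
      nlinarith [hδ0 t, pi_gt_three]
    rw [abs_mul, abs_of_pos pi_pos] at h5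
    exact le_of_mul_le_mul_left h5 pi_pos
  have hmem : (0 : ℝ) ∈ Icc 0 π := ⟨le_rfl, pi_pos.le⟩
  refine ⟨s, ⟨hs.1.le, hs.2.le⟩, fun θ hθ => ⟨hPp θ hθ, ?_⟩⟩
  have h1 := hQosc θ hθ 0 hmem
  have h2 := (abs_bdN_sub_le (P s 0) (M / π)).trans (hPp 0 hmem)
  rw [← h.bd0 s hs0] at h2
  calc |Q s θ - bdN (M / π)| = |(Q s θ - Q s 0) + (Q s 0 - bdN (M / π))| := by ring_nf
    _ ≤ _ := abs_add_le _ _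
    _ ≤ 6 * δ t := by linarith

end StripSol

/-- A solution of the planar hodograph problem on the exterior half-plane with gradient at most `η`,
together with its partial derivatives up to third order. -/
structure PlaneSol (η : ℝ) (U : Set (ℝ × ℝ)) (V p q a b c s₁ s₂ s₃ s₄ : ℝ × ℝ → ℝ) : Prop where
  isOpen : IsOpen U
  sub : extHalf ⊆ U
  jV : Jet2On U V p q a b c
  jp : Jet2On U p a b s₁ s₂ s₃
  jq : Jet2On U q b c s₂ s₃ s₄
  c₁ : ContinuousOn s₁ U
  c₂ : ContinuousOn s₂ U
  c₃ : ContinuousOn s₃ U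
  pde : ∀ z ∈ extHalf, 0 < z.2 →
    a z + 2 * (p z / (1 + q z)) * b z + (1 + p z ^ 2) / (1 + q z) ^ 2 * c z = 0
  bdry : ∀ z ∈ extHalf, z.2 = 0 → q z = bdN (p z)
  bp : ∀ z ∈ extHalf, |p z| ≤ η
  bq : ∀ z ∈ extHalf, |q z| ≤ η

/-- The planar point with log-polar coordinates `(t, θ)`. -/
def logPolar (t θ : ℝ) : ℝ × ℝ := (exp t * cos θ, exp t * sin θ)

theorem logPolar_normSq (t θ : ℝ) :
    (logPolar t θ).1 ^ 2 + (logPolar t θ).2 ^ 2 = exp t ^ 2 := by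
  simp only [logPolar]
  linear_combination exp t ^ 2 * sin_sq_add_cos_sq θ

theorem logPolar_mem_extHalf {t θ : ℝ} (ht : 0 ≤ t) (hθ : θ ∈ Icc 0 π) :
    logPolar t θ ∈ extHalf := by
  refine ⟨mul_nonneg (exp_pos t).le (sin_nonneg_of_mem_Icc hθ), ?_⟩
  rw [logPolar_normSq]
  exact one_le_pow₀ (one_le_exp ht)

theorem exists_logPolar {z : ℝ × ℝ} (hz : z ∈ extHalf) :
    ∃ t ≥ 0, ∃ θ ∈ Icc 0 π, z = logPolar t θ := by
  have h0 : 0 < z.1 ^ 2 + z.2 ^ 2 := lt_of_lt_of_le one_pos hz.2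
  set r := √(z.1 ^ 2 + z.2 ^ 2) with hr
  have hr1 : 1 ≤ r := by rw [hr]; exact one_le_sqrt.2 hz.2
  have hr2 : r ^ 2 = z.1 ^ 2 + z.2 ^ 2 := sq_sqrt h0.le
  have hrpos : 0 < r := by linarith
  have habs : |z.1| ≤ r := abs_le_of_sq_le_sq (by nlinarith [sq_nonneg z.2]) hrpos.le
  have h1 : -1 ≤ z.1 / r := by rw [le_div_iff₀ hrpos]; linarith [(abs_le.1 habs).1]
  have h2 : z.1 / r ≤ 1 := by rw [div_le_one hrpos]; exact (abs_le.1 habs).2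
  refine ⟨log r, log_nonneg hr1, arccos (z.1 / r), ⟨arccos_nonneg _, arccos_le_pi _⟩, ?_⟩
  refine Prod.ext ?_ ?_
  · simp only [logPolar, exp_log hrpos, cos_arccos h1 h2]
    field_simp
  · simp only [logPolar, exp_log hrpos, sin_arccos]
    have : r ^ 2 * (1 - (z.1 / r) ^ 2) = z.2 ^ 2 := by
      field_simp
      linarith
    have h3 : r * √(1 - (z.1 / r) ^ 2) = √(z.2 ^ 2) := by
      rw [← this, sqrt_mul (sq_nonneg r), sqrt_sq hrpos.le]
    rw [h3, sqrt_sq hz.1]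

theorem abs_coeff_le {p q g : ℝ} (hg : g ≤ 1 / 100) (hp : |p| ≤ g) (hq : |q| ≤ g) :
    |2 * (p / (1 + q))| ≤ 21 / 10 * g ∧ |(1 + p ^ 2) / (1 + q) ^ 2 - 1| ≤ 21 / 10 * g := by
  have hg0 : 0 ≤ g := (abs_nonneg p).trans hp
  obtain ⟨hp1, hp2⟩ := abs_le.1 hp
  obtain ⟨hq1, hq2⟩ := abs_le.1 hq
  have hq0 : 0 < 1 + q := by linarith
  constructor
  · rw [abs_le, ← mul_div_assoc, le_div_iff₀ hq0, div_le_iff₀ hq0]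
    constructor <;> nlinarith
  · have hpp : p ^ 2 ≤ g * g := by nlinarith
    rw [abs_le, le_sub_iff_add_le, sub_le_iff_le_add, le_div_iff₀ (by positivity),
      div_le_iff₀ (by positivity)]
    constructor
    · nlinarith [sq_nonneg p, sq_nonneg q, mul_nonneg hg0 (sq_nonneg q),
        mul_nonneg hg0 (by linarith : 0 ≤ q + g)]
    · nlinarith [sq_nonneg p, sq_nonneg q, mul_nonneg hg0 (sq_nonneg q),
        mul_nonneg hg0 (by linarith : 0 ≤ q + g)]

/-- A rotated gradient of a solution of a nearly Laplacian equation is nearly conformal. -/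
theorem quasiconformal_bound {p q g a b c x y : ℝ} (hg : g ≤ 1 / 100) (hp : |p| ≤ g) (hq : |q| ≤ g)
    (h : a + 2 * (p / (1 + q)) * b + (1 + p ^ 2) / (1 + q) ^ 2 * c = 0) :
    (a * x + b * y) ^ 2 + (b * x + c * y) ^ 2 ≤
      (1 + 20 * g) * ((b ^ 2 - a * c) * (x ^ 2 + y ^ 2)) := by
  have hg0 : 0 ≤ g := (abs_nonneg p).trans hp
  obtain ⟨hβ, hγ⟩ := abs_coeff_le hg hp hq
  set T := |a| + |b| + |c| with hT
  have hτ : |a + c| ≤ 21 / 10 * g * T := by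
    have : a + c = -(2 * (p / (1 + q)) * b) - ((1 + p ^ 2) / (1 + q) ^ 2 - 1) * c := by linarith
    rw [this]
    refine (abs_sub _ _).trans ?_
    rw [abs_neg, abs_mul _ b, abs_mul _ c, hT]
    linarith [mul_le_mul_of_nonneg_right hβ (abs_nonneg b),
      mul_le_mul_of_nonneg_right hγ (abs_nonneg c), mul_nonneg hg0 (abs_nonneg a)]
  have hT0 : 0 ≤ T := by positivity
  have hT2 : T ^ 2 ≤ 5 / 2 * (a ^ 2 + 2 * b ^ 2 + c ^ 2) := by
    rw [hT, ← sq_abs a, ← sq_abs b, ← sq_abs c]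
    linarith [sq_nonneg (|a| - |c|), sq_nonneg (|a| - 2 * |b|), sq_nonneg (|c| - 2 * |b|)]
  have hτ2 : (a + c) ^ 2 ≤ (21 / 10 * g * T) ^ 2 := sq_le_sq.2 (hτ.trans (le_abs_self _))
  have hgg : g ^ 2 ≤ 1 / 10000 := by nlinarith
  have hTD : T ^ 2 ≤ 51 / 10 * (b ^ 2 - a * c) := by
    have : (21 / 10 * g * T) ^ 2 ≤ 441 / 1000000 * T ^ 2 := by
      linarith [mul_le_mul_of_nonneg_right hgg (sq_nonneg T)]
    linarith [sq_nonneg T]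
  have hform : |a * x ^ 2 + 2 * b * (x * y) + c * y ^ 2| ≤ T * (x ^ 2 + y ^ 2) := by
    have hxy : |2 * (x * y)| ≤ x ^ 2 + y ^ 2 := by
      rw [abs_le]; constructor <;> nlinarith [sq_nonneg (x + y), sq_nonneg (x - y)]
    calc |a * x ^ 2 + 2 * b * (x * y) + c * y ^ 2|
        = |a * x ^ 2 + b * (2 * (x * y)) + c * y ^ 2| := by ring_nf
      _ ≤ |a * x ^ 2| + |b * (2 * (x * y))| + |c * y ^ 2| := abs_add_three _ _ _
      _ = |a| * x ^ 2 + |b| * |2 * (x * y)| + |c| * y ^ 2 := by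
          simp only [abs_mul, abs_of_nonneg (sq_nonneg x), abs_of_nonneg (sq_nonneg y)]
      _ ≤ T * (x ^ 2 + y ^ 2) := by
          have e : T * (x ^ 2 + y ^ 2) = |a| * x ^ 2 + |a| * y ^ 2 + |b| * (x ^ 2 + y ^ 2) +
              |c| * x ^ 2 + |c| * y ^ 2 := by rw [hT]; ring
          linarith [mul_le_mul_of_nonneg_left hxy (abs_nonneg b),
            mul_nonneg (abs_nonneg a) (sq_nonneg y), mul_nonneg (abs_nonneg c) (sq_nonneg x)]
  have hprod : (a + c) * (a * x ^ 2 + 2 * b * (x * y) + c * y ^ 2) ≤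
      21 / 10 * g * T * (T * (x ^ 2 + y ^ 2)) := by
    refine (le_abs_self _).trans ?_
    rw [abs_mul]
    exact mul_le_mul hτ hform (abs_nonneg _) (by positivity)
  have hfin : 21 / 10 * g * T * (T * (x ^ 2 + y ^ 2)) ≤
      20 * g * ((b ^ 2 - a * c) * (x ^ 2 + y ^ 2)) := by
    have h1 : 21 / 10 * T ^ 2 ≤ 20 * (b ^ 2 - a * c) := by linarith [sq_nonneg T]
    linarith [mul_le_mul_of_nonneg_right h1
      (mul_nonneg hg0 (add_nonneg (sq_nonneg x) (sq_nonneg y)))]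
  linarith

namespace PlaneSol

variable {η : ℝ} {U : Set (ℝ × ℝ)} {V p q a b c s₁ s₂ s₃ s₄ : ℝ × ℝ → ℝ}

theorem hasDerivAt_logPolar_time {g g₁ g₂ : ℝ × ℝ → ℝ} {t θ : ℝ}
    (hg : HasGradAt g (g₁ (logPolar t θ)) (g₂ (logPolar t θ)) (logPolar t θ)) :
    HasDerivAt (fun s => g (logPolar s θ)) (g₁ (logPolar t θ) * (logPolar t θ).1 +
      g₂ (logPolar t θ) * (logPolar t θ).2) t :=
  hg.comp_curve (α := fun s => exp s * cos θ) (β := fun s => exp s * sin θ)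
    ((hasDerivAt_exp t).mul_const _) ((hasDerivAt_exp t).mul_const _)

theorem hasDerivAt_logPolar_angle {g g₁ g₂ : ℝ × ℝ → ℝ} {t θ : ℝ}
    (hg : HasGradAt g (g₁ (logPolar t θ)) (g₂ (logPolar t θ)) (logPolar t θ)) :
    HasDerivAt (fun s => g (logPolar t s)) (g₁ (logPolar t θ) * -(logPolar t θ).2 +
      g₂ (logPolar t θ) * (logPolar t θ).1) θ :=
  (hg.comp_curve (α := fun s => exp t * cos s) (β := fun s => exp t * sin s)
    ((hasDerivAt_cos θ).const_mul _) ((hasDerivAt_sin θ).const_mul _)).congr_deriv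
    (by simp only [logPolar]; ring)

theorem continuousOn_logPolar {g : ℝ × ℝ → ℝ} (hU : extHalf ⊆ U) (hg : ContinuousOn g U) :
    ContinuousOn (fun z : ℝ × ℝ => g (logPolar z.1 z.2)) (Ici 0 ×ˢ Icc 0 π) :=
  hg.comp (f := fun z : ℝ × ℝ => logPolar z.1 z.2)
    (by unfold logPolar; fun_prop) fun _ hz => hU (logPolar_mem_extHalf hz.1 hz.2)

/-- The gradient of a solution in log-polar coordinates. -/
theorem stripSol (h : PlaneSol η U V p q a b c s₁ s₂ s₃ s₄) :
    StripSol η (fun t θ => p (logPolar t θ)) (fun t θ => q (logPolar t θ))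
      (fun t θ => a (logPolar t θ) * (logPolar t θ).1 + b (logPolar t θ) * (logPolar t θ).2)
      (fun t θ => a (logPolar t θ) * -(logPolar t θ).2 + b (logPolar t θ) * (logPolar t θ).1)
      (fun t θ => (s₁ (logPolar t θ) * (logPolar t θ).1 + s₂ (logPolar t θ) * (logPolar t θ).2) *
          -(logPolar t θ).2 + a (logPolar t θ) * -(logPolar t θ).2 +
        ((s₂ (logPolar t θ) * (logPolar t θ).1 + s₃ (logPolar t θ) * (logPolar t θ).2) *
          (logPolar t θ).1 + b (logPolar t θ) * (logPolar t θ).1))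
      (fun t θ => b (logPolar t θ) * (logPolar t θ).1 + c (logPolar t θ) * (logPolar t θ).2)
      (fun t θ => b (logPolar t θ) * -(logPolar t θ).2 + c (logPolar t θ) * (logPolar t θ).1) := by
  have hm : ∀ t ≥ (0 : ℝ), ∀ θ ∈ Icc 0 π, logPolar t θ ∈ U :=
    fun t ht θ hθ => h.sub (logPolar_mem_extHalf ht hθ)
  have cp : ContinuousOn p U := fun z hz => (h.jp.grad z hz).continuousAt.continuousWithinAt
  have cq : ContinuousOn q U := fun z hz => (h.jq.grad z hz).continuousAt.continuousWithinAt
  have ca : ContinuousOn a U := fun z hz => (h.jp.gradx z hz).continuousAt.continuousWithinAt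
  have cb : ContinuousOn b U := fun z hz => (h.jp.grady z hz).continuousAt.continuousWithinAt
  have cc : ContinuousOn c U := fun z hz => (h.jq.grady z hz).continuousAt.continuousWithinAt
  have c1 : ContinuousOn (fun z : ℝ × ℝ => (logPolar z.1 z.2).1) (Ici 0 ×ˢ Icc 0 π) := by
    unfold logPolar; fun_prop
  have c2 : ContinuousOn (fun z : ℝ × ℝ => (logPolar z.1 z.2).2) (Ici 0 ×ˢ Icc 0 π) := by
    unfold logPolar; fun_prop
  have lp := fun {g : ℝ × ℝ → ℝ} (hg : ContinuousOn g U) => continuousOn_logPolar h.sub hg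
  have ex : ∀ t θ : ℝ, HasDerivAt (fun s => (logPolar s θ).1) (logPolar t θ).1 t := fun t θ =>
    (hasDerivAt_exp t).mul_const _
  have ey : ∀ t θ : ℝ, HasDerivAt (fun s => (logPolar s θ).2) (logPolar t θ).2 t := fun t θ =>
    (hasDerivAt_exp t).mul_const _
  have ax : ∀ t θ : ℝ, HasDerivAt (fun s => (logPolar t s).1) (-(logPolar t θ).2) θ := fun t θ =>
    ((hasDerivAt_cos θ).const_mul _).congr_deriv (by simp [logPolar])
  have ay : ∀ t θ : ℝ, HasDerivAt (fun s => (logPolar t s).2) (logPolar t θ).1 θ := fun t θ =>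
    (hasDerivAt_sin θ).const_mul _
  refine ⟨fun t ht θ hθ => hasDerivAt_logPolar_time (h.jp.grad _ (hm t ht θ hθ)),
    fun t ht θ hθ => hasDerivAt_logPolar_angle (h.jp.grad _ (hm t ht θ hθ)),
    fun t ht θ hθ => hasDerivAt_logPolar_time (h.jq.grad _ (hm t ht θ hθ)),
    fun t ht θ hθ => hasDerivAt_logPolar_angle (h.jq.grad _ (hm t ht θ hθ)),
    fun t ht θ hθ => ?_, fun t ht θ hθ => ?_, lp cp, lp cq, ((lp ca).mul c1).add ((lp cb).mul c2),
    ((lp ca).mul c2.neg).add ((lp cb).mul c1), ?_, ((lp cb).mul c1).add ((lp cc).mul c2),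
    ((lp cb).mul c2.neg).add ((lp cc).mul c1), fun t ht θ hθ g hg hP hQ => ?_,
    fun t ht θ hθ g hg hP hQ => ?_, fun t ht => ?_, fun t ht => ?_,
    fun t ht θ hθ => h.bp _ (logPolar_mem_extHalf ht hθ),
    fun t ht θ hθ => h.bq _ (logPolar_mem_extHalf ht hθ)⟩
  · exact ((hasDerivAt_logPolar_time (h.jp.gradx _ (hm t ht θ hθ))).mul (ey t θ).neg).add
      ((hasDerivAt_logPolar_time (h.jp.grady _ (hm t ht θ hθ))).mul (ex t θ))
  · refine (((hasDerivAt_logPolar_angle (h.jp.gradx _ (hm t ht θ hθ))).mul (ax t θ)).add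
      ((hasDerivAt_logPolar_angle (h.jp.grady _ (hm t ht θ hθ))).mul (ay t θ))).congr_deriv ?_
    ring
  · exact (((((lp h.c₁).mul c1).add ((lp h.c₂).mul c2)).mul c2.neg).add ((lp ca).mul c2.neg)).add
      (((((lp h.c₂).mul c1).add ((lp h.c₃).mul c2)).mul c1).add ((lp cb).mul c1))
  · have hz := logPolar_mem_extHalf ht (Ioo_subset_Icc_self hθ)
    have hy : 0 < (logPolar t θ).2 := mul_pos (exp_pos t) (sin_pos_of_mem_Ioo hθ)
    refine (quasiconformal_bound (x := -(logPolar t θ).2) (y := (logPolar t θ).1)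
      hg hP hQ (h.pde _ hz hy)).trans_eq ?_
    ring
  · have hz := logPolar_mem_extHalf ht (Ioo_subset_Icc_self hθ)
    have hy : 0 < (logPolar t θ).2 := mul_pos (exp_pos t) (sin_pos_of_mem_Ioo hθ)
    refine (quasiconformal_bound (x := (logPolar t θ).1) (y := (logPolar t θ).2)
      hg hP hQ (h.pde _ hz hy)).trans_eq ?_
    ring
  · exact h.bdry _ (logPolar_mem_extHalf ht ⟨le_rfl, pi_pos.le⟩) (by simp [logPolar])
  · exact h.bdry _ (logPolar_mem_extHalf ht ⟨pi_pos.le, le_rfl⟩) (by simp [logPolar])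

end PlaneSol

theorem jet2On_const (U : Set (ℝ × ℝ)) (k : ℝ) :
    Jet2On U (fun _ => k) (fun _ => 0) (fun _ => 0) (fun _ => 0) (fun _ => 0) (fun _ => 0) :=
  ⟨fun z _ => hasGradAt_const k z, fun z _ => hasGradAt_const 0 z, fun z _ => hasGradAt_const 0 z⟩

theorem HasGradAt.eq_zero_of_eventually {g : ℝ × ℝ → ℝ} {a b : ℝ} {z : ℝ × ℝ}
    (hg : HasGradAt g a b z) (h : ∀ᶠ w in nhds z, g w = 0) : a = 0 ∧ b = 0 :=
  hg.unique (HasFDerivAt.congr_of_eventuallyEq (hasGradAt_const 0 z) h)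

namespace PlaneSol

variable {η : ℝ} {U : Set (ℝ × ℝ)} {V p q a b c s₁ s₂ s₃ s₄ : ℝ × ℝ → ℝ}

theorem one_add_pos (h : PlaneSol η U V p q a b c s₁ s₂ s₃ s₄) (hη : η ≤ 1 / 100) {z : ℝ × ℝ}
    (hz : z ∈ extHalf) : 0 < 1 + q z := by
  linarith [(abs_le.1 (h.bq z hz)).1]

/-- The equations satisfied by the first derivatives of a solution. -/
theorem grad_pde (h : PlaneSol η U V p q a b c s₁ s₂ s₃ s₄) (hη : η ≤ 1 / 100) {z : ℝ × ℝ}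
    (hz : 1 < z.1 ^ 2 + z.2 ^ 2) (hz2 : 0 < z.2) :
    s₁ z + 2 * (p z / (1 + q z)) * s₂ z + (1 + p z ^ 2) / (1 + q z) ^ 2 * s₃ z +
        (4 * (1 + q z) * b z + 2 * p z * c z) / (1 + q z) ^ 2 * a z +
        2 * p z * b z / (1 + q z) ^ 2 * b z = 0 ∧
      s₂ z + 2 * (p z / (1 + q z)) * s₃ z + (1 + p z ^ 2) / (1 + q z) ^ 2 * s₄ z +
        (2 * (1 + q z) * b z + 4 * p z * c z) / (1 + q z) ^ 2 * b z +
        2 * (1 + q z) * a z / (1 + q z) ^ 2 * c z = 0 := by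
  have hzU : z ∈ U := h.sub ⟨hz2.le, hz.le⟩
  have hq0 := h.one_add_pos hη (z := z) ⟨hz2.le, hz.le⟩
  have gp := h.jp.grad z hzU
  have gq := (hasGradAt_const 1 z).add (h.jq.grad z hzU)
  have ga := h.jp.gradx z hzU
  have gb := h.jp.grady z hzU
  have gc := h.jq.grady z hzU
  have key := (((gq.mul gq).mul ga).add (((gp.mul gq).mul gb).const_mul 2)).add
    (((hasGradAt_const 1 z).add (gp.mul gp)).mul gc)
  have hev : ∀ᶠ w : ℝ × ℝ in nhds z, (1 + q w) * (1 + q w) * a w + 2 * (p w * (1 + q w) * b w) +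
      (1 + p w * p w) * c w = 0 := by
    have h1 : ∀ᶠ w : ℝ × ℝ in nhds z, 1 < w.1 ^ 2 + w.2 ^ 2 :=
      (by fun_prop : Continuous fun w : ℝ × ℝ => w.1 ^ 2 + w.2 ^ 2).continuousAt.eventually_const_lt hz
    have h2 : ∀ᶠ w : ℝ × ℝ in nhds z, 0 < w.2 :=
      continuous_snd.continuousAt.eventually_const_lt hz2
    filter_upwards [h1, h2] with w hw1 hw2
    have hw := h.pde w ⟨hw2.le, hw1.le⟩ hw2
    have hqw := h.one_add_pos hη (z := w) ⟨hw2.le, hw1.le⟩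
    field_simp at hw
    linarith
  obtain ⟨e1, e2⟩ := key.eq_zero_of_eventually hev
  constructor
  · field_simp
    linarith
  · field_simp
    linarith

theorem grad_bdry (h : PlaneSol η U V p q a b c s₁ s₂ s₃ s₄) {z : ℝ × ℝ}
    (hz : 1 < z.1 ^ 2 + z.2 ^ 2) (hz2 : z.2 = 0) : b z = p z / √(1 + p z ^ 2) * a z := by
  have hzU : z ∈ U := h.sub ⟨hz2.ge, hz.le⟩
  obtain ⟨x, y⟩ := z
  obtain rfl : y = 0 := hz2
  have d1 : HasDerivAt (fun s => p (s, 0)) (a (x, 0)) x :=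
    ((h.jp.grad _ hzU).comp_curve (α := fun s => s) (β := fun _ => 0) (hasDerivAt_id x)
      (hasDerivAt_const x 0)).congr_deriv (by simp)
  have d2 : HasDerivAt (fun s => q (s, 0)) (b (x, 0)) x :=
    ((h.jq.grad _ hzU).comp_curve (α := fun s => s) (β := fun _ => 0) (hasDerivAt_id x)
      (hasDerivAt_const x 0)).congr_deriv (by simp)
  have hev : ∀ᶠ s in nhds x, q (s, 0) = bdN (p (s, 0)) := by
    have h1 : ∀ᶠ s : ℝ in nhds x, 1 < s ^ 2 :=
      (by fun_prop : Continuous fun s : ℝ => s ^ 2).continuousAt.eventually_const_lt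
        (by simpa using hz)
    filter_upwards [h1] with s hs
    exact h.bdry _ ⟨le_rfl, by simpa using hs.le⟩ rfl
  exact d2.unique (d1.bdN_comp.congr_of_eventuallyEq hev)

theorem elliptic_coeff (h : PlaneSol η U V p q a b c s₁ s₂ s₃ s₄) (hη : η ≤ 1 / 100) {z : ℝ × ℝ}
    (hz : z ∈ extHalf) : (p z / (1 + q z)) ^ 2 ≤ (1 + p z ^ 2) / (1 + q z) ^ 2 ∧
      1 / 4 ≤ (1 + p z ^ 2) / (1 + q z) ^ 2 := by
  have hq0 := h.one_add_pos hη hz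
  have hq1 := (abs_le.1 (h.bq z hz)).2
  constructor
  · rw [div_pow]
    gcongr
    linarith
  · rw [le_div_iff₀ (by positivity)]
    nlinarith [sq_nonneg (p z)]

/-- Maximum principle for the gradient of a solution. -/
theorem abs_grad_sub_le (h : PlaneSol η U V p q a b c s₁ s₂ s₃ s₄) (hη : η ≤ 1 / 100)
    {ρ₁ ρ₂ p₀ B₁ B₂ : ℝ} (hρ : 1 < ρ₁) (hB : B₁ ≤ B₂)
    (h₁ : ∀ z ∈ sqAnn ρ₁ ρ₂, z.1 ^ 2 + z.2 ^ 2 = ρ₁ → |p z - p₀| ≤ B₁ ∧ |q z - bdN p₀| ≤ B₂)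
    (h₂ : ∀ z ∈ sqAnn ρ₁ ρ₂, z.1 ^ 2 + z.2 ^ 2 = ρ₂ → |p z - p₀| ≤ B₁ ∧ |q z - bdN p₀| ≤ B₂) :
    ∀ z ∈ sqAnn ρ₁ ρ₂, |p z - p₀| ≤ B₁ ∧ |q z - bdN p₀| ≤ B₂ := by
  have hS : sqAnn ρ₁ ρ₂ ⊆ extHalf := sqAnn_subset_extHalf hρ.le
  have hSU := hS.trans h.sub
  have hpos : ∀ z ∈ sqAnn ρ₁ ρ₂, 1 + q z ≠ 0 := fun z hz => (h.one_add_pos hη (hS hz)).ne'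
  have cp : ContinuousOn p (sqAnn ρ₁ ρ₂) :=
    fun z hz => (h.jp.grad z (hSU hz)).continuousAt.continuousWithinAt
  have cq : ContinuousOn q (sqAnn ρ₁ ρ₂) :=
    fun z hz => (h.jq.grad z (hSU hz)).continuousAt.continuousWithinAt
  have ca : ContinuousOn a (sqAnn ρ₁ ρ₂) :=
    fun z hz => (h.jp.gradx z (hSU hz)).continuousAt.continuousWithinAt
  have cb : ContinuousOn b (sqAnn ρ₁ ρ₂) :=
    fun z hz => (h.jp.grady z (hSU hz)).continuousAt.continuousWithinAt
  obtain ⟨D, hD⟩ := (isCompact_sqAnn ρ₁ ρ₂).exists_bound_of_continuousOn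
    (f := fun z => 2 * p z * b z / (1 + q z) ^ 2)
    (((cp.const_mul 2).mul cb).div ((cq.const_add 1).pow 2) fun z hz => pow_ne_zero 2 (hpos z hz))
  obtain ⟨D', hD'⟩ := (isCompact_sqAnn ρ₁ ρ₂).exists_bound_of_continuousOn
    (f := fun z => 2 * (1 + q z) * a z / (1 + q z) ^ 2)
    ((((cq.const_add 1).const_mul 2).mul ca).div ((cq.const_add 1).pow 2)
      fun z hz => pow_ne_zero 2 (hpos z hz))
  have hell := fun z (hz : z ∈ sqAnn ρ₁ ρ₂) => (h.elliptic_coeff hη (hS hz)).1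
  have hb := fun z (hz : z ∈ sqAnn ρ₁ ρ₂) => (h.elliptic_coeff hη (hS hz)).2
  have hP : ∀ k : ℝ, |k| = 1 → ∀ z ∈ sqAnn ρ₁ ρ₂,
      k * p z + -(k * p₀) ≤ B₁ := by
    intro k hk
    have hle : ∀ z, |p z - p₀| ≤ B₁ → k * p z + -(k * p₀) ≤ B₁ := fun z hz => by
      refine (le_abs_self _).trans ?_
      rwa [show k * p z + -(k * p₀) = k * (p z - p₀) by ring, abs_mul, hk, one_mul]
    refine max_principle (β := fun z => -(p z / √(1 + p z ^ 2))) h.isOpen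
      ((h.jp.const_mul k).add (jet2On_const U (-(k * p₀)))) hSU hell hb hD ?_ ?_
      (fun z hz hr => hle z (h₁ z hz hr).1) (fun z hz hr => hle z (h₂ z hz hr).1)
      (d₁ := fun z => (4 * (1 + q z) * b z + 2 * p z * c z) / (1 + q z) ^ 2)
    · intro z hz hz2
      have := (h.grad_pde hη (hρ.trans_le hz.2.1) hz2).1
      refine le_of_eq ?_
      linear_combination -k * this
    · intro z hz hz2
      right
      have := h.grad_bdry (hρ.trans_le hz.2.1) hz2
      refine le_of_eq ?_
      linear_combination -k * this
  have hp : ∀ z ∈ sqAnn ρ₁ ρ₂, |p z - p₀| ≤ B₁ := fun z hz => by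
    have e1 := hP 1 (by simp) z hz
    have e2 := hP (-1) (by simp) z hz
    rw [abs_le]
    constructor <;> linarith
  have hQ : ∀ k : ℝ, |k| = 1 → ∀ z ∈ sqAnn ρ₁ ρ₂, k * q z + -(k * bdN p₀) ≤ B₂ := by
    intro k hk
    have hle : ∀ z, |q z - bdN p₀| ≤ B₂ → k * q z + -(k * bdN p₀) ≤ B₂ := fun z hz => by
      refine (le_abs_self _).trans ?_
      rwa [show k * q z + -(k * bdN p₀) = k * (q z - bdN p₀) by ring, abs_mul, hk, one_mul]
    refine max_principle (β := fun z => 0) h.isOpen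
      ((h.jq.const_mul k).add (jet2On_const U (-(k * bdN p₀)))) hSU hell hb hD' ?_ ?_
      (fun z hz hr => hle z (h₁ z hz hr).2) (fun z hz hr => hle z (h₂ z hz hr).2)
      (d₁ := fun z => (2 * (1 + q z) * b z + 4 * p z * c z) / (1 + q z) ^ 2)
    · intro z hz hz2
      have := (h.grad_pde hη (hρ.trans_le hz.2.1) hz2).2
      refine le_of_eq ?_
      linear_combination -k * this
    · intro z hz hz2
      left
      refine hle z ?_
      rw [h.bdry z (hS hz) hz2]
      exact (abs_bdN_sub_le _ _).trans ((hp z hz).trans hB)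
  intro z hz
  refine ⟨hp z hz, ?_⟩
  have e1 := hQ 1 (by simp) z hz
  have e2 := hQ (-1) (by simp) z hz
  rw [abs_le]
  constructor <;> linarith

end PlaneSol

theorem exists_gt_of_hasDerivAt_ge {f f' : ℝ → ℝ} {X m : ℝ} (hm : 0 < m)
    (hf : ∀ x ≥ X, HasDerivAt f (f' x) x) (hf' : ∀ x ≥ X, m ≤ f' x) (M : ℝ) :
    ∃ x ≥ X, M < f x := by
  have hanti : AntitoneOn (fun x => m * x - f x) (Ici X) :=
    antitoneOn_Ici_of_hasDerivAt_nonpos (f' := fun x => m * 1 - f' x)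
      (fun x hx => ((hasDerivAt_id x).const_mul m).sub (hf x hx))
      (fun x hx => by linarith [hf' x hx])
  set x := X + (|M - f X| + 1) / m with hx
  have hxX : X ≤ x := by rw [hx]; linarith [show 0 ≤ (|M - f X| + 1) / m by positivity]
  refine ⟨x, hxX, ?_⟩
  have h := hanti (self_mem_Ici (a := X)) hxX hxX
  have hmx : m * x = m * X + (|M - f X| + 1) := by rw [hx]; field_simp
  simp only [hmx] at h
  linarith [le_abs_self (M - f X)]

namespace PlaneSol

variable {η : ℝ} {U : Set (ℝ × ℝ)} {V p q a b c s₁ s₂ s₃ s₄ : ℝ × ℝ → ℝ}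

/-- Decay of the energy flux forces pointwise convergence of the gradient. -/
theorem exists_grad_limit (h : PlaneSol η U V p q a b c s₁ s₂ s₃ s₄) (hη0 : 0 < η)
    (hη : η ≤ 1 / 100) {P' : ℝ → ℝ → ℝ} {κ σ t₀ : ℝ} (hκ : 0 < κ) (hσ : 1 / 2 ≤ σ) (hσ1 : σ ≤ 1)
    (ht₀ : 1 ≤ t₀)
    (hP' : P' = fun t θ => a (logPolar t θ) * -(logPolar t θ).2 +
      b (logPolar t θ) * (logPolar t θ).1)
    (hE : ∀ t ≥ t₀, energyFlux (fun t θ => p (logPolar t θ)) (fun t θ => q (logPolar t θ)) P' t ≤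
      (κ * exp (-(σ * t))) ^ 2) :
    ∃ p₀, ∀ t ≥ t₀ + 1, ∀ θ ∈ Icc 0 π, |p (logPolar t θ) - p₀| ≤ 12 * κ * exp (-(σ * t)) ∧
      |q (logPolar t θ) - bdN p₀| ≤ 18 * κ * exp (-(σ * t)) := by
  subst hP'
  obtain ⟨p₀, hp₀⟩ := h.stripSol.exists_good_arcs hη0 hη hκ hσ ht₀ hE
  refine ⟨p₀, fun t ht θ hθ => ?_⟩
  obtain ⟨s, hs, hs'⟩ := hp₀ (t - 1) (by linarith)
  obtain ⟨r, hr, hr'⟩ := hp₀ t (by linarith)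
  have hs1 := hs.1
  have hs2 := hs.2
  have he : exp (-(σ * (t - 1))) ≤ 3 * exp (-(σ * t)) := by
    rw [show -(σ * (t - 1)) = σ + -(σ * t) by ring, exp_add]
    gcongr
    exact (exp_le_exp.2 hσ1).trans (by linarith [exp_one_lt_d9])
  have hpos := exp_pos (-(σ * t))
  have hsq : ∀ {t}, 1 < exp t ^ 2 ↔ 0 < t := fun {t} => by
    rw [one_lt_sq_iff₀ (exp_pos t).le, one_lt_exp_iff]
  have harc : ∀ {s : ℝ} {B₁ B₂ : ℝ}, 0 ≤ s → (∀ θ ∈ Icc 0 π, |p (logPolar s θ) - p₀| ≤ B₁ ∧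
      |q (logPolar s θ) - bdN p₀| ≤ B₂) → ∀ z : ℝ × ℝ, 0 ≤ z.2 → z.1 ^ 2 + z.2 ^ 2 = exp s ^ 2 →
      |p z - p₀| ≤ B₁ ∧ |q z - bdN p₀| ≤ B₂ := by
    intro s B₁ B₂ hs0 H z hz hzr
    obtain ⟨s', hs', φ, hφ, rfl⟩ := exists_logPolar (z := z)
      ⟨hz, by rw [hzr]; exact one_le_pow₀ (one_le_exp hs0)⟩
    rw [logPolar_normSq, pow_left_inj₀ (exp_pos _).le (exp_pos _).le two_ne_zero, exp_eq_exp] at hzr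
    subst hzr
    exact H φ hφ
  refine h.abs_grad_sub_le hη (p₀ := p₀) (ρ₁ := exp s ^ 2) (ρ₂ := exp r ^ 2)
    (hsq.2 (by linarith)) (by nlinarith) (fun z hz hzr => harc (by linarith) (fun φ hφ => ?_) z hz.1 hzr)
    (fun z hz hzr => harc (by linarith [hr.1]) (fun φ hφ => ?_) z hz.1 hzr) _ ⟨?_, ?_, ?_⟩
  · have := hs' φ hφ
    constructor <;> nlinarith
  · have := hr' φ hφ
    have hre : exp (-(σ * t)) * κ ≥ 0 := by positivity
    constructor <;> nlinarith
  · exact (logPolar_mem_extHalf (by linarith) hθ).1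
  · rw [logPolar_normSq]
    gcongr
    linarith
  · rw [logPolar_normSq]
    gcongr
    exact hr.1

/-- A solution whose gradient tends to a non-zero limit is unbounded in both directions. -/
theorem unbounded_of_grad_limit (h : PlaneSol η U V p q a b c s₁ s₂ s₃ s₄) {p₀ K t₀ : ℝ}
    (hp₀ : p₀ ≠ 0)
    (hlim : ∀ t ≥ t₀, ∀ θ ∈ Icc 0 π, |p (logPolar t θ) - p₀| ≤ K * exp (-(1 / 2 * t)))
    {e : ℝ} (he : |e| = 1) (M : ℝ) : ∃ z ∈ extHalf, M < e * V z := by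
  obtain ⟨e', he', hee'⟩ : ∃ e' : ℝ, (e' = 1 ∨ e' = -1) ∧ e * e' * p₀ = |p₀| := by
    rcases (abs_eq one_pos.le).1 he with rfl | rfl <;> rcases abs_choice p₀ with h | h <;>
      simp only [h]
    · exact ⟨1, Or.inl rfl, by ring⟩
    · exact ⟨-1, Or.inr rfl, by ring⟩
    · exact ⟨-1, Or.inr rfl, by ring⟩
    · exact ⟨1, Or.inl rfl, by ring⟩
  have hpos : 0 < |p₀| := abs_pos.2 hp₀
  have ht : Tendsto (fun t : ℝ => K * exp (-(1 / 2 * t))) atTop (nhds 0) := by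
    have h1 : Tendsto (fun t : ℝ => 1 / 2 * t) atTop atTop :=
      tendsto_id.const_mul_atTop (by norm_num)
    simpa using (tendsto_exp_neg_atTop_nhds_zero.comp h1).const_mul K
  obtain ⟨T, hT⟩ := ((ht.eventually_le_const (half_pos hpos)).and
    ((eventually_ge_atTop t₀).and (eventually_ge_atTop 0))).exists_forall_of_atTop
  have hmem : ∀ x ≥ exp T, (e' * x, (0 : ℝ)) ∈ extHalf ∧ |p (e' * x, 0) - p₀| ≤ |p₀| / 2 := by
    intro x hx
    have hx0 : 0 < x := (exp_pos T).trans_le hx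
    obtain ⟨h1, h2, h3⟩ := hT (log x) ((le_log_iff_exp_le hx0).2 hx)
    obtain ⟨φ, hφ, hz⟩ : ∃ φ ∈ Icc 0 π, (e' * x, (0 : ℝ)) = logPolar (log x) φ := by
      rcases he' with rfl | rfl
      · exact ⟨0, ⟨le_rfl, pi_pos.le⟩, by simp [logPolar, exp_log hx0]⟩
      · exact ⟨π, ⟨pi_pos.le, le_rfl⟩, by simp [logPolar, exp_log hx0]⟩
    rw [hz]
    exact ⟨logPolar_mem_extHalf h3 hφ, (hlim _ h2 φ hφ).trans h1⟩
  have hder : ∀ x ≥ exp T, |p₀| / 2 ≤ e * (p (e' * x, 0) * (e' * 1) + q (e' * x, 0) * 0) := by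
    intro x hx
    have h1 : |e * e' * (p (e' * x, 0) - p₀)| ≤ |p₀| / 2 := by
      rw [abs_mul, abs_mul, he]
      rcases he' with rfl | rfl <;> simpa using (hmem x hx).2
    linarith [(abs_le.1 h1).1]
  obtain ⟨x, hx, hMx⟩ := exists_gt_of_hasDerivAt_ge (f := fun x => e * V (e' * x, 0)) (half_pos hpos)
    (fun x hx => ((h.jV.grad _ (h.sub (hmem x hx).1)).comp_curve (α := fun s => e' * s)
      (β := fun _ => 0) ((hasDerivAt_id x).const_mul e') (hasDerivAt_const x 0)).const_mul e)
    hder M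
  exact ⟨_, (hmem x hx).1, hMx⟩

/-- The gradient of a one-sided bounded solution decays like the inverse distance. -/
theorem abs_grad_le_invRad (h : PlaneSol η U V p q a b c s₁ s₂ s₃ s₄) (hη0 : 0 < η)
    (hη : η ≤ 1 / 1000000) {e M : ℝ} (he : |e| = 1) (hbd : ∀ z ∈ extHalf, e * V z ≤ M) :
    ∀ z ∈ extHalf, |p z| ≤ 4000 * η * invRad z ∧ |q z| ≤ 4000 * η * invRad z := by
  have hη' : η ≤ 1 / 100 := hη.trans (by norm_num)
  have hzero : ∀ {p₀ K t₀ : ℝ}, (∀ t ≥ t₀, ∀ θ ∈ Icc 0 π,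
      |p (logPolar t θ) - p₀| ≤ K * exp (-(1 / 2 * t))) → p₀ = 0 := by
    intro p₀ K t₀ hlim
    by_contra hp₀
    obtain ⟨z, hz, hMz⟩ := h.unbounded_of_grad_limit hp₀ hlim he M
    exact hMz.not_ge (hbd z hz)
  obtain ⟨p₀, hp₀⟩ := h.exists_grad_limit hη0 hη' (κ := 15 * η) (σ := 1 / 2) (t₀ := 2)
    (by positivity) le_rfl (by norm_num) (by norm_num) rfl
    (h.stripSol.energyFlux_decay_half hη0 hη')
  obtain rfl := hzero fun t ht θ hθ => (hp₀ t ht θ hθ).1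
  simp only [bdN_zero, sub_zero] at hp₀
  obtain ⟨p₁, hp₁⟩ := h.exists_grad_limit hη0 hη' (κ := 170 * η) (σ := 1) (t₀ := 3)
    (by positivity) (by norm_num) le_rfl (by norm_num) rfl
    (h.stripSol.energyFlux_decay_one hη0 hη
      (fun t ht θ hθ => (hp₀ t (by linarith) θ hθ).1.trans
        (by have : 0 < η * exp (-(1 / 2 * t)) := by positivity
            linarith))
      (fun t ht θ hθ => (hp₀ t (by linarith) θ hθ).2.trans (by linarith)))
  obtain rfl := hzero (K := 12 * (170 * η)) (t₀ := 4) fun t ht θ hθ =>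
    (hp₁ t (by linarith) θ hθ).1.trans (by gcongr; linarith)
  simp only [bdN_zero, sub_zero] at hp₁
  intro z hz
  obtain ⟨t, ht, θ, hθ, rfl⟩ := exists_logPolar hz
  have hinv : invRad (logPolar t θ) = exp (-t) := by
    rw [invRad, logPolar_normSq, sqrt_sq (exp_pos t).le, exp_neg]
  rw [hinv]
  have hpos : 0 < η * exp (-t) := by positivity
  rcases le_total 4 t with h4 | h4
  · have := hp₁ t (by linarith) θ hθ
    rw [one_mul] at this
    exact ⟨this.1.trans (by linarith), this.2.trans (by linarith)⟩
  · have h1 : 1 ≤ 4000 * exp (-t) := by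
      have h2 : exp t ≤ 4000 := (exp_le_exp.2 h4).trans (by
        have h3 : exp 4 = exp 1 ^ 4 := by rw [← exp_nat_mul]; norm_num
        rw [h3]
        calc exp 1 ^ 4 ≤ 3 ^ 4 := by
              gcongr
              linarith [exp_one_lt_d9]
          _ ≤ 4000 := by norm_num)
      rw [exp_neg, ← div_eq_mul_inv, le_div_iff₀ (exp_pos t)]
      linarith
    have hle : η ≤ 4000 * η * exp (-t) := by nlinarith
    exact ⟨(h.bp _ hz).trans hle, (h.bq _ hz).trans hle⟩

end PlaneSol

namespace PlaneSol

variable {η : ℝ} {U : Set (ℝ × ℝ)} {V p q a b c s₁ s₂ s₃ s₄ : ℝ × ℝ → ℝ}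

/-- The coefficients of the linear oblique problem satisfied by a solution with decaying
gradient. -/
theorem frozen_coeff (h : PlaneSol η U V p q a b c s₁ s₂ s₃ s₄) {ε : ℝ} (hε : ε ≤ 1 / 200)
    (hdec : ∀ z ∈ extHalf, |p z| ≤ ε * invRad z ∧ |q z| ≤ ε * invRad z) {z : ℝ × ℝ}
    (hz : z ∈ extHalf) :
    |p z / (1 + q z)| ≤ 2 * ε * invRad z ∧
      |(1 + p z ^ 2) / (1 + q z) ^ 2 - 1| ≤ 3 * ε * invRad z ∧
      |-(p z / (√(1 + p z ^ 2) + 1))| ≤ ε * invRad z ∧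
      (z.2 = 0 → q z + -(p z / (√(1 + p z ^ 2) + 1)) * p z = 0) := by
  obtain ⟨hp, hq⟩ := hdec z hz
  have hu0 := invRad_pos (extHalf_subset_punctured hz)
  have hg0 : 0 ≤ ε * invRad z := (abs_nonneg _).trans hp
  have hε0 : 0 ≤ ε := nonneg_of_mul_nonneg_left hg0 hu0
  have hg : ε * invRad z ≤ 1 / 100 := by nlinarith [invRad_le_one hz]
  obtain ⟨h1, h2⟩ := abs_coeff_le hg hp hq
  have hs := one_le_sqrt_one_add_sq (p z)
  refine ⟨?_, by linarith, ?_, fun hz2 => ?_⟩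
  · rw [abs_mul, abs_two] at h1
    linarith
  · rw [abs_neg, abs_div, abs_of_pos (by linarith : 0 < √(1 + p z ^ 2) + 1)]
    exact (div_le_self (abs_nonneg _) (by linarith)).trans hp
  · rw [h.bdry z hz hz2, bdN]
    have hsq : √(1 + p z ^ 2) ^ 2 = 1 + p z ^ 2 := sq_sqrt (by positivity)
    field_simp
    linarith

theorem annulus_upper (h : PlaneSol η U V p q a b c s₁ s₂ s₃ s₄) {ε : ℝ} (hε : ε ≤ 1 / 200)
    (hdec : ∀ z ∈ extHalf, |p z| ≤ ε * invRad z ∧ |q z| ≤ ε * invRad z) (e : ℝ)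
    {k m B ρ : ℝ} (hkm : |k| ≤ 10 * m)
    (h₁ : ∀ z ∈ extHalf, z.1 ^ 2 + z.2 ^ 2 = 1 → e * V z ≤ B)
    (h₂ : ∀ z ∈ extHalf, z.1 ^ 2 + z.2 ^ 2 = ρ → e * V z ≤ k * log √ρ + B) :
    ∀ z ∈ sqAnn 1 ρ, e * V z ≤ k * log √(z.1 ^ 2 + z.2 ^ 2) + B + 2 * m :=
  annulus_log_upper h.isOpen (h.jV.const_mul e) h.sub hε
    (fun _ hz => (h.frozen_coeff hε hdec hz).1) (fun _ hz => (h.frozen_coeff hε hdec hz).2.1)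
    (fun _ hz => (h.frozen_coeff hε hdec hz).2.2.1)
    (fun z hz hz2 => by linear_combination e * h.pde z hz hz2)
    (fun z hz hz2 => by linear_combination e * (h.frozen_coeff hε hdec hz).2.2.2 hz2) hkm h₁ h₂

theorem exterior_upper (h : PlaneSol η U V p q a b c s₁ s₂ s₃ s₄) {ε : ℝ} (hε : ε ≤ 1 / 200)
    (hdec : ∀ z ∈ extHalf, |p z| ≤ ε * invRad z ∧ |q z| ≤ ε * invRad z) (e : ℝ) {k B C : ℝ}
    (h₁ : ∀ z ∈ extHalf, z.1 ^ 2 + z.2 ^ 2 = 1 → e * V z ≤ B)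
    (h₂ : ∀ z ∈ extHalf, e * V z ≤ k * log √(z.1 ^ 2 + z.2 ^ 2) + C) :
    ∀ z ∈ extHalf, e * V z ≤ k * log √(z.1 ^ 2 + z.2 ^ 2) + B + |k| / 5 :=
  exterior_log_upper h.isOpen (h.jV.const_mul e) h.sub hε
    (fun _ hz => (h.frozen_coeff hε hdec hz).1) (fun _ hz => (h.frozen_coeff hε hdec hz).2.1)
    (fun _ hz => (h.frozen_coeff hε hdec hz).2.2.1)
    (fun z hz hz2 => by linear_combination e * h.pde z hz hz2)
    (fun z hz hz2 => by linear_combination e * (h.frozen_coeff hε hdec hz).2.2.2 hz2) h₁ h₂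

theorem abs_logPolar_deriv_le {x y u ε p q : ℝ} (hu : 0 ≤ u) (hε : 0 ≤ ε)
    (hr : (x * u) ^ 2 + (y * u) ^ 2 = 1) (hp : |p| ≤ ε * u) (hq : |q| ≤ ε * u) :
    |p * x + q * y| ≤ 2 * ε := by
  have hx : |x| * u ≤ 1 := by
    rw [← abs_of_nonneg hu, ← abs_mul, ← sq_le_one_iff_abs_le_one]
    nlinarith [sq_nonneg (y * u)]
  have hy : |y| * u ≤ 1 := by
    rw [← abs_of_nonneg hu, ← abs_mul, ← sq_le_one_iff_abs_le_one]
    nlinarith [sq_nonneg (x * u)]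
  calc |p * x + q * y| ≤ |p * x| + |q * y| := abs_add_le _ _
    _ = |p| * |x| + |q| * |y| := by rw [abs_mul, abs_mul]
    _ ≤ ε * u * |x| + ε * u * |y| := by gcongr
    _ ≤ 2 * ε := by nlinarith

/-- A solution whose gradient decays like the inverse distance grows like a multiple of the
logarithm. -/
theorem exists_log_approx (h : PlaneSol η U V p q a b c s₁ s₂ s₃ s₄) {ε : ℝ} (hε : ε ≤ 1 / 200)
    (hdec : ∀ z ∈ extHalf, |p z| ≤ ε * invRad z ∧ |q z| ≤ ε * invRad z) :
    ∃ k C : ℝ, ∀ e : ℝ, |e| = 1 → ∀ z ∈ extHalf,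
      e * V z ≤ e * k * log √(z.1 ^ 2 + z.2 ^ 2) + C := by
  have hlog : ∀ t, log √(exp t ^ 2) = t := fun t => by rw [sqrt_sq (exp_pos t).le, log_exp]
  have hε0 : 0 ≤ ε := by
    have h0 : ((0 : ℝ), (1 : ℝ)) ∈ extHalf := ⟨zero_le_one, by norm_num⟩
    exact nonneg_of_mul_nonneg_left ((abs_nonneg _).trans (hdec _ h0).1)
      (invRad_pos (extHalf_subset_punctured h0))
  have hgrad : ∀ t ≥ (0 : ℝ), ∀ θ ∈ Icc 0 π,
      |p (logPolar t θ) * (logPolar t θ).1 + q (logPolar t θ) * (logPolar t θ).2| ≤ 2 * ε ∧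
      |p (logPolar t θ) * -(logPolar t θ).2 + q (logPolar t θ) * (logPolar t θ).1| ≤ 2 * ε := by
    intro t ht θ hθ
    have hz := logPolar_mem_extHalf ht hθ
    obtain ⟨hp, hq⟩ := hdec _ hz
    have hr := sq_add_sq_mul_invRad (extHalf_subset_punctured hz)
    have hu := (invRad_pos (extHalf_subset_punctured hz)).le
    exact ⟨abs_logPolar_deriv_le hu hε0 hr hp hq,
      abs_logPolar_deriv_le hu hε0 (by linarith) hp hq⟩
  have hangle : ∀ t ≥ (0 : ℝ), ∀ θ ∈ Icc 0 π,
      |V (logPolar t θ) - V (logPolar t (π / 2))| ≤ 1 := by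
    intro t ht θ hθ
    have hmid : π / 2 ∈ Icc 0 π := ⟨by positivity, by linarith [pi_pos]⟩
    have := (convex_Icc 0 π).norm_image_sub_le_of_norm_hasDerivWithin_le
      (f := fun s => V (logPolar t s)) (C := 2 * ε)
      (fun φ hφ => (hasDerivAt_logPolar_angle
        (h.jV.grad _ (h.sub (logPolar_mem_extHalf ht hφ)))).hasDerivWithinAt)
      (fun φ hφ => (hgrad t ht φ hφ).2) hmid hθ
    rw [norm_eq_abs, norm_eq_abs] at this
    have h2 : |θ - π / 2| ≤ 4 := by
      rw [abs_le]
      constructor <;> linarith [hθ.1, hθ.2, pi_le_four, pi_pos]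
    nlinarith [abs_nonneg (θ - π / 2)]
  have htime : ∀ t ≥ (0 : ℝ), |V (logPolar t (π / 2)) - V (logPolar 0 (π / 2))| ≤ t := by
    intro t ht
    have hmid : π / 2 ∈ Icc 0 π := ⟨by positivity, by linarith [pi_pos]⟩
    have := (convex_Ici 0).norm_image_sub_le_of_norm_hasDerivWithin_le
      (f := fun s => V (logPolar s (π / 2))) (C := 2 * ε)
      (fun s hs => (hasDerivAt_logPolar_time
        (h.jV.grad _ (h.sub (logPolar_mem_extHalf hs hmid)))).hasDerivWithinAt)
      (fun s hs => (hgrad s hs _ hmid).1) (self_mem_Ici (a := (0 : ℝ))) (mem_Ici.2 ht)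
    rw [norm_eq_abs, norm_eq_abs, sub_zero, abs_of_nonneg ht] at this
    nlinarith
  set V₀ := V (logPolar 0 (π / 2)) with hV₀
  set K : ℕ → ℝ := fun n => V (logPolar (n + 1) (π / 2)) / (n + 1) with hK
  have hKb : ∀ n, |K n| ≤ |V₀| + 1 := by
    intro n
    have hn : (0 : ℝ) < n + 1 := by positivity
    rw [hK, abs_div, abs_of_pos hn, div_le_iff₀ hn]
    have h1 := htime (n + 1) hn.le
    have h2 := abs_sub_abs_le_abs_sub (V (logPolar (n + 1) (π / 2))) V₀
    nlinarith [abs_nonneg V₀, mul_nonneg (abs_nonneg V₀) (Nat.cast_nonneg (α := ℝ) n)]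
  obtain ⟨k, -, φ, hφ, hlim⟩ := tendsto_subseq_of_bounded
    (Metric.isBounded_closedBall (x := (0 : ℝ)) (r := |V₀| + 1))
    (fun n => mem_closedBall_zero_iff.2 (hKb n))
  refine ⟨k, (|V₀| + 1) + 2 * (|V₀| + 1), fun e he z hz => ?_⟩
  have hn : ∀ n : ℕ, log √(z.1 ^ 2 + z.2 ^ 2) ≤ n →
      e * V z ≤ e * K n * log √(z.1 ^ 2 + z.2 ^ 2) + ((|V₀| + 1) + 2 * (|V₀| + 1)) := by
    intro n hzn
    have hpos : 0 < z.1 ^ 2 + z.2 ^ 2 := one_pos.trans_le hz.2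
    have key := h.annulus_upper hε hdec e (k := e * K n) (m := |V₀| + 1) (B := |V₀| + 1)
      (ρ := exp (n + 1) ^ 2) ?_ ?_ ?_ z ⟨hz.1, hz.2, ?_⟩
    · linarith
    · rw [abs_mul, he, one_mul]
      linarith [hKb n, abs_nonneg V₀]
    · intro w hw hw1
      obtain ⟨t, ht, θ, hθ, rfl⟩ := exists_logPolar hw
      rw [logPolar_normSq, pow_eq_one_iff_of_nonneg (exp_pos t).le two_ne_zero, exp_eq_one_iff]
        at hw1
      subst hw1
      refine (le_abs_self _).trans ?_
      rw [abs_mul, he, one_mul]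
      linarith [hangle 0 le_rfl θ hθ,
        abs_sub_abs_le_abs_sub (V (logPolar 0 θ)) (V (logPolar 0 (π / 2)))]
    · intro w hw hw1
      obtain ⟨t, ht, θ, hθ, rfl⟩ := exists_logPolar hw
      rw [logPolar_normSq, pow_left_inj₀ (exp_pos _).le (exp_pos _).le two_ne_zero, exp_eq_exp]
        at hw1
      subst hw1
      have hKn : K n * (n + 1) = V (logPolar (n + 1) (π / 2)) := by
        rw [hK]; field_simp
      rw [hlog, mul_assoc, hKn]
      have h1 := le_abs_self (e * (V (logPolar (n + 1) θ) - V (logPolar (n + 1) (π / 2))))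
      rw [abs_mul, he, one_mul] at h1
      linarith [hangle (n + 1) ht θ hθ, abs_nonneg V₀]
    · rw [log_le_iff_le_exp (sqrt_pos.2 hpos), sqrt_le_left (exp_pos _).le] at hzn
      refine hzn.trans ?_
      gcongr
      linarith
  refine ge_of_tendsto (((hlim.const_mul e).mul_const _).add_const _) ?_
  filter_upwards [hφ.tendsto_atTop.eventually
    (tendsto_natCast_atTop_atTop.eventually_ge_atTop (log √(z.1 ^ 2 + z.2 ^ 2)))] with n hzn
  exact hn (φ n) hzn

/-- Logarithmic expansion of one-sided bounded planar solutions. -/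
theorem exists_log_expansion (h : PlaneSol η U V p q a b c s₁ s₂ s₃ s₄) (hη0 : 0 < η)
    (hη : η ≤ 1 / 1000000) {e M₀ M : ℝ} (he : |e| = 1) (hbd : ∀ z ∈ extHalf, e * V z ≤ M₀)
    (hM : ∀ z ∈ extHalf, z.1 ^ 2 + z.2 ^ 2 ≤ 4 → |V z| ≤ M) :
    ∃ k : ℝ, (∀ z ∈ extHalf, |V z - k * log √(z.1 ^ 2 + z.2 ^ 2)| ≤ 10 * M) ∧ |k| ≤ 10 * M := by
  have hε : 4000 * η ≤ 1 / 200 := by linarith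
  have hdec := h.abs_grad_le_invRad hη0 hη he hbd
  obtain ⟨k, C, hk⟩ := h.exists_log_approx hε hdec
  have hup : ∀ e : ℝ, |e| = 1 → ∀ z ∈ extHalf,
      e * V z ≤ e * k * log √(z.1 ^ 2 + z.2 ^ 2) + M + |k| / 5 := by
    intro e he z hz
    have := h.exterior_upper hε hdec e (k := e * k) (B := M) (C := C)
      (fun w hw hw1 => by
        refine (le_abs_self _).trans ?_
        rw [abs_mul, he, one_mul]
        exact hM w hw (by linarith)) (hk e he) z hz
    rwa [abs_mul, he, one_mul] at this
  have hz2 : ((0 : ℝ), (2 : ℝ)) ∈ extHalf := ⟨zero_le_two, by norm_num⟩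
  have hV2 := abs_le.1 (hM _ hz2 (by norm_num))
  have hM0 : 0 ≤ M := (abs_nonneg _).trans (hM _ hz2 (by norm_num))
  have e1 := hup 1 (by simp) _ hz2
  have e2 := hup (-1) (by simp) _ hz2
  have hlog2 : log √((0 : ℝ) ^ 2 + 2 ^ 2) = log 2 := by
    rw [zero_pow two_ne_zero, zero_add, sqrt_sq zero_le_two]
  simp only [hlog2] at e1 e2
  have hl := log_two_gt_d9
  have hkM : |k| ≤ 5 * M := by
    rcases abs_cases k with ⟨h1, h2⟩ | ⟨h1, h2⟩ <;> rw [h1] at e1 e2 ⊢ <;> nlinarith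
  refine ⟨k, fun z hz => ?_, by linarith⟩
  have u1 := hup 1 (by simp) z hz
  have u2 := hup (-1) (by simp) z hz
  rw [abs_le]
  constructor <;> linarith

end PlaneSol

/-- The `i`-th partial derivative as an operator on functions on the Euclidean plane. -/
def partialD (i : Fin 2) (F : EuclideanSpace ℝ (Fin 2) → ℝ) (y : EuclideanSpace ℝ (Fin 2)) : ℝ :=
  fderiv ℝ F y (EuclideanSpace.single i 1)

/-- The linear identification of `ℝ × ℝ` with the Euclidean plane. -/
def toPlane : ℝ × ℝ →L[ℝ] EuclideanSpace ℝ (Fin 2) :=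
  (ContinuousLinearMap.fst ℝ ℝ ℝ).smulRight (EuclideanSpace.single 0 1) +
    (ContinuousLinearMap.snd ℝ ℝ ℝ).smulRight (EuclideanSpace.single 1 1)

theorem toPlane_zero (z : ℝ × ℝ) : toPlane z 0 = z.1 := by simp [toPlane]

theorem toPlane_one (z : ℝ × ℝ) : toPlane z 1 = z.2 := by simp [toPlane]

theorem norm_toPlane (z : ℝ × ℝ) : ‖toPlane z‖ = √(z.1 ^ 2 + z.2 ^ 2) := by
  simp [EuclideanSpace.norm_eq, Fin.sum_univ_two, toPlane_zero, toPlane_one]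

theorem toPlane_coords (y : EuclideanSpace ℝ (Fin 2)) : toPlane (y 0, y 1) = y := by
  ext i
  fin_cases i
  · exact toPlane_zero _
  · exact toPlane_one _

section
variable {W : Set (EuclideanSpace ℝ (Fin 2))} {F G : EuclideanSpace ℝ (Fin 2) → ℝ}

theorem contDiffOn_partialD (hW : IsOpen W) (hF : ContDiffOn ℝ (⊤ : ℕ∞) F W) (i : Fin 2) :
    ContDiffOn ℝ (⊤ : ℕ∞) (partialD i F) W :=
  (hF.fderiv_of_isOpen hW (by simp)).clm_apply contDiffOn_const

theorem partialD_congr (hW : IsOpen W) (h : EqOn F G W) (i : Fin 2) :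
    EqOn (partialD i F) (partialD i G) W := fun y hy => by
  rw [partialD, partialD, (h.eventuallyEq_of_mem (hW.mem_nhds hy)).fderiv_eq]

theorem partialD_comm (hW : IsOpen W) (hF : ContDiffOn ℝ (⊤ : ℕ∞) F W) (i j : Fin 2) :
    EqOn (partialD i (partialD j F)) (partialD j (partialD i F)) W := by
  intro y hy
  have hFy : ContDiffAt ℝ (⊤ : ℕ∞) F y := hF.contDiffAt (hW.mem_nhds hy)
  have hd : DifferentiableAt ℝ (fderiv ℝ F) y :=
    ((hF.fderiv_of_isOpen hW (m := (⊤ : ℕ∞)) (by simp)).contDiffAt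
      (hW.mem_nhds hy)).differentiableAt (by simp)
  have hsymm := hFy.isSymmSndFDerivAt (by simpa using WithTop.coe_le_coe.2 (le_top (a := (2 : ℕ∞))))
  have hk : ∀ i j : Fin 2, partialD i (partialD j F) y =
      fderiv ℝ (fderiv ℝ F) y (EuclideanSpace.single i 1) (EuclideanSpace.single j 1) := by
    intro i j
    have : partialD j F = fun z => fderiv ℝ F z (EuclideanSpace.single j 1) := rfl
    rw [partialD, this, fderiv_clm_apply hd (differentiableAt_const _)]
    simp
  rw [hk, hk]
  exact hsymm _ _

theorem hasGradAt_comp_toPlane (hW : IsOpen W) (hF : ContDiffOn ℝ (⊤ : ℕ∞) F W) {z : ℝ × ℝ}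
    (hz : toPlane z ∈ W) :
    HasGradAt (fun z => F (toPlane z)) (partialD 0 F (toPlane z)) (partialD 1 F (toPlane z)) z := by
  have hd := ((hF.contDiffAt (hW.mem_nhds hz)).differentiableAt (by simp)).hasFDerivAt
  refine (hd.comp z toPlane.hasFDerivAt).hasGradAt ?_ ?_ <;> simp [toPlane, partialD]

theorem jet2On_comp_toPlane (hW : IsOpen W) (hF : ContDiffOn ℝ (⊤ : ℕ∞) F W) :
    Jet2On (toPlane ⁻¹' W) (fun z => F (toPlane z)) (fun z => partialD 0 F (toPlane z))
      (fun z => partialD 1 F (toPlane z)) (fun z => partialD 0 (partialD 0 F) (toPlane z))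
      (fun z => partialD 1 (partialD 0 F) (toPlane z))
      (fun z => partialD 1 (partialD 1 F) (toPlane z)) :=
  ⟨fun _ hz => hasGradAt_comp_toPlane hW hF hz,
    fun _ hz => hasGradAt_comp_toPlane hW (contDiffOn_partialD hW hF 0) hz,
    fun _ hz => (hasGradAt_comp_toPlane hW (contDiffOn_partialD hW hF 1) hz).congr_val
      (partialD_comm hW hF 0 1 hz) rfl⟩

end

theorem mem_extDom_toPlane {z : ℝ × ℝ} :
    toPlane z ∈ extDom 2 (by norm_num) ↔ z ∈ extHalf := by
  have : lastIdx 2 (by norm_num) = 1 := rfl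
  simp [extDom, extHalf, this, toPlane_one, norm_toPlane, one_le_sqrt]

theorem IsHodSol.exists_planeSol {v : EuclideanSpace ℝ (Fin 2) → ℝ} {η : ℝ}
    (hv : IsHodSol 2 (by norm_num) v (extDom 2 (by norm_num)))
    (hη : ∀ y ∈ extDom 2 (by norm_num), ‖fderiv ℝ v y‖ ≤ η) :
    ∃ U p q a b c s₁ s₂ s₃ s₄,
      PlaneSol η U (fun z => v (toPlane z)) p q a b c s₁ s₂ s₃ s₄ := by
  obtain ⟨⟨W, hW, hsub, hs⟩, hpde, hbd⟩ := hv
  have h0 := contDiffOn_partialD hW hs 0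
  have h1 := contDiffOn_partialD hW hs 1
  have h00 := contDiffOn_partialD hW h0 0
  have h10 := contDiffOn_partialD hW h0 1
  have cont : ∀ {F : EuclideanSpace ℝ (Fin 2) → ℝ}, ContDiffOn ℝ (⊤ : ℕ∞) F W →
      ContinuousOn (fun z => F (toPlane z)) (toPlane ⁻¹' W) := fun hF =>
    hF.continuousOn.comp toPlane.continuous.continuousOn fun _ hz => hz
  have hlast : lastIdx 2 (by norm_num) = 1 := rfl
  have hbound : ∀ i : Fin 2, ∀ z ∈ extHalf, |partialD i v (toPlane z)| ≤ η := by
    intro i z hz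
    refine ((fderiv ℝ v (toPlane z)).le_opNorm _).trans ?_
    simpa using hη _ (mem_extDom_toPlane.2 hz)
  have hcomm := partialD_comm hW hs 0 1
  have hcomm1 := partialD_congr hW hcomm 1
  refine ⟨toPlane ⁻¹' W, _, _, _, _, _, _, _, _, _, hW.preimage toPlane.continuous,
    fun z hz => hsub (mem_extDom_toPlane.2 hz), jet2On_comp_toPlane hW hs,
    jet2On_comp_toPlane hW h0,
    ⟨fun z hz => ((jet2On_comp_toPlane hW h1).grad z hz).congr_val (hcomm hz) rfl,
      fun z hz => ?_,
      fun z hz => ((jet2On_comp_toPlane hW h1).grady z hz).congr_val (hcomm1 hz) rfl⟩,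
    cont (contDiffOn_partialD hW h00 0), cont (contDiffOn_partialD hW h00 1),
    cont (contDiffOn_partialD hW h10 1), ?_, ?_, hbound 0, hbound 1⟩
  · exact (jet2On_comp_toPlane hW h0).grady z hz
  · intro z hz hz2
    have hy := mem_extDom_toPlane.2 hz
    have := hpde _ hy (by rwa [hlast, toPlane_one])
    have hc := hcomm (hsub hy)
    have hgrad : ∀ i, gradC 2 v (toPlane z) i = partialD i v (toPlane z) := fun _ => rfl
    have hhess : ∀ i j, hessC 2 v (toPlane z) i j = partialD j (partialD i v) (toPlane z) :=
      fun _ _ => rfl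
    simp only [hodOp, hodA, tangSq, hgrad, hhess, Fin.sum_univ_two, hlast, hc, zero_ne_one,
      if_true, if_false, add_zero, one_mul] at this
    linear_combination this
  · intro z hz hz2
    have hy := mem_extDom_toPlane.2 hz
    have := hbd _ hy (by rwa [hlast, toPlane_one])
    simpa [gradC, hodN, tangSq, Fin.sum_univ_two, hlast, bdN, partialD] using this

/-- Precise asymptotics at infinity, `d = 2`: expansion `v(y) = k log|y| + O(1)`. -/
theorem stmt12 :
    ∃ η₀ : ℝ, 0 < η₀ ∧ η₀ < 1 / 2 ∧ ∃ C : ℝ, 1 ≤ C ∧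
      ∀ v : EuclideanSpace ℝ (Fin 2) → ℝ,
        IsHodSol 2 (by norm_num) v (extDom 2 (by norm_num)) →
        ((∃ M : ℝ, ∀ y ∈ extDom 2 (by norm_num), v y ≤ M) ∨
         (∃ m : ℝ, ∀ y ∈ extDom 2 (by norm_num), m ≤ v y)) →
        (∀ y ∈ extDom 2 (by norm_num), ‖fderiv ℝ v y‖ ≤ η₀) →
        ∀ M : ℝ, M = sSup ((fun y => |v y|) '' halfAnn 2 (by norm_num) 2) →
        ∃ k : ℝ,
          (∀ y ∈ extDom 2 (by norm_num), |v y - k * Real.log ‖y‖| ≤ C * M) ∧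
          |k| ≤ C * M := by
  refine ⟨1 / 1000000, by norm_num, by norm_num, 10, by norm_num, fun v hv hone hη M hM => ?_⟩
  obtain ⟨U, p, q, a, b, c, s₁, s₂, s₃, s₄, h⟩ := hv.exists_planeSol hη
  obtain ⟨e, M₀, he, hbd⟩ : ∃ e M₀ : ℝ, |e| = 1 ∧ ∀ z ∈ extHalf, e * v (toPlane z) ≤ M₀ := by
    rcases hone with ⟨M₀, h⟩ | ⟨m, h⟩
    · exact ⟨1, M₀, by simp, fun z hz => by simpa using h _ (mem_extDom_toPlane.2 hz)⟩
    · exact ⟨-1, -m, by simp, fun z hz => by simpa using h _ (mem_extDom_toPlane.2 hz)⟩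
  have hcpt : IsCompact (halfAnn 2 (by norm_num) 2) := by
    have : halfAnn 2 (by norm_num) 2 = toPlane '' sqAnn 1 4 := by
      ext y
      constructor
      · rintro ⟨h1, h2, h3⟩
        refine ⟨(y 0, y 1), ?_, toPlane_coords y⟩
        rw [← toPlane_coords y, norm_toPlane] at h2 h3
        rw [one_le_sqrt] at h2
        rw [sqrt_le_left zero_le_two] at h3
        exact ⟨h1, h2, by linarith⟩
      · rintro ⟨z, ⟨h1, h2, h3⟩, rfl⟩
        refine ⟨(mem_extDom_toPlane.2 ⟨h1, h2⟩).1, (mem_extDom_toPlane.2 ⟨h1, h2⟩).2, ?_⟩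
        rw [norm_toPlane, sqrt_le_left zero_le_two]
        linarith
    rw [this]
    exact (isCompact_sqAnn 1 4).image toPlane.continuous
  have hbdd : BddAbove ((fun y => |v y|) '' halfAnn 2 (by norm_num) 2) := by
    obtain ⟨⟨W, hW, hsub, hs⟩, -, -⟩ := hv
    exact hcpt.bddAbove_image
      ((hs.continuousOn.mono fun y hy => hsub ⟨hy.1, hy.2.1⟩).abs)
  obtain ⟨k, hk, hkM⟩ := h.exists_log_expansion (M := M) (by norm_num) le_rfl he hbd
    fun z hz hz4 => by
      rw [hM]
      have hz' := mem_extDom_toPlane.2 hz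
      refine le_csSup hbdd ⟨toPlane z, ⟨hz'.1, hz'.2, ?_⟩, rfl⟩
      rw [norm_toPlane, sqrt_le_left zero_le_two]
      linarith
  refine ⟨k, fun y hy => ?_, hkM⟩
  have := hk (y 0, y 1) (mem_extDom_toPlane.1 (by rwa [toPlane_coords]))
  rwa [← norm_toPlane, toPlane_coords] at this
end
end
end
end

section
/- Let σ, s ∈ ℝ with σ·s ≥ 0, and define φ : ℝ² → [0,∞) by φ(x) = (x₂ + σ·log|x| + s)₊. Then φ is a viscosity supersolution of the homogeneous Bernoulli problem in the open set {x ∈ ℝ² : |x| > 3}. -/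
open Real Set Filter Metric MeasureTheory

noncomputable section

/-- The Laplacian of `φ` at `x` (trace of the Hessian). -/
def lapl (d : ℕ) (φ : EuclideanSpace ℝ (Fin d) → ℝ) (x : EuclideanSpace ℝ (Fin d)) : ℝ :=
  ∑ i : Fin d, hessC d φ x i i

/-- `u` is a continuous nonnegative viscosity supersolution of the Bernoulli free boundary
problem `Δu = 0` in `{u>0} ∩ U`, `|∇u| = Q` on `∂{u>0} ∩ U`. -/
def IsViscSupersol (d : ℕ) (U : Set (EuclideanSpace ℝ (Fin d)))
    (Q u : EuclideanSpace ℝ (Fin d) → ℝ) : Prop :=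
  ContinuousOn u U ∧ (∀ x ∈ U, 0 ≤ u x) ∧
  ∀ φ : EuclideanSpace ℝ (Fin d) → ℝ, ContDiffOn ℝ (⊤ : ℕ∞) φ U →
    ∀ x ∈ U, IsLocalMinOn (fun z => u z - φ z) U x → u x = φ x →
      lapl d φ x ≤ 0 ∨ (φ x = 0 ∧ ‖fderiv ℝ φ x‖ ≤ Q x)

/-- `u` is a continuous nonnegative viscosity subsolution of the Bernoulli free boundary
problem `Δu = 0` in `{u>0} ∩ U`, `|∇u| = Q` on `∂{u>0} ∩ U`. -/
def IsViscSubsol (d : ℕ) (U : Set (EuclideanSpace ℝ (Fin d)))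
    (Q u : EuclideanSpace ℝ (Fin d) → ℝ) : Prop :=
  ContinuousOn u U ∧ (∀ x ∈ U, 0 ≤ u x) ∧
  ∀ φ : EuclideanSpace ℝ (Fin d) → ℝ, ContDiffOn ℝ (⊤ : ℕ∞) φ U →
    ∀ x ∈ closure {z ∈ U | 0 < u z} ∩ U,
      IsLocalMaxOn (fun z => u z - max (φ z) 0) U x → u x = max (φ x) 0 →
      0 ≤ lapl d φ x ∨ (φ x = 0 ∧ Q x ≤ ‖fderiv ℝ φ x‖)

/-- `u` is a viscosity solution: both a subsolution and a supersolution. -/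
def IsViscSol (d : ℕ) (U : Set (EuclideanSpace ℝ (Fin d)))
    (Q u : EuclideanSpace ℝ (Fin d) → ℝ) : Prop :=
  IsViscSubsol d U Q u ∧ IsViscSupersol d U Q u

open scoped Topology

/-- Second-order necessary condition for a local minimum on the line. -/
theorem deriv_deriv_nonneg_of_isLocalMin {f : ℝ → ℝ} {a : ℝ} (hf : IsLocalMin f a)
    (hc : ContinuousAt f a) : 0 ≤ deriv (deriv f) a := by
  by_contra! hneg
  have hmax : IsLocalMax f a := isLocalMax_of_deriv_deriv_neg hneg hf.deriv_eq_zero hc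
  have hconst : f =ᶠ[𝓝 a] fun _ => f a := by
    filter_upwards [hf, hmax] with t h₁ h₂ using le_antisymm h₂ h₁
  have hzero : deriv (deriv f) a = 0 := by
    rw [hconst.deriv.deriv_eq]
    simp
  exact hneg.ne hzero

theorem hasDerivAt_comp_add_smul {E : Type*} [NormedAddCommGroup E] [NormedSpace ℝ E]
    {h : E → ℝ} {x v : E} {t : ℝ} (hd : DifferentiableAt ℝ h (x + t • v)) :
    HasDerivAt (fun t : ℝ => h (x + t • v)) (fderiv ℝ h (x + t • v) v) t := by
  have hline : HasDerivAt (fun t : ℝ => x + t • v) v t := by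
    simpa using ((hasDerivAt_id t).smul_const v).const_add x
  exact hd.hasFDerivAt.comp_hasDerivAt t hline

theorem tendsto_add_smul_nhds {E : Type*} [NormedAddCommGroup E] [NormedSpace ℝ E] (x v : E) :
    Tendsto (fun t : ℝ => x + t • v) (𝓝 0) (𝓝 x) := by
  have hcont : Continuous fun t : ℝ => x + t • v := by fun_prop
  simpa using hcont.tendsto 0

theorem differentiableAt_fderiv_apply {E : Type*} [NormedAddCommGroup E] [NormedSpace ℝ E]
    {h : E → ℝ} {x : E} (hh : ContDiffAt ℝ 2 h x) (v : E) :
    DifferentiableAt ℝ (fun z => fderiv ℝ h z v) x :=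
  ((hh.fderiv_right (m := 1) (by norm_num)).differentiableAt (by norm_num)).clm_apply
    (differentiableAt_const v)

theorem eventually_differentiableAt {E : Type*} [NormedAddCommGroup E] [NormedSpace ℝ E]
    {h : E → ℝ} {x : E} (hh : ContDiffAt ℝ 2 h x) : ∀ᶠ z in 𝓝 x, DifferentiableAt ℝ h z :=
  (hh.eventually (by simp)).mono fun _ hz => hz.differentiableAt (by norm_num)

theorem lapl_nonneg_of_isLocalMin {d : ℕ} {h : EuclideanSpace ℝ (Fin d) → ℝ}
    {x : EuclideanSpace ℝ (Fin d)} (hh : ContDiffAt ℝ 2 h x) (hmin : IsLocalMin h x) :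
    0 ≤ lapl d h x := by
  refine Finset.sum_nonneg fun i _ => ?_
  set e : EuclideanSpace ℝ (Fin d) := EuclideanSpace.single i 1
  have hlim := tendsto_add_smul_nhds x e
  have hmin' : IsLocalMin (fun t : ℝ => h (x + t • e)) 0 := by
    filter_upwards [hlim.eventually hmin] with t ht
    simpa using ht
  have hderiv : deriv (fun t : ℝ => h (x + t • e)) =ᶠ[𝓝 0]
      fun t => fderiv ℝ h (x + t • e) e := by
    filter_upwards [hlim.eventually (eventually_differentiableAt hh)] with t ht
    exact (hasDerivAt_comp_add_smul ht).deriv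
  have hcont : ContinuousAt (fun t : ℝ => h (x + t • e)) 0 :=
    (hasDerivAt_comp_add_smul (by
      simpa using hh.differentiableAt (by norm_num))).continuousAt
  have hsecond := deriv_deriv_nonneg_of_isLocalMin hmin' hcont
  rw [hderiv.deriv_eq, (hasDerivAt_comp_add_smul (h := fun z => fderiv ℝ h z e) (by
    simpa using differentiableAt_fderiv_apply hh e)).deriv] at hsecond
  simpa [hessC, e] using hsecond

theorem lapl_sub {d : ℕ} {w φ : EuclideanSpace ℝ (Fin d) → ℝ} {x : EuclideanSpace ℝ (Fin d)}
    (hw : ContDiffAt ℝ 2 w x) (hφ : ContDiffAt ℝ 2 φ x) :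
    lapl d (fun z => w z - φ z) x = lapl d w x - lapl d φ x := by
  unfold lapl
  rw [← Finset.sum_sub_distrib]
  refine Finset.sum_congr rfl fun i _ => ?_
  have heq : (fun z => fderiv ℝ (fun y => w y - φ y) z (EuclideanSpace.single i 1)) =ᶠ[𝓝 x]
      fun z => fderiv ℝ w z (EuclideanSpace.single i 1) -
        fderiv ℝ φ z (EuclideanSpace.single i 1) := by
    filter_upwards [eventually_differentiableAt hw, eventually_differentiableAt hφ] with z h₁ h₂
    rw [fderiv_fun_sub h₁ h₂, sub_apply]
  unfold hessC
  rw [heq.fderiv_eq, fderiv_fun_sub (differentiableAt_fderiv_apply hw _)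
    (differentiableAt_fderiv_apply hφ _), sub_apply]

theorem lapl_le_of_isLocalMin_sub {d : ℕ} {w φ : EuclideanSpace ℝ (Fin d) → ℝ}
    {x : EuclideanSpace ℝ (Fin d)} (hw : ContDiffAt ℝ 2 w x) (hφ : ContDiffAt ℝ 2 φ x)
    (hmin : IsLocalMin (fun z => w z - φ z) x) : lapl d φ x ≤ lapl d w x := by
  have h := lapl_nonneg_of_isLocalMin (hw.sub hφ) hmin
  rw [lapl_sub hw hφ] at h
  linarith

theorem eventually_pos_of_hasDerivAt {f : ℝ → ℝ} {f' : ℝ} (hf : HasDerivAt f f' 0)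
    (h₀ : f 0 = 0) (hpos : 0 < f') : ∀ᶠ t in 𝓝[>] (0 : ℝ), 0 < f t := by
  filter_upwards [hf.tendsto_slope_zero_right.eventually (lt_mem_nhds hpos),
    self_mem_nhdsWithin] with t ht ht₀
  simp only [zero_add, h₀, sub_zero, smul_eq_mul] at ht
  exact (pos_iff_pos_of_mul_pos ht).mp (inv_pos.mpr ht₀)

/-- A function touching `w₊` from below at a zero of `w` has a gradient no larger than that
of `w`. -/
theorem norm_fderiv_le_of_isLocalMin_posPart_sub {E : Type*} [NormedAddCommGroup E]
    [NormedSpace ℝ E] {w φ : E → ℝ} {x : E} (hw : DifferentiableAt ℝ w x)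
    (hφ : DifferentiableAt ℝ φ x) (hw₀ : w x = 0) (hφ₀ : φ x = 0)
    (hmin : IsLocalMin (fun z => max (w z) 0 - φ z) x) :
    ‖fderiv ℝ φ x‖ ≤ ‖fderiv ℝ w x‖ := by
  have key (v : E) : fderiv ℝ φ x v ≤ max (fderiv ℝ w x v) 0 := by
    by_contra! hlt
    obtain ⟨h₁, h₂⟩ := max_lt_iff.mp hlt
    have hdφ : HasDerivAt (fun t : ℝ => φ (x + t • v)) (fderiv ℝ φ x v) 0 := by
      simpa using hasDerivAt_comp_add_smul (h := φ) (x := x) (v := v) (t := 0) (by simpa using hφ)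
    have hdw : HasDerivAt (fun t : ℝ => w (x + t • v)) (fderiv ℝ w x v) 0 := by
      simpa using hasDerivAt_comp_add_smul (h := w) (x := x) (v := v) (t := 0) (by simpa using hw)
    have hlim : Tendsto (fun t : ℝ => x + t • v) (𝓝[>] 0) (𝓝 x) :=
      (tendsto_add_smul_nhds x v).mono_left nhdsWithin_le_nhds
    obtain ⟨t, ht₁, ht₂, ht₃⟩ := ((eventually_pos_of_hasDerivAt hdφ (by simpa using hφ₀) h₂).and
      ((eventually_pos_of_hasDerivAt (hdφ.sub hdw) (by simp [hφ₀, hw₀]) (sub_pos.mpr h₁)).and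
        (hlim.eventually hmin))).exists
    simp only [hw₀, hφ₀, max_self, sub_self, sub_nonneg] at ht₃
    simp only [Pi.sub_apply, sub_pos] at ht₂
    exact absurd ht₃ (not_le.mpr (max_lt ht₂ ht₁))
  have bound (v : E) : fderiv ℝ φ x v ≤ ‖fderiv ℝ w x‖ * ‖v‖ :=
    (key v).trans (max_le ((le_abs_self _).trans ((fderiv ℝ w x).le_opNorm v)) (by positivity))
  refine ContinuousLinearMap.opNorm_le_bound _ (norm_nonneg _) fun v => abs_le.mpr ⟨?_, bound v⟩
  have h := bound (-v)
  rw [map_neg, norm_neg] at h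
  linarith

/-- The function `x₂ + σ log|x| + s` on the plane. -/
def planarLog (σ s : ℝ) (x : EuclideanSpace ℝ (Fin 2)) : ℝ :=
  x 1 + σ * Real.log ‖x‖ + s

theorem contDiffAt_planarLog (σ s : ℝ) {x : EuclideanSpace ℝ (Fin 2)} (hx : x ≠ 0) :
    ContDiffAt ℝ 2 (planarLog σ s) x := by
  unfold planarLog
  have hcoord : ContDiffAt ℝ 2 (fun z : EuclideanSpace ℝ (Fin 2) => z 1) x :=
    (EuclideanSpace.proj (𝕜 := ℝ) (1 : Fin 2)).contDiff.contDiffAt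
  exact (hcoord.add (contDiffAt_const.mul
    ((contDiffAt_norm ℝ hx).log (norm_ne_zero_iff.mpr hx)))).add contDiffAt_const

theorem hasFDerivAt_planarLog (σ s : ℝ) {x : EuclideanSpace ℝ (Fin 2)} (hx : x ≠ 0) :
    HasFDerivAt (planarLog σ s)
      (EuclideanSpace.proj (1 : Fin 2) + (σ / ‖x‖ ^ 2) • innerSL ℝ x) x := by
  have hlog : HasFDerivAt (fun z : EuclideanSpace ℝ (Fin 2) => Real.log (‖z‖ ^ 2)) _ x :=
    (hasStrictFDerivAt_norm_sq x).hasFDerivAt.log (pow_ne_zero 2 (norm_ne_zero_iff.mpr hx))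
  have hsum := ((EuclideanSpace.proj (𝕜 := ℝ) (1 : Fin 2)).hasFDerivAt.add
    (hlog.const_mul (σ / 2))).add_const s
  refine (hsum.congr_fderiv ?_).congr_of_eventuallyEq (.of_forall fun z => ?_)
  · ext v
    simp
    ring
  · simp [planarLog]
    ring

theorem fderiv_planarLog_single (σ s : ℝ) {x : EuclideanSpace ℝ (Fin 2)} (hx : x ≠ 0)
    (i : Fin 2) : fderiv ℝ (planarLog σ s) x (EuclideanSpace.single i 1) =
      EuclideanSpace.single (𝕜 := ℝ) i 1 1 + σ * (x i / ‖x‖ ^ 2) := by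
  rw [(hasFDerivAt_planarLog σ s hx).fderiv]
  simp [EuclideanSpace.inner_single_right]
  ring

theorem hessC_planarLog_diag (σ s : ℝ) {x : EuclideanSpace ℝ (Fin 2)} (hx : x ≠ 0)
    (i : Fin 2) : hessC 2 (planarLog σ s) x i i =
      σ * (1 / ‖x‖ ^ 2 - 2 * x i ^ 2 / (‖x‖ ^ 2) ^ 2) := by
  have heq : (fun z => fderiv ℝ (planarLog σ s) z (EuclideanSpace.single i 1)) =ᶠ[𝓝 x]
      fun z => EuclideanSpace.single (𝕜 := ℝ) i 1 1 + σ * (z i / ‖z‖ ^ 2) := by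
    filter_upwards [isOpen_ne.mem_nhds hx] with z hz using fderiv_planarLog_single σ s hz i
  have hN : ‖x‖ ^ 2 ≠ 0 := pow_ne_zero 2 (norm_ne_zero_iff.mpr hx)
  have hdiv := (((EuclideanSpace.proj (𝕜 := ℝ) i).hasFDerivAt (x := x)).fun_mul
    ((hasDerivAt_inv hN).comp_hasFDerivAt x
      (hasStrictFDerivAt_norm_sq x).hasFDerivAt)).const_mul σ
  have hfin := hdiv.const_add (EuclideanSpace.single (𝕜 := ℝ) i 1 1)
  unfold hessC
  rw [heq.fderiv_eq]
  have := hfin.fderiv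
  simp only [Function.comp_def, PiLp.proj_apply, ← div_eq_mul_inv] at this
  rw [this]
  simp [EuclideanSpace.inner_single_right]
  field_simp
  ring

theorem lapl_planarLog (σ s : ℝ) {x : EuclideanSpace ℝ (Fin 2)} (hx : x ≠ 0) :
    lapl 2 (planarLog σ s) x = 0 := by
  have hN : ‖x‖ ^ 2 ≠ 0 := pow_ne_zero 2 (norm_ne_zero_iff.mpr hx)
  have hsq : ‖x‖ ^ 2 = x 0 ^ 2 + x 1 ^ 2 := by
    simp [EuclideanSpace.norm_sq_eq, Fin.sum_univ_two]
  rw [lapl, Fin.sum_univ_two, hessC_planarLog_diag σ s hx, hessC_planarLog_diag σ s hx]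
  field_simp
  rw [hsq]
  ring

theorem norm_fderiv_planarLog_sq (σ s : ℝ) {x : EuclideanSpace ℝ (Fin 2)} (hx : x ≠ 0) :
    ‖fderiv ℝ (planarLog σ s) x‖ ^ 2 = 1 + (2 * σ * x 1 + σ ^ 2) / ‖x‖ ^ 2 := by
  have hN : ‖x‖ ≠ 0 := norm_ne_zero_iff.mpr hx
  have hgrad : fderiv ℝ (planarLog σ s) x =
      innerSL ℝ (EuclideanSpace.single 1 1 + (σ / ‖x‖ ^ 2) • x) := by
    rw [(hasFDerivAt_planarLog σ s hx).fderiv]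
    ext v
    simp [EuclideanSpace.inner_single_left]
  rw [hgrad, innerSL_apply_norm, norm_add_sq_real, norm_smul, inner_smul_right,
    EuclideanSpace.inner_single_left, mul_pow, Real.norm_eq_abs, sq_abs]
  simp
  field_simp
  ring

theorem norm_fderiv_planarLog_le_one {σ s : ℝ} (hσs : 0 ≤ σ * s)
    {x : EuclideanSpace ℝ (Fin 2)} (hx : 3 < ‖x‖) (hzero : planarLog σ s x = 0) :
    ‖fderiv ℝ (planarLog σ s) x‖ ≤ 1 := by
  have hlog : 1 ≤ Real.log ‖x‖ :=
    (Real.le_log_iff_exp_le (by linarith)).mpr (by linarith [Real.exp_one_lt_d9])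
  have hx₁ : x 1 = -(σ * Real.log ‖x‖) - s := by
    unfold planarLog at hzero
    linarith
  have hnum : 2 * σ * x 1 + σ ^ 2 ≤ 0 := by
    rw [hx₁]
    nlinarith [mul_nonneg (sq_nonneg σ) (sub_nonneg.mpr hlog), sq_nonneg σ]
  rw [← sq_le_one_iff₀ (norm_nonneg _),
    norm_fderiv_planarLog_sq σ s (norm_pos_iff.mp (by linarith))]
  linarith [div_nonpos_of_nonpos_of_nonneg hnum (sq_nonneg ‖x‖)]

/-- The function `φ(x) = (x₂ + σ log|x| + s)₊` with `σ·s ≥ 0` is a viscosity supersolution of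
the homogeneous Bernoulli problem in `{|x| > 3}`. -/
theorem stmt13 (σ s : ℝ) (hσs : 0 ≤ σ * s) :
    IsViscSupersol 2 {x : EuclideanSpace ℝ (Fin 2) | 3 < ‖x‖} (fun _ => 1)
      (fun x => max (x 1 + σ * Real.log ‖x‖ + s) 0) := by
  have hopen : IsOpen {x : EuclideanSpace ℝ (Fin 2) | 3 < ‖x‖} :=
    isOpen_lt continuous_const continuous_norm
  have hne {x : EuclideanSpace ℝ (Fin 2)} (hx : 3 < ‖x‖) : x ≠ 0 :=
    norm_pos_iff.mp (by linarith)
  change IsViscSupersol 2 _ _ fun x => max (planarLog σ s x) 0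
  refine ⟨fun x hx => ContinuousAt.continuousWithinAt
    ((contDiffAt_planarLog σ s (hne hx)).continuousAt.max continuousAt_const), fun x _ => le_max_right _ _, ?_⟩
  intro φ hφ x hx hmin htouch
  have hφx : ContDiffAt ℝ 2 φ x :=
    (hφ.contDiffAt (hopen.mem_nhds hx)).of_le (by norm_cast)
  have hw := contDiffAt_planarLog σ s (hne hx)
  have hmin : IsLocalMin (fun z => max (planarLog σ s z) 0 - φ z) x :=
    hmin.isLocalMin (hopen.mem_nhds hx)
  rcases lt_trichotomy (planarLog σ s x) 0 with hneg | hzero | hpos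
  · left
    have heq : (fun z => max (planarLog σ s z) 0 - φ z) =ᶠ[𝓝 x] fun z => 0 - φ z := by
      filter_upwards [hw.continuousAt.eventually (gt_mem_nhds hneg)] with z hz
      rw [max_eq_right hz.le]
    have h := lapl_le_of_isLocalMin_sub contDiffAt_const hφx (hmin.congr heq)
    simpa [lapl, hessC] using h
  · right
    have hφ₀ : φ x = 0 := by
      rw [← htouch]
      simp [hzero]
    exact ⟨hφ₀, (norm_fderiv_le_of_isLocalMin_posPart_sub (hw.differentiableAt (by norm_num))
      (hφx.differentiableAt (by norm_num)) hzero hφ₀ hmin).trans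
        (norm_fderiv_planarLog_le_one hσs hx hzero)⟩
  · left
    have heq : (fun z => max (planarLog σ s z) 0 - φ z) =ᶠ[𝓝 x]
        fun z => planarLog σ s z - φ z := by
      filter_upwards [hw.continuousAt.eventually (lt_mem_nhds hpos)] with z hz
      rw [max_eq_left hz.le]
    exact (lapl_le_of_isLocalMin_sub hw hφx (hmin.congr heq)).trans
      (lapl_planarLog σ s (hne hx)).le
end
end

section
/- Let u be a continuous nonnegative function on the closed unit ball of ℝ^d which is a viscosity solution of the homogeneous Bernoulli problem in the open unit ball B₁, and suppose u(x) ≥ (x_d)₊ for all x ∈ B₁ and 0 ∈ ∂{u>0}. Then u(x) = x_d for every x ∈ B₁ with x_d > 0. -/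
open Real Set Filter Metric MeasureTheory

noncomputable section

/-- The Hopf barrier: a linear function plus a Gaussian bump centred at `p`, plus a constant. -/
def hopfBarrier {d : ℕ} (l : EuclideanSpace ℝ (Fin d) →L[ℝ] ℝ) (p : EuclideanSpace ℝ (Fin d))
    (a ε k : ℝ) (x : EuclideanSpace ℝ (Fin d)) : ℝ :=
  l x + ε * Real.exp (-a * ‖x - p‖ ^ 2) + k

section HopfBarrier

variable {d : ℕ} (l : EuclideanSpace ℝ (Fin d) →L[ℝ] ℝ) (p : EuclideanSpace ℝ (Fin d)) (a ε k : ℝ)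

lemma contDiff_hopfBarrier : ContDiff ℝ (⊤ : ℕ∞) (hopfBarrier l p a ε k) := by
  unfold hopfBarrier
  have h : ContDiff ℝ (⊤ : ℕ∞) fun x : EuclideanSpace ℝ (Fin d) => ‖x - p‖ ^ 2 :=
    (contDiff_id.sub contDiff_const).norm_sq ℝ
  exact (l.contDiff.add (contDiff_const.mul (contDiff_const.mul h).exp)).add contDiff_const

lemma hasFDerivAt_gaussian (x : EuclideanSpace ℝ (Fin d)) :
    HasFDerivAt (fun x => Real.exp (-a * ‖x - p‖ ^ 2))
      ((-(2 * a) * Real.exp (-a * ‖x - p‖ ^ 2)) • innerSL ℝ (x - p)) x := by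
  have h : HasFDerivAt (fun x : EuclideanSpace ℝ (Fin d) => ‖x - p‖ ^ 2)
      (2 • innerSL ℝ (x - p)) x := by
    simpa using ((hasFDerivAt_id x).sub_const p).norm_sq
  refine (h.const_mul (-a)).exp.congr_fderiv ?_
  ext v
  simp
  ring

lemma fderiv_hopfBarrier (x : EuclideanSpace ℝ (Fin d)) :
    fderiv ℝ (hopfBarrier l p a ε k) x =
      l + (2 * a * ε * Real.exp (-a * ‖x - p‖ ^ 2)) • innerSL ℝ (p - x) := by
  have h : HasFDerivAt (hopfBarrier l p a ε k) _ x :=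
    (l.hasFDerivAt.add ((hasFDerivAt_gaussian p a x).const_mul ε)).add_const k
  rw [h.fderiv]
  ext v
  simp only [add_apply, smul_apply, innerSL_apply_apply,
    smul_eq_mul, ← neg_sub x p, inner_neg_left]
  ring

lemma lapl_hopfBarrier (x : EuclideanSpace ℝ (Fin d)) :
    lapl d (hopfBarrier l p a ε k) x =
      ε * Real.exp (-a * ‖x - p‖ ^ 2) * (4 * a ^ 2 * ‖x - p‖ ^ 2 - 2 * a * d) := by
  have hess (i : Fin d) : hessC d (hopfBarrier l p a ε k) x i i =
      ε * Real.exp (-a * ‖x - p‖ ^ 2) * (4 * a ^ 2 * (x i - p i) ^ 2 - 2 * a) := by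
    unfold hessC
    have hfun : (fun z => fderiv ℝ (hopfBarrier l p a ε k) z (EuclideanSpace.single i 1)) =
        fun z => l (EuclideanSpace.single i 1) +
          2 * a * ε * (Real.exp (-a * ‖z - p‖ ^ 2) * (p i - z i)) := by
      funext z
      simp only [fderiv_hopfBarrier, add_apply,
        smul_apply, innerSL_apply_apply, smul_eq_mul,
        EuclideanSpace.inner_single_right, PiLp.sub_apply]
      simp
      ring
    have hi : HasFDerivAt (fun z : EuclideanSpace ℝ (Fin d) => p i - z i)
        (-(EuclideanSpace.proj i : EuclideanSpace ℝ (Fin d) →L[ℝ] ℝ)) x :=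
      (EuclideanSpace.proj i : EuclideanSpace ℝ (Fin d) →L[ℝ] ℝ).hasFDerivAt.const_sub (p i)
    have h : HasFDerivAt (fun z => l (EuclideanSpace.single i 1) +
        2 * a * ε * (Real.exp (-a * ‖z - p‖ ^ 2) * (p i - z i))) _ x :=
      (((hasFDerivAt_gaussian p a x).mul hi).const_mul (2 * a * ε)).const_add _
    rw [hfun, h.fderiv]
    simp only [add_apply, neg_apply,
      smul_apply, innerSL_apply_apply, smul_eq_mul,
      EuclideanSpace.inner_single_right, PiLp.sub_apply]
    simp
    ring
  have hn : ‖x - p‖ ^ 2 = ∑ i, (x i - p i) ^ 2 := by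
    simp [EuclideanSpace.norm_sq_eq]
  simp only [lapl, hess]
  rw [← Finset.mul_sum, Finset.sum_sub_distrib, ← Finset.mul_sum, ← hn]
  simp
  ring_nf
  simp

end HopfBarrier

/-- Hopf lemma for viscosity supersolutions: if `u` lies above a linear function `l`, strictly so
in a ball on which `u` is positive, then a contact point on the boundary of the ball is a zero
of `u` where `l` tilted in the inner normal direction still has slope at most `Q`. -/
lemma IsViscSupersol.hopf {d : ℕ} (hd : 0 < d) {U : Set (EuclideanSpace ℝ (Fin d))}
    {Q u : EuclideanSpace ℝ (Fin d) → ℝ} (hu : IsViscSupersol d U Q u)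
    {l : EuclideanSpace ℝ (Fin d) →L[ℝ] ℝ} (hl : ∀ x ∈ U, l x ≤ u x)
    {p z : EuclideanSpace ℝ (Fin d)} {r : ℝ} (hr : 0 < r) (hU : closedBall p r ⊆ U)
    (hlt : ∀ x ∈ ball p r, l x < u x) (hpos : ∀ x ∈ ball p r, 0 < u x)
    (hz : z ∈ sphere p r) (huz : u z = l z) :
    ∃ c : ℝ, 0 < c ∧ u z = 0 ∧ ‖l + c • innerSL ℝ (p - z)‖ ≤ Q z := by
  obtain ⟨hcont, -, htest⟩ := hu
  have hd' : (0 : ℝ) < d := Nat.cast_pos.2 hd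
  obtain ⟨a, ha, har⟩ : ∃ a : ℝ, 0 < a ∧ a * r ^ 2 = 3 * d :=
    ⟨3 * d / r ^ 2, by positivity, by field_simp⟩
  have hlapl {ε k : ℝ} (hε : 0 < ε) {x : EuclideanSpace ℝ (Fin d)} (hx : r / 2 ≤ ‖x - p‖) :
      0 < lapl d (hopfBarrier l p a ε k) x := by
    rw [lapl_hopfBarrier]
    have h1 : (r / 2) ^ 2 ≤ ‖x - p‖ ^ 2 := by gcongr
    have h2 : a * (r / 2) ^ 2 ≤ a * ‖x - p‖ ^ 2 := by gcongr
    have h3 : 0 < 4 * (a * ‖x - p‖ ^ 2) - 2 * d := by nlinarith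
    have h4 : 4 * a ^ 2 * ‖x - p‖ ^ 2 - 2 * a * d = a * (4 * (a * ‖x - p‖ ^ 2) - 2 * d) := by ring
    rw [h4]
    positivity
  have hsub : sphere p (r / 2) ⊆ ball p r := fun x hx => by
    simp only [mem_sphere, mem_ball] at *
    linarith
  obtain ⟨ε, hε, hεle⟩ : ∃ ε, 0 < ε ∧ ∀ x ∈ sphere p (r / 2), ε ≤ u x - l x :=
    (isCompact_sphere p (r / 2)).exists_forall_le'
      ((hcont.mono ((hsub.trans ball_subset_closedBall).trans hU)).sub l.continuous.continuousOn)
      fun x hx => sub_pos.2 (hlt x (hsub hx))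
  set k : ℝ := -(ε * Real.exp (-a * r ^ 2)) with hk
  set φ := hopfBarrier l p a ε k with hφ
  set K := closedBall p r \ ball p (r / 2)
  have hKU : K ⊆ U := sdiff_subset.trans hU
  have hKc : IsCompact K := (isCompact_closedBall p r).diff isOpen_ball
  have hzr : ‖z - p‖ = r := by simpa [dist_eq_norm] using hz
  have hzK : z ∈ K := ⟨sphere_subset_closedBall hz, by simp [dist_eq_norm, hzr]; linarith⟩
  have hφr (x) (hx : ‖x - p‖ = r) : φ x = l x := by simp [hφ, hopfBarrier, hx, hk]
  have hφcont : Continuous φ := (contDiff_hopfBarrier l p a ε k).continuous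
  obtain ⟨x₀, hx₀, hmin⟩ := hKc.exists_isMinOn ⟨z, hzK⟩
    ((hcont.mono hKU).sub hφcont.continuousOn)
  have hx₀r : ‖x₀ - p‖ ≤ r := by simpa [dist_eq_norm] using hx₀.1
  have hx₀r' : r / 2 ≤ ‖x₀ - p‖ := by simpa [dist_eq_norm] using hx₀.2
  have hnonneg : 0 ≤ u x₀ - φ x₀ := by
    by_contra! hneg
    have hlt₀ : ‖x₀ - p‖ < r := lt_of_le_of_ne hx₀r fun h => by
      have := hl x₀ (hKU hx₀)
      rw [hφr x₀ h] at hneg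
      linarith
    have hgt₀ : r / 2 < ‖x₀ - p‖ := lt_of_le_of_ne hx₀r' fun h => by
      have h1 := hεle x₀ (by simp [← h])
      have h2 : Real.exp (-a * ‖x₀ - p‖ ^ 2) ≤ 1 :=
        Real.exp_le_one_iff.2 (by nlinarith [mul_nonneg ha.le (sq_nonneg ‖x₀ - p‖)])
      have h3 : 0 < ε * Real.exp (-a * r ^ 2) := by positivity
      have h4 : φ x₀ = l x₀ + ε * Real.exp (-a * ‖x₀ - p‖ ^ 2) + k := rfl
      nlinarith
    have hnhds : K ∈ nhds x₀ := by
      have hmem : x₀ ∈ ball p r ∩ (closedBall p (r / 2))ᶜ := by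
        simp [dist_eq_norm, hlt₀, hgt₀]
      refine mem_of_superset ((isOpen_ball.inter isClosed_closedBall.isOpen_compl).mem_nhds hmem) ?_
      exact fun y hy => ⟨ball_subset_closedBall hy.1, fun h => hy.2 (ball_subset_closedBall h)⟩
    have hshift (y) : hopfBarrier l p a ε (k + (u x₀ - φ x₀)) y = φ y + (u x₀ - φ x₀) := by
      simp only [hφ, hopfBarrier]
      ring
    rcases htest _ (contDiff_hopfBarrier l p a ε (k + (u x₀ - φ x₀))).contDiffOn x₀ (hKU hx₀)
      (by
        refine IsLocalMin.on ?_ U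
        filter_upwards [hnhds] with y hy
        have : u x₀ - φ x₀ ≤ u y - φ y := hmin hy
        simp only [hshift]
        linarith) (by rw [hshift]; ring) with h | h
    · exact absurd h (not_le.2 (hlapl hε hx₀r'))
    · have := hpos x₀ (by simpa [dist_eq_norm] using hlt₀)
      have h1 := h.1
      rw [hshift] at h1
      linarith
  have hlocmin : IsLocalMinOn (fun y => u y - φ y) U z := by
    have hopen : (closedBall p (r / 2))ᶜ ∈ nhds z :=
      isClosed_closedBall.isOpen_compl.mem_nhds (by simp [dist_eq_norm, hzr]; linarith)
    filter_upwards [mem_nhdsWithin_of_mem_nhds hopen, self_mem_nhdsWithin] with y hy hyU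
    rw [hφr z hzr, huz, sub_self]
    rcases le_or_gt ‖y - p‖ r with h | h
    · exact hnonneg.trans (hmin ⟨by simpa [dist_eq_norm] using h,
        fun h' => hy (ball_subset_closedBall h')⟩)
    · have h1 : Real.exp (-a * ‖y - p‖ ^ 2) ≤ Real.exp (-a * r ^ 2) := by
        apply Real.exp_le_exp.2
        have : r ^ 2 ≤ ‖y - p‖ ^ 2 := by gcongr
        nlinarith
      have h2 := hl y hyU
      have h3 : φ y = l y + ε * Real.exp (-a * ‖y - p‖ ^ 2) + k := rfl
      nlinarith
  refine ⟨2 * a * ε * Real.exp (-a * ‖z - p‖ ^ 2), by positivity, ?_⟩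
  rcases htest φ (contDiff_hopfBarrier l p a ε k).contDiffOn z (hKU hzK) hlocmin
    (by rw [hφr z hzr, huz]) with h | h
  · exact absurd h (not_le.2 (hlapl hε (by linarith)))
  · rw [hφr z hzr, hφ, fderiv_hopfBarrier] at h
    exact ⟨huz.trans h.1, h.2⟩

/-- Strong maximum principle: a viscosity supersolution above a linear function `l` that is
strictly above `l` somewhere in a connected open set of positivity is so everywhere in it. -/
lemma IsViscSupersol.lt_of_exists_lt {d : ℕ} (hd : 0 < d) {U V : Set (EuclideanSpace ℝ (Fin d))}
    {Q u : EuclideanSpace ℝ (Fin d) → ℝ} (hu : IsViscSupersol d U Q u)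
    {l : EuclideanSpace ℝ (Fin d) →L[ℝ] ℝ} (hl : ∀ x ∈ U, l x ≤ u x)
    (hV : IsOpen V) (hVc : IsPreconnected V) (hVU : V ⊆ U) (hpos : ∀ x ∈ V, 0 < u x)
    (hex : ∃ x ∈ V, l x < u x) : ∀ x ∈ V, l x < u x := by
  set N := {x ∈ V | l x < u x} with hN
  have hcontV : ContinuousOn u V := hu.1.mono hVU
  have hNopen : IsOpen N := by
    have h := (hcontV.sub l.continuous.continuousOn).isOpen_inter_preimage hV
      (isOpen_Ioi (a := (0 : ℝ)))
    convert h using 1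
    ext x
    simp [hN]
  suffices h : V ⊆ N from fun x hx => (h hx).2
  refine hVc.subset_of_closure_inter_subset hNopen (by
    obtain ⟨x, hx, hx'⟩ := hex
    exact ⟨x, hx, hx, hx'⟩) ?_
  rintro z ⟨hzN, hzV⟩
  refine ⟨hzV, lt_of_le_of_ne (hl z (hVU hzV)) fun hzeq => ?_⟩
  obtain ⟨ρ, hρ, hρV⟩ := Metric.isOpen_iff.1 hV z hzV
  obtain ⟨p, hpN, hzp⟩ := Metric.mem_closure_iff.1 hzN (ρ / 2) (by linarith)
  have hzNc : z ∈ Nᶜ := fun h => h.2.ne hzeq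
  obtain ⟨w, hwN, hw⟩ := hNopen.isClosed_compl.exists_infDist_eq_dist ⟨z, hzNc⟩ p
  have hle : dist p w ≤ dist z p := by
    rw [← hw, dist_comm z p]
    exact infDist_le_dist_of_mem hzNc
  have hcb : closedBall p (dist p w) ⊆ V := fun y hy => hρV <| by
    have h1 : dist y p ≤ dist p w := hy
    have h2 := dist_triangle y p z
    rw [mem_ball]
    linarith [dist_comm p z]
  have hball : ball p (dist p w) ⊆ N := fun y hy => by
    by_contra hyN
    have h1 := infDist_le_dist_of_mem (x := p) (show y ∈ Nᶜ from hyN)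
    rw [hw, dist_comm p y] at h1
    exact absurd hy (not_lt.2 h1)
  have hwV : w ∈ V := hcb (by simp [dist_comm])
  have hweq : u w = l w :=
    le_antisymm (not_lt.1 fun h => hwN ⟨hwV, h⟩) (hl w (hVU hwV))
  have hr : 0 < dist p w := dist_pos.2 fun h => hwN (h ▸ hpN)
  obtain ⟨-, -, h0, -⟩ := hu.hopf hd hl hr (hcb.trans hVU) (fun x hx => (hball hx).2)
    (fun x hx => hpos x (hball hx).1) (mem_sphere.2 (dist_comm w p)) hweq
  exact (hpos w hwV).ne' h0

/-- Strong maximum principle: a viscosity solution above `(x_d)₊` with `0` on the free boundary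
equals `x_d` on the upper half ball. -/
theorem stmt16 (d : ℕ) (hd : 0 < d) (u : EuclideanSpace ℝ (Fin d) → ℝ)
    (hc : ContinuousOn u (Metric.closedBall 0 1))
    (hnn : ∀ x ∈ Metric.closedBall (0 : EuclideanSpace ℝ (Fin d)) 1, 0 ≤ u x)
    (hsol : IsViscSol d (Metric.ball 0 1) (fun _ => 1) u)
    (hlow : ∀ x ∈ Metric.ball (0 : EuclideanSpace ℝ (Fin d)) 1,
      max (x ⟨d - 1, by omega⟩) 0 ≤ u x)
    (h0 : (0 : EuclideanSpace ℝ (Fin d)) ∈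
      frontier {x ∈ Metric.ball (0 : EuclideanSpace ℝ (Fin d)) 1 | 0 < u x}) :
    ∀ x ∈ Metric.ball (0 : EuclideanSpace ℝ (Fin d)) 1, 0 < x ⟨d - 1, by omega⟩ →
      u x = x ⟨d - 1, by omega⟩ := by
  set j : Fin d := ⟨d - 1, by omega⟩
  set l : EuclideanSpace ℝ (Fin d) →L[ℝ] ℝ := EuclideanSpace.proj j
  have hlx (x : EuclideanSpace ℝ (Fin d)) : l x = x j := rfl
  have hsup := hsol.2
  have hl : ∀ x ∈ ball (0 : EuclideanSpace ℝ (Fin d)) 1, l x ≤ u x := fun x hx =>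
    (le_max_left _ _).trans (hlow x hx)
  set V := {x ∈ ball (0 : EuclideanSpace ℝ (Fin d)) 1 | 0 < l x}
  have hV : IsOpen V := isOpen_ball.inter (isOpen_lt continuous_const l.continuous)
  have hVc : IsPreconnected V :=
    ((convex_ball 0 1).inter (convex_halfSpace_gt l.isLinear 0)).isPreconnected
  have hpos : ∀ x ∈ V, 0 < u x := fun x hx => hx.2.trans_le (hl x hx.1)
  have hu0 : u 0 = 0 := by
    have hopen : IsOpen {x ∈ ball (0 : EuclideanSpace ℝ (Fin d)) 1 | 0 < u x} :=
      hsup.1.isOpen_inter_preimage isOpen_ball (isOpen_Ioi (a := (0 : ℝ)))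
    rw [hopen.frontier_eq] at h0
    have h0b : (0 : EuclideanSpace ℝ (Fin d)) ∈ ball (0 : EuclideanSpace ℝ (Fin d)) 1 := by simp
    exact le_antisymm (not_lt.1 fun h => h0.2 ⟨h0b, h⟩) (hsup.2.1 0 h0b)
  intro x hx hxj
  by_contra hne
  have hlt := hsup.lt_of_exists_lt hd hl hV hVc (fun _ h => h.1) hpos
    ⟨x, ⟨hx, hxj⟩, lt_of_le_of_ne (hl x hx) (Ne.symm hne)⟩
  set p : EuclideanSpace ℝ (Fin d) := EuclideanSpace.single j (1 / 4) with hp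
  have hpn : ‖p‖ = 1 / 4 := by rw [hp, PiLp.norm_single]; norm_num
  have hcb : closedBall p (1 / 4) ⊆ ball 0 1 := fun y hy => by
    rw [mem_closedBall, dist_eq_norm] at hy
    rw [mem_ball_zero_iff]
    have := norm_le_norm_add_norm_sub' y p
    linarith
  have hball : ball p (1 / 4) ⊆ V := fun y hy => by
    refine ⟨hcb (ball_subset_closedBall hy), ?_⟩
    rw [mem_ball, dist_eq_norm] at hy
    have h1 : |y j - 1 / 4| ≤ ‖y - p‖ := by
      simpa [hp] using PiLp.norm_apply_le (y - p) j
    rw [hlx]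
    linarith [neg_abs_le (y j - 1 / 4)]
  obtain ⟨c, hc0, -, hnorm⟩ := hsup.hopf hd hl (by norm_num) hcb (fun y hy => hlt y (hball hy))
    (fun y hy => hpos y (hball hy)) (z := 0) (by simp [hpn]) (by rw [hu0, map_zero])
  have hle := (l + c • innerSL ℝ (p - 0)).le_opNorm (EuclideanSpace.single j 1)
  have hval : (l + c • innerSL ℝ (p - 0)) (EuclideanSpace.single j 1) = 1 + c * (1 / 4) := by
    simp [hlx, hp, EuclideanSpace.inner_single_right]
  rw [hval, PiLp.norm_single, norm_one, mul_one, Real.norm_eq_abs] at hle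
  linarith [le_abs_self (1 + c * (1 / 4))]
end
end
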